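/- (Reflection formula for minor determinants of the on-shell Bessel moment matrix.) For every integer k ≥ 2: det( IKM(2a, 2(k−a)+1; 2b−1) )_{1≤a,b≤⌊k/2⌋} = π^{−⌊(k+1)/2⌋} · ((2k+1)!!)^{(2−(−1)^k)/2} / ( 2^{⌊k/2⌋}·(k−1)!!·(k!!)^{1−(−1)^k} ) · det( IKM(2a−1, 2(k−a+1); 2b−1) )_{1≤a,b≤⌊(k+1)/2⌋}, where ((2k+1)!!)^{(2−(−1)^k)/2} denotes the real power (so it equals √((2k+1)!!) for k even and ((2k+1)!!)^{3/2} for k odd), and (k!!)^{1−(−1)^k} equals 1 for k even and (k!!)² for k odd. -/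

import Mathlib

open scoped BigOperators
open Matrix Polynomial Filter

/-- The modified Bessel function `I₀`. -/
noncomputable def besselI0 (t : ℝ) : ℝ :=
  (1 / Real.pi) * ∫ θ in (0:ℝ)..Real.pi, Real.exp (t * Real.cos θ)

/-- The modified Bessel function `K₀`. -/
noncomputable def besselK0 (t : ℝ) : ℝ :=
  ∫ v in Set.Ioi (0:ℝ), Real.exp (-(t * Real.cosh v))

/-- On-shell Bessel moment `IKM(a,b;n)`. -/
noncomputable def IKM (a b n : ℕ) : ℝ :=
  ∫ t in Set.Ioi (0:ℝ), besselI0 t ^ a * besselK0 t ^ b * t ^ n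



section PartA
open MeasureTheory Topology

noncomputable def HG (g : ℝ → ℝ) (z : ℂ) : ℂ :=
  ∫ θ in (0:ℝ)..Real.pi, (g θ : ℂ) * Complex.exp (z * (Real.cos θ : ℂ))

lemma norm_exp_mul_cos_le (z : ℂ) (θ : ℝ) :
    ‖Complex.exp (z * (Real.cos θ : ℂ))‖ ≤ Real.exp |z.re| := by
  rw [Complex.norm_exp]
  apply Real.exp_le_exp.2
  simp only [Complex.mul_re, Complex.ofReal_re, Complex.ofReal_im, mul_zero, sub_zero]
  calc z.re * Real.cos θ ≤ |z.re * Real.cos θ| := le_abs_self _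
    _ = |z.re| * |Real.cos θ| := abs_mul _ _
    _ ≤ |z.re| * 1 := by gcongr; exact Real.abs_cos_le_one θ
    _ = |z.re| := mul_one _

lemma HG_intervalIntegrable {g : ℝ → ℝ} (hg : IntervalIntegrable g volume 0 Real.pi) (z : ℂ) :
    IntervalIntegrable (fun θ : ℝ => (g θ : ℂ) * Complex.exp (z * (Real.cos θ : ℂ)))
      volume 0 Real.pi := by
  have h : IntervalIntegrable (fun θ => (g θ : ℂ)) volume 0 Real.pi := by
    constructor
    · exact hg.1.ofReal
    · exact hg.2.ofReal
  apply h.mul_continuousOn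
  fun_prop

lemma IntervalIntegrable_mul_cos {g : ℝ → ℝ} (hg : IntervalIntegrable g volume 0 Real.pi) :
    IntervalIntegrable (fun θ => g θ * Real.cos θ) volume 0 Real.pi :=
  hg.mul_continuousOn (by fun_prop)

lemma HG_hasDerivAt {g : ℝ → ℝ} (hg : IntervalIntegrable g volume 0 Real.pi) (z : ℂ) :
    HasDerivAt (HG g) (HG (fun θ => g θ * Real.cos θ) z) z := by
  have := intervalIntegral.hasDerivAt_integral_of_dominated_loc_of_deriv_le (𝕜 := ℂ)
    (μ := volume) (a := 0) (b := Real.pi)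
    (F := fun z θ => (g θ : ℂ) * Complex.exp (z * (Real.cos θ : ℂ)))
    (F' := fun z θ => ((g θ * Real.cos θ : ℝ) : ℂ) * Complex.exp (z * (Real.cos θ : ℂ)))
    (x₀ := z) (s := Metric.ball z 1)
    (bound := fun θ => Real.exp (|z.re| + 1) * ‖g θ * Real.cos θ‖)
    (Metric.ball_mem_nhds z one_pos) ?_ (HG_intervalIntegrable hg z) ?_ ?_ ?_ ?_
  · exact this.2
  · refine Eventually.of_forall fun w => ?_
    have := (HG_intervalIntegrable hg w)
    rw [intervalIntegrable_iff] at this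
    exact this.aestronglyMeasurable
  · have := (HG_intervalIntegrable (IntervalIntegrable_mul_cos hg) z)
    rw [intervalIntegrable_iff] at this
    exact this.aestronglyMeasurable
  · refine Eventually.of_forall fun θ _ w hw => ?_
    rw [norm_mul, mul_comm, Complex.norm_real]
    gcongr
    refine (norm_exp_mul_cos_le w θ).trans (Real.exp_le_exp.2 ?_)
    have h1 : |w.re - z.re| ≤ ‖w - z‖ := by simpa using Complex.abs_re_le_norm (w - z)
    rw [Metric.mem_ball, dist_eq_norm] at hw
    have h2 := abs_sub_abs_le_abs_sub w.re z.re
    linarith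
  · exact (IntervalIntegrable_mul_cos hg).norm.const_mul _
  · refine Eventually.of_forall fun θ _ w hw => ?_
    have h1 : HasDerivAt (fun x : ℂ => x * (Real.cos θ : ℂ)) (Real.cos θ : ℂ) w := by
      simpa using (hasDerivAt_id w).mul_const (Real.cos θ : ℂ)
    refine (h1.cexp.const_mul (g θ : ℂ)).congr_deriv ?_
    push_cast; ring

lemma HG_conj (g : ℝ → ℝ) (z : ℂ) : HG g (starRingEnd ℂ z) = starRingEnd ℂ (HG g z) := by
  unfold HG
  rw [intervalIntegral.integral_of_le Real.pi_pos.le, intervalIntegral.integral_of_le Real.pi_pos.le,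
    ← integral_conj]
  congr 1
  ext θ
  rw [map_mul, ← Complex.exp_conj, map_mul, Complex.conj_ofReal, Complex.conj_ofReal]

lemma HG_even (g : ℝ → ℝ) (hg : ∀ θ, g (Real.pi - θ) = g θ) (z : ℂ) : HG g (-z) = HG g z := by
  unfold HG
  have := intervalIntegral.integral_comp_sub_left (a := 0) (b := Real.pi)
    (fun θ : ℝ => (g θ : ℂ) * Complex.exp (z * (Real.cos θ : ℂ))) Real.pi
  simp only [sub_self, sub_zero] at this
  rw [← this]
  congr 1
  ext θ
  rw [hg, Real.cos_pi_sub]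
  push_cast
  ring_nf

lemma HG_lin (a b : ℂ) {g h : ℝ → ℝ} (hg : IntervalIntegrable g volume 0 Real.pi)
    (hh : IntervalIntegrable h volume 0 Real.pi) (z : ℂ) :
    a * HG g z + b * HG h z = ∫ θ in (0:ℝ)..Real.pi,
      (a * g θ + b * h θ) * Complex.exp (z * (Real.cos θ : ℂ)) := by
  unfold HG
  rw [← intervalIntegral.integral_const_mul, ← intervalIntegral.integral_const_mul,
    ← intervalIntegral.integral_add]
  · congr 1; ext θ; ring
  · exact (HG_intervalIntegrable hg z).const_mul _
  · exact (HG_intervalIntegrable hh z).const_mul _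

noncomputable def Ic (z : ℂ) : ℂ := (1 / Real.pi : ℂ) * HG (fun _ => 1) z
noncomputable def Ic1 (z : ℂ) : ℂ := (1 / Real.pi : ℂ) * HG (fun θ => 1 * Real.cos θ) z
noncomputable def Ic2 (z : ℂ) : ℂ := (1 / Real.pi : ℂ) * HG (fun θ => 1 * Real.cos θ * Real.cos θ) z

lemma ii_one : IntervalIntegrable (fun _ : ℝ => (1:ℝ)) volume 0 Real.pi :=
  Continuous.intervalIntegrable (by fun_prop) _ _

lemma ii_log : IntervalIntegrable (fun θ : ℝ => 2 * Real.log (Real.sin θ)) volume 0 Real.pi :=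
  (intervalIntegrable_log_sin (a := 0) (b := Real.pi)).const_mul 2

noncomputable def E0 (z : ℂ) : ℂ := (-1 / Real.pi : ℂ) * HG (fun θ => 2 * Real.log (Real.sin θ)) z
noncomputable def E01 (z : ℂ) : ℂ :=
  (-1 / Real.pi : ℂ) * HG (fun θ => 2 * Real.log (Real.sin θ) * Real.cos θ) z
noncomputable def E02 (z : ℂ) : ℂ :=
  (-1 / Real.pi : ℂ) * HG (fun θ => 2 * Real.log (Real.sin θ) * Real.cos θ * Real.cos θ) z

lemma Ic_hasDerivAt (z : ℂ) : HasDerivAt Ic (Ic1 z) z := (HG_hasDerivAt ii_one z).const_mul _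
lemma Ic1_hasDerivAt (z : ℂ) : HasDerivAt Ic1 (Ic2 z) z :=
  (HG_hasDerivAt (IntervalIntegrable_mul_cos ii_one) z).const_mul _
lemma E0_hasDerivAt (z : ℂ) : HasDerivAt E0 (E01 z) z := (HG_hasDerivAt ii_log z).const_mul _
lemma E01_hasDerivAt (z : ℂ) : HasDerivAt E01 (E02 z) z :=
  (HG_hasDerivAt (IntervalIntegrable_mul_cos ii_log) z).const_mul _

lemma Ic_conj (z : ℂ) : Ic (starRingEnd ℂ z) = starRingEnd ℂ (Ic z) := by
  simp [Ic, HG_conj]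
lemma E0_conj (z : ℂ) : E0 (starRingEnd ℂ z) = starRingEnd ℂ (E0 z) := by
  simp [E0, HG_conj]
lemma Ic_even (z : ℂ) : Ic (-z) = Ic z := by
  rw [Ic, HG_even _ (fun _ => rfl), Ic]
lemma E0_even (z : ℂ) : E0 (-z) = E0 z := by
  rw [E0, HG_even _ (fun _ => by rw [Real.sin_pi_sub]), E0]

lemma Ic_norm_le (z : ℂ) : ‖Ic z‖ ≤ Real.exp |z.re| := by
  rw [Ic, norm_mul]
  have h := intervalIntegral.norm_integral_le_of_norm_le_const (a := 0) (b := Real.pi)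
    (f := fun θ : ℝ => (((1:ℝ)) : ℂ) * Complex.exp (z * (Real.cos θ : ℂ))) (C := Real.exp |z.re|)
    (fun θ _ => by simpa using norm_exp_mul_cos_le z θ)
  rw [sub_zero, abs_of_pos Real.pi_pos] at h
  have h2 : ‖(1 / Real.pi : ℂ)‖ = 1 / Real.pi := by
    rw [norm_div, Complex.norm_real, norm_one, Real.norm_of_nonneg Real.pi_pos.le]
  rw [h2]
  calc 1 / Real.pi * ‖HG (fun _ => 1) z‖ ≤ 1 / Real.pi * (Real.exp |z.re| * Real.pi) := by
        gcongr; exact h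
    _ = _ := by field_simp

lemma Ic1_norm_le (z : ℂ) : ‖Ic1 z‖ ≤ Real.exp |z.re| := by
  rw [Ic1, norm_mul]
  have h := intervalIntegral.norm_integral_le_of_norm_le_const (a := 0) (b := Real.pi)
    (f := fun θ : ℝ => (((1 * Real.cos θ:ℝ)) : ℂ) * Complex.exp (z * (Real.cos θ : ℂ)))
    (C := Real.exp |z.re|)
    (fun θ _ => by
      rw [norm_mul, Complex.norm_real, one_mul]
      calc _ ≤ 1 * Real.exp |z.re| := by
            gcongr
            · exact Real.abs_cos_le_one θ
            · exact norm_exp_mul_cos_le z θ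
        _ = _ := one_mul _)
  rw [sub_zero, abs_of_pos Real.pi_pos] at h
  have h2 : ‖(1 / Real.pi : ℂ)‖ = 1 / Real.pi := by
    rw [norm_div, Complex.norm_real, norm_one, Real.norm_of_nonneg Real.pi_pos.le]
  rw [h2]
  calc 1 / Real.pi * ‖HG (fun θ => 1 * Real.cos θ) z‖ ≤ 1 / Real.pi * (Real.exp |z.re| * Real.pi) := by
        gcongr; exact h
    _ = _ := by field_simp

lemma Ic_ofReal (t : ℝ) : Ic t = (besselI0 t : ℂ) := by
  rw [Ic, HG, besselI0]
  push_cast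
  rw [← intervalIntegral.integral_ofReal]
  congr 2
  ext θ
  push_cast
  ring_nf

lemma Ic_zero : Ic 0 = 1 := by
  rw [Ic, HG]
  have : (Real.pi : ℂ) ≠ 0 := by exact_mod_cast Real.pi_ne_zero
  simp [this]

lemma Ic_ode (z : ℂ) : z * Ic2 z + Ic1 z - z * Ic z = 0 := by
  have h0 := ii_one
  have h1 := IntervalIntegrable_mul_cos h0
  have h2 := IntervalIntegrable_mul_cos h1
  have key : z * HG (fun θ => 1 * Real.cos θ * Real.cos θ) z + HG (fun θ => 1 * Real.cos θ) z
      - z * HG (fun _ => 1) z = 0 := by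
    have e : ∀ θ ∈ Set.uIcc (0:ℝ) Real.pi, HasDerivAt
        (fun θ : ℝ => (Real.sin θ : ℂ) * Complex.exp (z * (Real.cos θ : ℂ)))
        ((z * ((1 * Real.cos θ * Real.cos θ : ℝ) : ℂ) + ((1 * Real.cos θ : ℝ) : ℂ) - z * ((1:ℝ):ℂ))
           * Complex.exp (z * (Real.cos θ : ℂ))) θ := by
      intro θ _
      have a1 : HasDerivAt (fun θ : ℝ => (Real.sin θ : ℂ)) (Real.cos θ : ℂ) θ :=
        (Real.hasDerivAt_sin θ).ofReal_comp
      have a2 : HasDerivAt (fun θ : ℝ => (Real.cos θ : ℂ)) ((-Real.sin θ : ℝ) : ℂ) θ :=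
        (Real.hasDerivAt_cos θ).ofReal_comp
      refine (a1.mul (a2.const_mul z).cexp).congr_deriv ?_
      have : (Real.cos θ : ℂ) * Real.cos θ = 1 - (Real.sin θ : ℂ) * Real.sin θ := by
        have := Real.sin_sq_add_cos_sq θ
        have h : (Real.sin θ : ℂ)^2 + (Real.cos θ : ℂ)^2 = 1 := by exact_mod_cast this
        linear_combination h
      push_cast at *
      linear_combination (-z * Complex.exp (z * Complex.cos θ)) * this
    have ft := intervalIntegral.integral_eq_sub_of_hasDerivAt e
      (Continuous.intervalIntegrable (by fun_prop) _ _)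
    simp only [Real.sin_pi, Real.sin_zero, Complex.ofReal_zero, zero_mul, sub_self] at ft
    rw [← ft]
    unfold HG
    rw [← intervalIntegral.integral_const_mul, ← intervalIntegral.integral_const_mul,
      ← intervalIntegral.integral_add, ← intervalIntegral.integral_sub]
    · congr 1; ext θ; ring
    all_goals exact Continuous.intervalIntegrable (by fun_prop) _ _
  simp only [Ic, Ic1, Ic2]
  linear_combination (1 / Real.pi : ℂ) * key

lemma E0_ode (z : ℂ) : z * E02 z + E01 z - z * E0 z = 2 * Ic1 z := by
  have h0 := ii_log
  have h1 := IntervalIntegrable_mul_cos h0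
  have h2 := IntervalIntegrable_mul_cos h1
  have g0 := HG_intervalIntegrable h0 z
  have g1 := HG_intervalIntegrable h1 z
  have g2 := HG_intervalIntegrable h2 z
  have g3 := HG_intervalIntegrable (IntervalIntegrable_mul_cos ii_one) z
  have key : z * HG (fun θ => 2 * Real.log (Real.sin θ) * Real.cos θ * Real.cos θ) z
      + HG (fun θ => 2 * Real.log (Real.sin θ) * Real.cos θ) z
      - z * HG (fun θ => 2 * Real.log (Real.sin θ)) z + 2 * HG (fun θ => 1 * Real.cos θ) z = 0 := by
    have int := ((((g2.const_mul z).add g1).sub (g0.const_mul z)).add (g3.const_mul 2))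
    have e : ∀ θ ∈ Set.Ioo (0:ℝ) Real.pi, HasDerivAt
        (fun θ : ℝ => ((2 * (Real.sin θ * Real.log (Real.sin θ)) : ℝ) : ℂ) *
          Complex.exp (z * (Real.cos θ : ℂ)))
        (z * (((2 * Real.log (Real.sin θ) * Real.cos θ * Real.cos θ : ℝ) : ℂ)
           * Complex.exp (z * (Real.cos θ : ℂ))) + ((2 * Real.log (Real.sin θ) * Real.cos θ : ℝ) : ℂ)
           * Complex.exp (z * (Real.cos θ : ℂ)) - z * (((2 * Real.log (Real.sin θ) : ℝ) : ℂ)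
           * Complex.exp (z * (Real.cos θ : ℂ))) + 2 * (((1 * Real.cos θ : ℝ) : ℂ)
           * Complex.exp (z * (Real.cos θ : ℂ)))) θ := by
      intro θ hθ
      have hs : Real.sin θ ≠ 0 := (Real.sin_pos_of_mem_Ioo hθ).ne'
      have a1 := (((Real.hasDerivAt_sin θ).mul ((Real.hasDerivAt_sin θ).log hs)).const_mul 2).ofReal_comp
      have a2 : HasDerivAt (fun θ : ℝ => (Real.cos θ : ℂ)) ((-Real.sin θ : ℝ) : ℂ) θ :=
        (Real.hasDerivAt_cos θ).ofReal_comp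
      refine (a1.mul (a2.const_mul z).cexp).congr_deriv ?_
      have : (Real.cos θ : ℂ) * Real.cos θ = 1 - (Real.sin θ : ℂ) * Real.sin θ := by
        have := Real.sin_sq_add_cos_sq θ
        have h : (Real.sin θ : ℂ)^2 + (Real.cos θ : ℂ)^2 = 1 := by exact_mod_cast this
        linear_combination h
      have e3 : Real.sin θ * (Real.cos θ / Real.sin θ) = Real.cos θ := by field_simp
      simp only [Pi.mul_apply, e3]
      push_cast at *
      linear_combination (-2 * z * Real.log (Real.sin θ) * Complex.exp (z * Complex.cos θ)) * this
    have hc : Continuous (fun θ : ℝ => ((2 * (Real.sin θ * Real.log (Real.sin θ)) : ℝ) : ℂ) *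
          Complex.exp (z * (Real.cos θ : ℂ))) := by
      have : Continuous (fun θ : ℝ => Real.sin θ * Real.log (Real.sin θ)) :=
        Real.continuous_mul_log.comp Real.continuous_sin
      fun_prop
    have ft := intervalIntegral.integral_eq_sub_of_hasDerivAt_of_le Real.pi_pos.le hc.continuousOn
      e int
    simp only [Real.sin_pi, Real.sin_zero, Complex.ofReal_zero, zero_mul, mul_zero, sub_self] at ft
    rw [← ft]
    unfold HG
    rw [intervalIntegral.integral_add, intervalIntegral.integral_sub, intervalIntegral.integral_add,
      intervalIntegral.integral_const_mul, intervalIntegral.integral_const_mul,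
      intervalIntegral.integral_const_mul]
    · exact g2.const_mul z
    · exact g1
    · exact (g2.const_mul z).add g1
    · exact g0.const_mul z
    · exact ((g2.const_mul z).add g1).sub (g0.const_mul z)
    · exact g3.const_mul 2
  simp only [E0, E01, E02, Ic1]
  linear_combination (-1 / Real.pi : ℂ) * key

lemma IE_wronskian (z : ℂ) : -(Ic z)^2 + z * (Ic z * E01 z - Ic1 z * E0 z) = -1 := by
  have hd : ∀ w, HasDerivAt (fun z => -(Ic z)^2 + z * (Ic z * E01 z - Ic1 z * E0 z)) 0 w := by
    intro w
    have h := (((Ic_hasDerivAt w).pow 2).neg).add ((hasDerivAt_id w).mul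
      (((Ic_hasDerivAt w).mul (E01_hasDerivAt w)).sub ((Ic1_hasDerivAt w).mul (E0_hasDerivAt w))))
    refine h.congr_deriv ?_
    simp only [Pi.mul_apply, Pi.sub_apply, id]
    linear_combination (E0_ode w) * Ic w - Ic_ode w * E0 w
  have := is_const_of_deriv_eq_zero (fun w => (hd w).differentiableAt) (fun w => (hd w).deriv) z 0
  rw [this, Ic_zero]; ring

end PartA


section PartA2
open MeasureTheory Topology

noncomputable def KQ (n : ℕ) (z : ℂ) : ℂ :=
  ∫ v in Set.Ioi (0:ℝ), ((Real.cosh v : ℝ) : ℂ) ^ n * Complex.exp (-(z * (Real.cosh v : ℂ)))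

lemma inv_cosh_le (v : ℝ) : (Real.cosh v)⁻¹ ≤ 2 * Real.exp (-v) := by
  have h1 : Real.exp v / 2 ≤ Real.cosh v := by
    rw [Real.cosh_eq]; have := Real.exp_pos (-v); linarith
  rw [inv_le_comm₀ (Real.cosh_pos v) (by positivity)]
  refine le_trans (le_of_eq ?_) h1
  rw [Real.exp_neg]; field_simp

lemma cosh_exp_le (n : ℕ) {δ : ℝ} (hδ : 0 < δ) (v : ℝ) :
    Real.cosh v ^ n * Real.exp (-(δ * Real.cosh v)) ≤
      ((n+1).factorial / δ^(n+1) * 2) * Real.exp (-v) := by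
  have hc := Real.cosh_pos v
  have h := Real.pow_div_factorial_le_exp (δ * Real.cosh v) (by positivity) (n+1)
  have h2 := inv_cosh_le v
  rw [mul_assoc]
  refine le_trans ?_ (mul_le_mul_of_nonneg_left h2 (by positivity))
  rw [Real.exp_neg]
  have he := Real.exp_pos (δ * Real.cosh v)
  rw [← div_eq_mul_inv, ← div_eq_mul_inv, div_le_iff₀ he]
  calc Real.cosh v ^ n = (((n+1).factorial / δ^(n+1)) / Real.cosh v) *
        ((δ * Real.cosh v)^(n+1) / (n+1).factorial) := by
        have : ((n+1).factorial : ℝ) ≠ 0 := by positivity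
        rw [mul_pow, pow_succ (Real.cosh v)]
        field_simp
    _ ≤ _ := by gcongr

lemma integrable_exp_neg_Ioi : IntegrableOn (fun v : ℝ => Real.exp (-v)) (Set.Ioi 0) :=
  integrableOn_exp_neg_Ioi 0

lemma norm_cosh_exp (n : ℕ) (z : ℂ) (v : ℝ) :
    ‖((Real.cosh v : ℝ) : ℂ) ^ n * Complex.exp (-(z * (Real.cosh v : ℂ)))‖ =
      Real.cosh v ^ n * Real.exp (-(z.re * Real.cosh v)) := by
  rw [norm_mul, norm_pow, Complex.norm_real, Real.norm_of_nonneg (Real.cosh_pos v).le,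
    Complex.norm_exp]
  simp

lemma KQ_integrable (n : ℕ) {z : ℂ} (hz : 0 < z.re) :
    IntegrableOn (fun v : ℝ => ((Real.cosh v : ℝ) : ℂ) ^ n *
      Complex.exp (-(z * (Real.cosh v : ℂ)))) (Set.Ioi 0) := by
  refine Integrable.mono' (integrable_exp_neg_Ioi.const_mul ((n+1).factorial / z.re^(n+1) * 2)) ?_ ?_
  · apply Continuous.aestronglyMeasurable
    have := Real.continuous_cosh
    fun_prop
  · refine Eventually.of_forall fun v => ?_
    rw [norm_cosh_exp]
    exact cosh_exp_le n hz v

lemma KQ_hasDerivAt (n : ℕ) {z : ℂ} (hz : 0 < z.re) : HasDerivAt (KQ n) (-KQ (n+1) z) z := by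
  have hcont : ∀ (n : ℕ) (w : ℂ), Continuous (fun v : ℝ => ((Real.cosh v : ℝ) : ℂ) ^ n *
      Complex.exp (-(w * (Real.cosh v : ℂ)))) := by
    intro n w
    have := Real.continuous_cosh
    fun_prop
  have := hasDerivAt_integral_of_dominated_loc_of_deriv_le (𝕜 := ℂ)
    (μ := volume.restrict (Set.Ioi (0:ℝ)))
    (F := fun z v => ((Real.cosh v : ℝ) : ℂ) ^ n * Complex.exp (-(z * (Real.cosh v : ℂ))))
    (F' := fun z v => -(((Real.cosh v : ℝ) : ℂ) ^ (n+1) * Complex.exp (-(z * (Real.cosh v : ℂ)))))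
    (x₀ := z) (s := Metric.ball z (z.re/2))
    (bound := fun v => ((n+1+1).factorial / (z.re/2)^(n+1+1) * 2) * Real.exp (-v))
    (Metric.ball_mem_nhds z (by positivity))
    (Eventually.of_forall fun w => (hcont n w).aestronglyMeasurable) (KQ_integrable n hz)
    (hcont (n+1) z).neg.aestronglyMeasurable ?_ (integrable_exp_neg_Ioi.const_mul _) ?_
  · rw [KQ, ← integral_neg]
    exact this.2
  · refine Eventually.of_forall fun v w hw => ?_
    rw [norm_neg, norm_cosh_exp]
    refine le_trans ?_ (cosh_exp_le (n+1) (half_pos hz) v)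
    have h1 : |w.re - z.re| ≤ ‖w - z‖ := by simpa using Complex.abs_re_le_norm (w - z)
    rw [Metric.mem_ball, dist_eq_norm] at hw
    have h2 := (abs_lt.1 (h1.trans_lt hw)).1
    have hc := Real.cosh_pos v
    gcongr
    linarith
  · refine Eventually.of_forall fun v w hw => ?_
    have h1 : HasDerivAt (fun x : ℂ => -(x * (Real.cosh v : ℂ))) (-(Real.cosh v : ℂ)) w := by
      exact (((hasDerivAt_id w).mul_const (Real.cosh v : ℂ)).neg).congr_deriv (by simp)
    refine (h1.cexp.const_mul (((Real.cosh v : ℝ) : ℂ) ^ n)).congr_deriv ?_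
    ring

/-- `∫ sinh v exp(-z cosh v)`-type boundary term decay -/
lemma tendsto_exp_cosh {z : ℂ} (hz : 0 < z.re) (n : ℕ) :
    Tendsto (fun v : ℝ => ((Real.cosh v : ℝ) : ℂ) ^ n *
      Complex.exp (-(z * (Real.cosh v : ℂ)))) atTop (𝓝 0) := by
  apply squeeze_zero_norm (a := fun v => ((n+1).factorial / z.re^(n+1) * 2) * Real.exp (-v))
  · intro v
    rw [norm_cosh_exp]
    exact cosh_exp_le n hz v
  · have := (Real.tendsto_exp_neg_atTop_nhds_zero).const_mul ((n+1).factorial / z.re^(n+1) * 2)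
    simpa using this

lemma abs_sinh_le_cosh (v : ℝ) : |Real.sinh v| ≤ Real.cosh v := by
  rw [abs_le]
  have h1 := Real.exp_pos v
  have h2 := Real.exp_pos (-v)
  rw [Real.sinh_eq, Real.cosh_eq]
  constructor <;> linarith

lemma KQ_ode {z : ℂ} (hz : 0 < z.re) : z * KQ 2 z - KQ 1 z - z * KQ 0 z = 0 := by
  have i0 := KQ_integrable 0 hz
  have i1 := KQ_integrable 1 hz
  have i2 := KQ_integrable 2 hz
  have hd : ∀ v ∈ Set.Ici (0:ℝ), HasDerivAt (fun v : ℝ => -((Real.sinh v : ℂ) *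
      Complex.exp (-(z * (Real.cosh v : ℂ)))))
      (z * (((Real.cosh v : ℝ) : ℂ) ^ 2 * Complex.exp (-(z * (Real.cosh v : ℂ)))) -
      ((Real.cosh v : ℝ) : ℂ) ^ 1 * Complex.exp (-(z * (Real.cosh v : ℂ))) -
      z * (((Real.cosh v : ℝ) : ℂ) ^ 0 * Complex.exp (-(z * (Real.cosh v : ℂ))))) v := by
    intro v _
    have a1 : HasDerivAt (fun v : ℝ => (Real.sinh v : ℂ)) (Real.cosh v : ℂ) v :=
      (Real.hasDerivAt_sinh v).ofReal_comp
    have a2 : HasDerivAt (fun v : ℝ => (Real.cosh v : ℂ)) (Real.sinh v : ℂ) v :=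
      (Real.hasDerivAt_cosh v).ofReal_comp
    refine (a1.mul (a2.const_mul z).neg.cexp).neg.congr_deriv ?_
    have : (Real.cosh v : ℂ)^2 = (Real.sinh v : ℂ)^2 + 1 := by
      exact_mod_cast Real.cosh_sq v
    simp only [Pi.neg_apply]
    linear_combination -z * Complex.exp (-(z * (Real.cosh v : ℂ))) * this
  have hl : Tendsto (fun v : ℝ => -((Real.sinh v : ℂ) *
      Complex.exp (-(z * (Real.cosh v : ℂ))))) atTop (𝓝 0) := by
    refine squeeze_zero_norm ?_ (tendsto_zero_iff_norm_tendsto_zero.1 (tendsto_exp_cosh hz 1))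
    intro v
    rw [norm_neg, norm_mul, norm_mul, pow_one, Complex.norm_real, Complex.norm_real,
      Real.norm_of_nonneg (Real.cosh_pos v).le]
    gcongr
    exact abs_sinh_le_cosh v
  have ft := integral_Ioi_of_hasDerivAt_of_tendsto' hd
    (((i2.const_mul z).sub i1).sub (i0.const_mul z)) hl
  have i21 : Integrable (fun v : ℝ => z * (((Real.cosh v : ℝ) : ℂ) ^ 2 *
      Complex.exp (-(z * (Real.cosh v : ℂ)))) - ((Real.cosh v : ℝ) : ℂ) ^ 1 *
      Complex.exp (-(z * (Real.cosh v : ℂ)))) (volume.restrict (Set.Ioi 0)) :=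
    (i2.const_mul z).sub i1
  rw [integral_sub i21 (i0.const_mul z), integral_sub (i2.const_mul z) i1,
    integral_const_mul, integral_const_mul] at ft
  rw [KQ, KQ, KQ, ft]
  simp

lemma KQ_ofReal (t : ℝ) : KQ 0 t = (besselK0 t : ℂ) := by
  rw [KQ, besselK0, ← integral_complex_ofReal]
  congr 1
  ext v
  push_cast
  simp

lemma KQ1_bounds {t : ℝ} (ht : 0 < t) : ‖(t:ℂ) * KQ 1 t - Complex.exp (-t)‖ ≤ t := by
  have hz : 0 < ((t:ℂ)).re := by simpa using ht
  have i1 := KQ_integrable 1 hz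
  have hd : ∀ v ∈ Set.Ici (0:ℝ), HasDerivAt (fun v : ℝ => -
      Complex.exp (-((t:ℂ) * (Real.cosh v : ℂ))))
      ((t:ℂ) * Real.sinh v * Complex.exp (-((t:ℂ) * (Real.cosh v : ℂ)))) v := by
    intro v _
    have a2 : HasDerivAt (fun v : ℝ => (Real.cosh v : ℂ)) (Real.sinh v : ℂ) v :=
      (Real.hasDerivAt_cosh v).ofReal_comp
    refine ((a2.const_mul (t:ℂ)).neg.cexp).neg.congr_deriv ?_
    simp only [Pi.neg_apply]
    ring
  have hs : IntegrableOn (fun v : ℝ => (t:ℂ) * Real.sinh v * Complex.exp (-((t:ℂ) * (Real.cosh v : ℂ))))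
      (Set.Ioi 0) := by
    refine Integrable.mono (i1.const_mul (t:ℂ)) ?_ (Eventually.of_forall fun v => ?_)
    · apply Continuous.aestronglyMeasurable
      have := Real.continuous_cosh
      have := Real.continuous_sinh
      fun_prop
    · rw [mul_assoc, norm_mul, norm_mul, norm_mul, norm_mul, pow_one, Complex.norm_real (Real.sinh v),
        Complex.norm_real (Real.cosh v), Real.norm_of_nonneg (Real.cosh_pos v).le]
      gcongr
      exact abs_sinh_le_cosh v
  have hl : Tendsto (fun v : ℝ => -
      Complex.exp (-((t:ℂ) * (Real.cosh v : ℂ)))) atTop (𝓝 0) := by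
    have := (tendsto_exp_cosh hz 0).neg
    simpa using this
  have ft := integral_Ioi_of_hasDerivAt_of_tendsto' hd hs hl
  have e1 : (t:ℂ) * KQ 1 t - Complex.exp (-t) = ∫ v in Set.Ioi (0:ℝ),
      ((t:ℂ) * (((Real.cosh v : ℝ) : ℂ) ^ 1 * Complex.exp (-((t:ℂ) * (Real.cosh v : ℂ)))) -
      (t:ℂ) * Real.sinh v * Complex.exp (-((t:ℂ) * (Real.cosh v : ℂ)))) := by
    rw [integral_sub (i1.const_mul (t:ℂ)) hs, ft, integral_const_mul, KQ]
    simp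
  rw [e1]
  have hb : ∀ v ∈ Set.Ioi (0:ℝ), ‖((t:ℂ) * (((Real.cosh v : ℝ) : ℂ) ^ 1 * Complex.exp (-((t:ℂ) * (Real.cosh v : ℂ)))) -
      (t:ℂ) * Real.sinh v * Complex.exp (-((t:ℂ) * (Real.cosh v : ℂ))))‖ ≤ t * Real.exp (-v) := by
    intro v _
    have : ((t:ℂ) * (((Real.cosh v : ℝ) : ℂ) ^ 1 * Complex.exp (-((t:ℂ) * (Real.cosh v : ℂ)))) -
      (t:ℂ) * Real.sinh v * Complex.exp (-((t:ℂ) * (Real.cosh v : ℂ)))) =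
      (((t * Real.exp (-v) * Real.exp (-(t * Real.cosh v)) : ℝ)) : ℂ) := by
      have : Real.exp (-v) = Real.cosh v - Real.sinh v := by
        rw [Real.cosh_eq, Real.sinh_eq]; ring
      rw [this]; push_cast; ring
    rw [this, Complex.norm_real, Real.norm_of_nonneg (by positivity)]
    have h1 : Real.exp (-(t * Real.cosh v)) ≤ 1 := by
      rw [Real.exp_le_one_iff]
      have := Real.cosh_pos v
      have : 0 < t * Real.cosh v := by positivity
      linarith
    have h2 : 0 ≤ t * Real.exp (-v) := by positivity
    nlinarith
  calc _ ≤ ∫ v in Set.Ioi (0:ℝ), t * Real.exp (-v) := by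
        refine norm_integral_le_of_norm_le (integrable_exp_neg_Ioi.const_mul t) ?_
        exact (ae_restrict_mem measurableSet_Ioi).mono hb
    _ = t := by rw [integral_const_mul, integral_exp_neg_Ioi_zero, mul_one]

lemma KQ0_le {t : ℝ} (ht : 0 < t) : ‖(t:ℂ) * KQ 0 t‖ ≤ 1 + t := by
  have hz : 0 < ((t:ℂ)).re := by simpa using ht
  have h := KQ1_bounds ht
  have h1 : ‖(t:ℂ) * KQ 1 t‖ ≤ 1 + t := by
    have e : (t:ℂ) * KQ 1 t = Complex.exp (-t) + ((t:ℂ) * KQ 1 t - Complex.exp (-t)) := by ring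
    rw [e]
    refine (norm_add_le _ _).trans (add_le_add ?_ h)
    rw [Complex.norm_exp]; simp [ht.le]
  refine le_trans ?_ h1
  rw [norm_mul, norm_mul]
  gcongr
  have e0 : KQ 1 (t:ℂ) = ((∫ v in Set.Ioi (0:ℝ), Real.cosh v * Real.exp (-(t * Real.cosh v)) : ℝ) : ℂ) := by
    rw [KQ, ← integral_complex_ofReal]; congr 1; ext v; push_cast; simp
  have e1 : ∀ n v, ‖((Real.cosh v : ℝ) : ℂ) ^ n * Complex.exp (-((t:ℂ) * (Real.cosh v : ℂ)))‖ =
      Real.cosh v ^ n * Real.exp (-(t * Real.cosh v)) := by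
    intro n v; rw [norm_cosh_exp]; simp
  have j1 : IntegrableOn (fun v : ℝ => Real.cosh v * Real.exp (-(t * Real.cosh v))) (Set.Ioi 0) := by
    refine (KQ_integrable 1 hz).norm.congr (Eventually.of_forall fun v => ?_)
    simp only [e1]; simp
  rw [e0, Complex.norm_real, Real.norm_of_nonneg
    (integral_nonneg fun v => by have := Real.cosh_pos v; positivity), KQ]
  refine norm_integral_le_of_norm_le j1 (Eventually.of_forall fun v => ?_)
  rw [e1, pow_zero]
  gcongr
  exact Real.one_le_cosh v

lemma KQ_bound {z : ℂ} (hz : 0 < z.re) :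
    ‖KQ 0 z‖ ≤ 2 * (1 + 1 / ‖z‖) * Real.exp (-z.re) := by
  have hz0 : z ≠ 0 := by rintro rfl; simp at hz
  have i0 := KQ_integrable 0 hz
  have hne : ∀ v : ℝ, (Real.cosh v : ℂ) ≠ 0 := fun v => by exact_mod_cast (Real.cosh_pos v).ne'
  set A : ℝ → ℂ := fun v => ((Real.cosh v : ℂ)^2)⁻¹ * Complex.exp (-(z * (Real.cosh v : ℂ))) with hA
  set B : ℝ → ℂ := fun v => (2 * ((Real.cosh v : ℂ)^2)⁻¹ - 1) * (Real.cosh v : ℂ)⁻¹ *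
    Complex.exp (-(z * (Real.cosh v : ℂ))) with hB
  have hexp : ∀ v : ℝ, ‖Complex.exp (-(z * (Real.cosh v : ℂ)))‖ ≤ Real.exp (-z.re) := by
    intro v
    rw [Complex.norm_exp]
    apply Real.exp_le_exp.2
    have := Real.one_le_cosh v
    simp
    nlinarith
  have hAb : ∀ v, ‖A v‖ ≤ 2 * Real.exp (-z.re) * Real.exp (-v) := by
    intro v
    rw [hA, norm_mul, norm_inv, norm_pow, Complex.norm_real, Real.norm_of_nonneg (Real.cosh_pos v).le]
    have h1 := inv_cosh_le v
    have h2 : (Real.cosh v ^ 2)⁻¹ ≤ (Real.cosh v)⁻¹ := by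
      apply inv_anti₀ (Real.cosh_pos v)
      have := Real.one_le_cosh v
      nlinarith
    calc _ ≤ (2 * Real.exp (-v)) * Real.exp (-z.re) := by
          gcongr
          · exact h2.trans h1
          · exact hexp v
      _ = _ := by ring
  have hBb : ∀ v, ‖B v‖ ≤ 2 * Real.exp (-z.re) * Real.exp (-v) := by
    intro v
    have h1 := inv_cosh_le v
    have e : (2 * ((Real.cosh v : ℂ)^2)⁻¹ - 1) = ((2 * (Real.cosh v ^2)⁻¹ - 1 : ℝ) : ℂ) := by
      push_cast; rfl
    simp only [hB]
    rw [e, norm_mul, norm_mul, norm_inv, Complex.norm_real, Complex.norm_real,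
      Real.norm_of_nonneg (Real.cosh_pos v).le]
    have h2 : (Real.cosh v ^ 2)⁻¹ ≤ 1 := by
      apply inv_le_one_of_one_le₀
      have := Real.one_le_cosh v
      nlinarith
    have h3 : 0 < (Real.cosh v ^ 2)⁻¹ := by have := Real.cosh_pos v; positivity
    have h4 : ‖(2 * (Real.cosh v ^ 2)⁻¹ - 1 : ℝ)‖ ≤ 1 := by
      rw [Real.norm_eq_abs, abs_le]; constructor <;> linarith
    have h5 : 0 < (Real.cosh v)⁻¹ := by have := Real.cosh_pos v; positivity
    calc _ ≤ (1 * (2 * Real.exp (-v))) * Real.exp (-z.re) := by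
          gcongr
          exact hexp v
      _ = _ := by ring
  have hcc := Real.continuous_cosh
  have cA : Continuous A := by
    have : Continuous fun v : ℝ => ((Real.cosh v : ℂ)^2)⁻¹ :=
      Continuous.inv₀ (by fun_prop) (fun v => pow_ne_zero 2 (hne v))
    fun_prop
  have cB : Continuous B := by
    have : Continuous fun v : ℝ => ((Real.cosh v : ℂ)^2)⁻¹ :=
      Continuous.inv₀ (by fun_prop) (fun v => pow_ne_zero 2 (hne v))
    have : Continuous fun v : ℝ => ((Real.cosh v : ℂ))⁻¹ :=
      Continuous.inv₀ (by fun_prop) hne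
    fun_prop
  have hIntg := (integrable_exp_neg_Ioi.const_mul (2 * Real.exp (-z.re)))
  have iA : IntegrableOn A (Set.Ioi 0) :=
    Integrable.mono' hIntg cA.aestronglyMeasurable (Eventually.of_forall hAb)
  have iB : IntegrableOn B (Set.Ioi 0) :=
    Integrable.mono' hIntg cB.aestronglyMeasurable (Eventually.of_forall hBb)
  have hd : ∀ v ∈ Set.Ici (0:ℝ), HasDerivAt (fun v : ℝ => (Real.sinh v : ℂ) * ((Real.cosh v : ℂ)^2)⁻¹ *
      Complex.exp (-(z * (Real.cosh v : ℂ))))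
      (B v - z * (((Real.cosh v : ℂ))^0 * Complex.exp (-(z * (Real.cosh v : ℂ))) - A v)) v := by
    intro v _
    have a1 : HasDerivAt (fun v : ℝ => (Real.sinh v : ℂ)) (Real.cosh v : ℂ) v :=
      (Real.hasDerivAt_sinh v).ofReal_comp
    have a2 : HasDerivAt (fun v : ℝ => (Real.cosh v : ℂ)) (Real.sinh v : ℂ) v :=
      (Real.hasDerivAt_cosh v).ofReal_comp
    refine ((a1.mul ((a2.pow 2).inv (pow_ne_zero 2 (hne v)))).mul
      (a2.const_mul z).neg.cexp).congr_deriv ?_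
    have : (Real.sinh v : ℂ)^2 = (Real.cosh v : ℂ)^2 - 1 := by
      exact_mod_cast Real.sinh_sq v
    have hn := hne v
    simp only [hA, hB, Pi.neg_apply, Pi.mul_apply, Pi.inv_apply, Pi.pow_apply]
    generalize (Real.cosh v : ℂ) = c at *
    generalize (Real.sinh v : ℂ) = s at *
    generalize Complex.exp (-(z * c)) = e at *
    field_simp
    simp only [Nat.cast_ofNat, Nat.reduceSub, pow_one]
    ring_nf
    simp only [show s^2 = c^2 - 1 from this]
    ring
  have hl : Tendsto (fun v : ℝ => (Real.sinh v : ℂ) * ((Real.cosh v : ℂ)^2)⁻¹ *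
      Complex.exp (-(z * (Real.cosh v : ℂ)))) atTop (𝓝 0) := by
    refine squeeze_zero_norm ?_ (tendsto_zero_iff_norm_tendsto_zero.1 (tendsto_exp_cosh hz 1))
    intro v
    rw [norm_mul, norm_mul, norm_mul, pow_one, Complex.norm_real, Complex.norm_real,
      Real.norm_of_nonneg (Real.cosh_pos v).le]
    gcongr
    have h1 : ‖((Real.cosh v : ℂ)^2)⁻¹‖ ≤ 1 := by
      rw [norm_inv, norm_pow, Complex.norm_real, Real.norm_of_nonneg (Real.cosh_pos v).le]
      apply inv_le_one_of_one_le₀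
      have := Real.one_le_cosh v
      nlinarith
    calc _ ≤ Real.cosh v * 1 := by
          gcongr
          exact abs_sinh_le_cosh v
      _ = _ := mul_one _
  have ft := integral_Ioi_of_hasDerivAt_of_tendsto' hd (iB.sub ((i0.sub iA).const_mul z)) hl
  have iz : Integrable (fun v : ℝ => z * (((Real.cosh v : ℝ) : ℂ) ^ 0 *
      Complex.exp (-(z * (Real.cosh v : ℂ))) - A v)) (volume.restrict (Set.Ioi 0)) :=
    (i0.sub iA).const_mul z
  rw [integral_sub iB iz, integral_const_mul] at ft
  have is := integral_sub i0 iA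
  rw [is] at ft
  simp only [Real.sinh_zero, Complex.ofReal_zero, zero_mul, sub_zero] at ft
  have hK : KQ 0 z = (∫ v in Set.Ioi (0:ℝ), A v) + (1/z) * ∫ v in Set.Ioi (0:ℝ), B v := by
    have ft2 : (∫ v in Set.Ioi (0:ℝ), B v) - z * (KQ 0 z - ∫ v in Set.Ioi (0:ℝ), A v) = 0 := ft
    field_simp
    linear_combination -ft2
  have nA : ‖∫ v in Set.Ioi (0:ℝ), A v‖ ≤ 2 * Real.exp (-z.re) := by
    calc _ ≤ ∫ v in Set.Ioi (0:ℝ), 2 * Real.exp (-z.re) * Real.exp (-v) :=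
          norm_integral_le_of_norm_le hIntg (Eventually.of_forall hAb)
      _ = _ := by rw [integral_const_mul, integral_exp_neg_Ioi_zero, mul_one]
  have nB : ‖∫ v in Set.Ioi (0:ℝ), B v‖ ≤ 2 * Real.exp (-z.re) := by
    calc _ ≤ ∫ v in Set.Ioi (0:ℝ), 2 * Real.exp (-z.re) * Real.exp (-v) :=
          norm_integral_le_of_norm_le hIntg (Eventually.of_forall hBb)
      _ = _ := by rw [integral_const_mul, integral_exp_neg_Ioi_zero, mul_one]
  rw [hK]
  calc _ ≤ ‖∫ v in Set.Ioi (0:ℝ), A v‖ + ‖(1/z) * ∫ v in Set.Ioi (0:ℝ), B v‖ := norm_add_le _ _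
    _ ≤ 2 * Real.exp (-z.re) + (1/‖z‖) * (2 * Real.exp (-z.re)) := by
        rw [norm_mul, norm_div, norm_one]; gcongr
    _ = _ := by ring

end PartA2


section PartA3
open MeasureTheory Topology

lemma isOpen_rhp : IsOpen {z : ℂ | 0 < z.re} := isOpen_lt continuous_const Complex.continuous_re
lemma convex_rhp : Convex ℝ {z : ℂ | 0 < z.re} := convex_halfSpace_re_gt 0

lemma Ic1_zero : Ic1 0 = 0 := by
  rw [Ic1, HG]
  have : ∫ θ in (0:ℝ)..Real.pi, (((1 * Real.cos θ : ℝ)) : ℂ) * Complex.exp (0 * (Real.cos θ : ℂ)) = 0 := by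
    have h : (fun θ : ℝ => (((1 * Real.cos θ : ℝ)) : ℂ) * Complex.exp (0 * (Real.cos θ : ℂ))) =
      fun θ : ℝ => ((Real.cos θ : ℝ) : ℂ) := by
      ext θ; simp
    rw [h, intervalIntegral.integral_ofReal, integral_cos]
    simp
  rw [this, mul_zero]

lemma KI_wronskian {z : ℂ} (hz : 0 < z.re) : z * (Ic z * (-KQ 1 z) - Ic1 z * KQ 0 z) = -1 := by
  set f : ℂ → ℂ := fun z => z * (Ic z * (-KQ 1 z) - Ic1 z * KQ 0 z) with hf
  have hd : ∀ w : ℂ, 0 < w.re → HasDerivAt f 0 w := by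
    intro w hw
    have h := (hasDerivAt_id w).mul
      (((Ic_hasDerivAt w).mul (KQ_hasDerivAt 1 hw).neg).sub ((Ic1_hasDerivAt w).mul (KQ_hasDerivAt 0 hw)))
    refine h.congr_deriv ?_
    simp only [Pi.mul_apply, Pi.sub_apply, Pi.neg_apply, id, zero_add]
    linear_combination (KQ_ode hw) * Ic w - Ic_ode w * KQ 0 w
  have hconst : ∀ w : ℂ, 0 < w.re → f w = f z := by
    intro w hw
    exact isOpen_rhp.is_const_of_deriv_eq_zero convex_rhp.isPreconnected
      (fun x hx => (hd x hx).differentiableAt.differentiableWithinAt)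
      (fun x hx => (hd x hx).deriv) hw hz
  have l0 : Tendsto (fun t : ℝ => (t:ℂ)) (𝓝[>] (0:ℝ)) (𝓝 0) := by
    have : Tendsto (fun t : ℝ => (t:ℂ)) (𝓝 (0:ℝ)) (𝓝 ((0:ℝ):ℂ)) :=
      Complex.continuous_ofReal.tendsto 0
    rw [Complex.ofReal_zero] at this
    exact this.mono_left nhdsWithin_le_nhds
  have pos : ∀ᶠ t : ℝ in 𝓝[>] (0:ℝ), 0 < t := eventually_mem_nhdsWithin
  have lI : Tendsto (fun t : ℝ => Ic t) (𝓝[>] (0:ℝ)) (𝓝 1) := by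
    have := (Ic_hasDerivAt 0).continuousAt.tendsto.comp l0
    rwa [Ic_zero] at this
  have lI1 : Tendsto (fun t : ℝ => Ic1 t) (𝓝[>] (0:ℝ)) (𝓝 0) := by
    have := (Ic1_hasDerivAt 0).continuousAt.tendsto.comp l0
    rwa [Ic1_zero] at this
  have lt : Tendsto (fun t : ℝ => t) (𝓝[>] (0:ℝ)) (𝓝 0) := tendsto_id.mono_left nhdsWithin_le_nhds
  have lK1 : Tendsto (fun t : ℝ => (t:ℂ) * KQ 1 t) (𝓝[>] (0:ℝ)) (𝓝 1) := by
    have h1 : Tendsto (fun t : ℝ => (t:ℂ) * KQ 1 t - Complex.exp (-t)) (𝓝[>] (0:ℝ)) (𝓝 0) :=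
      squeeze_zero_norm' (pos.mono fun t ht => KQ1_bounds ht) lt
    have h2 : Tendsto (fun t : ℝ => Complex.exp (-t)) (𝓝[>] (0:ℝ)) (𝓝 1) := by
      have := (Complex.continuous_exp.tendsto _).comp l0.neg
      simpa [Function.comp_def] using this
    have := h1.add h2
    simpa using this
  have lK0 : Tendsto (fun t : ℝ => Ic1 t * ((t:ℂ) * KQ 0 t)) (𝓝[>] (0:ℝ)) (𝓝 0) := by
    have h : Tendsto (fun t : ℝ => ‖Ic1 t‖ * (1 + t)) (𝓝[>] (0:ℝ)) (𝓝 0) := by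
      have := lI1.norm.mul (lt.const_add 1)
      simpa using this
    refine squeeze_zero_norm' (pos.mono fun t ht => ?_) h
    rw [norm_mul]
    gcongr
    exact KQ0_le ht
  have lf : Tendsto (fun t : ℝ => f t) (𝓝[>] (0:ℝ)) (𝓝 (-1)) := by
    have := (lI.mul lK1).neg.sub lK0
    simp only [mul_one, sub_zero] at this
    refine this.congr fun t => ?_
    simp only [hf]; ring
  have lf2 : Tendsto (fun t : ℝ => f t) (𝓝[>] (0:ℝ)) (𝓝 (f z)) :=
    tendsto_const_nhds.congr' (pos.mono fun t ht => (hconst t (by simpa using ht)).symm)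
  exact tendsto_nhds_unique lf2 lf

lemma besselI0_pos (t : ℝ) : 0 < besselI0 t := by
  rw [besselI0]
  have := Real.pi_pos
  refine mul_pos (by positivity) ?_
  apply intervalIntegral.intervalIntegral_pos_of_pos_on
  · exact Continuous.intervalIntegrable (by fun_prop) _ _
  · intro x _; positivity
  · exact this

lemma Ic_ofReal_ne (t : ℝ) : Ic t ≠ 0 := by
  rw [Ic_ofReal]; exact_mod_cast (besselI0_pos t).ne'

noncomputable def alphaK : ℂ := (KQ 0 ((1:ℝ):ℂ) - E0 ((1:ℝ):ℂ)) / Ic ((1:ℝ):ℂ)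

noncomputable def Ec (z : ℂ) : ℂ := E0 z + alphaK * Ic z
noncomputable def Ec1 (z : ℂ) : ℂ := E01 z + alphaK * Ic1 z
noncomputable def Kc (z : ℂ) : ℂ := - (Ic z * Complex.log z) + Ec z
noncomputable def Kc1 (z : ℂ) : ℂ := - (Ic1 z * Complex.log z + Ic z * z⁻¹) + Ec1 z

lemma alphaK_conj : starRingEnd ℂ alphaK = alphaK := by
  have h : starRingEnd ℂ (KQ 0 ((1:ℝ):ℂ)) = KQ 0 ((1:ℝ):ℂ) := by
    rw [KQ_ofReal, Complex.conj_ofReal]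
  rw [alphaK, map_div₀, map_sub, ← Ic_conj, ← E0_conj, h, Complex.conj_ofReal]

lemma Ec_conj (z : ℂ) : Ec (starRingEnd ℂ z) = starRingEnd ℂ (Ec z) := by
  simp [Ec, E0_conj, Ic_conj, alphaK_conj]

lemma Ec_even (z : ℂ) : Ec (-z) = Ec z := by simp [Ec, E0_even, Ic_even]

lemma Ec_hasDerivAt (z : ℂ) : HasDerivAt Ec (Ec1 z) z :=
  (E0_hasDerivAt z).add ((Ic_hasDerivAt z).const_mul _)

lemma Kc_hasDerivAt {z : ℂ} (hz : z ∈ Complex.slitPlane) : HasDerivAt Kc (Kc1 z) z :=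
  (((Ic_hasDerivAt z).mul (Complex.hasDerivAt_log hz)).neg).add (Ec_hasDerivAt z)

lemma Kc1_hasDerivAt {z : ℂ} (hz : z ∈ Complex.slitPlane) :
    HasDerivAt Kc1 (Kc z - Kc1 z / z) z := by
  have hz0 := Complex.slitPlane_ne_zero hz
  have h := ((((Ic1_hasDerivAt z).mul (Complex.hasDerivAt_log hz)).add
    ((Ic_hasDerivAt z).mul (hasDerivAt_inv hz0))).neg).add
      ((E01_hasDerivAt z).add ((Ic1_hasDerivAt z).const_mul alphaK))
  refine h.congr_deriv ?_
  simp only [Kc, Kc1, Ec, Ec1]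
  have h1 := E0_ode z
  have h2 := Ic_ode z
  field_simp
  linear_combination z * h1 + z * (alphaK - Complex.log z) * h2

lemma Kc_wronskian {z : ℂ} (hz0 : z ≠ 0) : z * (Ic z * Kc1 z - Ic1 z * Kc z) = -1 := by
  rw [← IE_wronskian z]
  simp only [Kc, Kc1, Ec, Ec1]
  field_simp
  ring

lemma ofReal_mem_slit {t : ℝ} (ht : 0 < t) : (t:ℂ) ∈ Complex.slitPlane := Or.inl (by simpa using ht)

lemma Kc_ofReal' {t : ℝ} (ht : 0 < t) : Kc t = KQ 0 t := by
  set f : ℝ → ℂ := fun t => (KQ 0 t - Kc t) / Ic t with hf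
  have hd : ∀ t : ℝ, t ∈ Set.Ioi (0:ℝ) → HasDerivAt f 0 t := by
    intro t ht
    have ht' : 0 < t := ht
    have hre : 0 < (t:ℂ).re := by simpa using ht
    have h := (((KQ_hasDerivAt 0 hre).sub (Kc_hasDerivAt (ofReal_mem_slit ht))).div
      (Ic_hasDerivAt t) (Ic_ofReal_ne t)).comp_ofReal
    refine h.congr_deriv ?_
    have hI := Ic_ofReal_ne t
    have h1 := KI_wronskian hre
    have ht0 : (t:ℂ) ≠ 0 := by exact_mod_cast ht'.ne'
    have h2 := Kc_wronskian ht0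
    rw [div_eq_zero_iff]; left
    have h3 : (t:ℂ) * ((-KQ (0+1) t - Kc1 t) * Ic t - (KQ 0 t - Kc t) * Ic1 t) = 0 := by
      simp only [zero_add]
      linear_combination h1 - h2
    exact (mul_eq_zero.1 h3).resolve_left ht0
  have hc : f t = f 1 :=
    isOpen_Ioi.is_const_of_deriv_eq_zero (convex_Ioi (0:ℝ)).isPreconnected
      (fun x hx => (hd x hx).differentiableAt.differentiableWithinAt)
      (fun x hx => (hd x hx).deriv) (Set.mem_Ioi.2 ht) (Set.mem_Ioi.2 one_pos)
  have h1 : f 1 = 0 := by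
    simp only [hf]
    rw [div_eq_zero_iff]; left
    have hI := Ic_ofReal_ne 1
    simp only [Kc, Ec, alphaK]
    rw [Complex.ofReal_one] at *
    rw [Complex.log_one]
    field_simp
    ring
  rw [h1] at hc
  have h3 : KQ 0 t - Kc t = 0 := (div_eq_zero_iff.1 hc).resolve_right (Ic_ofReal_ne t)
  exact (sub_eq_zero.1 h3).symm

lemma Kc_ofReal {t : ℝ} (ht : 0 < t) : Kc t = (besselK0 t : ℂ) := by
  rw [Kc_ofReal' ht, KQ_ofReal]

lemma rhp_slit {z : ℂ} (hz : 0 < z.re) : z ∈ Complex.slitPlane := Or.inl hz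

lemma Kc_eq_KQ {z : ℂ} (hz : 0 < z.re) : Kc z = KQ 0 z := by
  have hK : AnalyticOnNhd ℂ Kc {z : ℂ | 0 < z.re} :=
    DifferentiableOn.analyticOnNhd
      (fun x hx => (Kc_hasDerivAt (rhp_slit hx)).differentiableAt.differentiableWithinAt) isOpen_rhp
  have hQ : AnalyticOnNhd ℂ (KQ 0) {z : ℂ | 0 < z.re} :=
    DifferentiableOn.analyticOnNhd
      (fun x hx => (KQ_hasDerivAt 0 hx).differentiableAt.differentiableWithinAt) isOpen_rhp
  refine hK.eqOn_of_preconnected_of_frequently_eq hQ convex_rhp.isPreconnected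
    (z₀ := ((1:ℝ):ℂ)) (by simp) ?_ hz
  have ht : Tendsto (fun t : ℝ => (t:ℂ)) (𝓝[≠] (1:ℝ)) (𝓝[≠] ((1:ℝ):ℂ)) := by
    apply tendsto_nhdsWithin_of_tendsto_nhds_of_eventually_within
    · exact (Complex.continuous_ofReal.tendsto 1).mono_left nhdsWithin_le_nhds
    · filter_upwards [eventually_mem_nhdsWithin] with t ht
      simpa using ht
  refine ht.frequently (Eventually.frequently ?_)
  have : ∀ᶠ t : ℝ in 𝓝[≠] (1:ℝ), 0 < t :=
    (lt_mem_nhds one_pos).filter_mono nhdsWithin_le_nhds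
  exact this.mono fun t ht => Kc_ofReal' ht

lemma Kc_conj {z : ℂ} (hz : z ∈ Complex.slitPlane) : Kc (starRingEnd ℂ z) = starRingEnd ℂ (Kc z) := by
  simp only [Kc, map_add, map_neg, map_mul, Ec_conj, Ic_conj,
    Complex.log_conj z (Complex.slitPlane_arg_ne_pi hz)]

lemma I_mul_mem_slit {x : ℝ} (hx : x ≠ 0) : Complex.I * x ∈ Complex.slitPlane := by
  right; simpa using hx

/-- jump relation on the imaginary axis -/
lemma Kc_jump {x : ℝ} (hx : 0 < x) :
    Kc (-(Complex.I * x)) = Kc (Complex.I * x) + Complex.I * Real.pi * Ic (Complex.I * x) := by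
  have h1 : Complex.log (Complex.I * x) = Real.log x + (Real.pi / 2 : ℝ) * Complex.I := by
    rw [mul_comm, Complex.log_ofReal_mul hx Complex.I_ne_zero, Complex.log_I]
    push_cast; ring
  have h2 : Complex.log (-(Complex.I * x)) = Real.log x - (Real.pi / 2 : ℝ) * Complex.I := by
    rw [mul_comm, ← mul_neg, Complex.log_ofReal_mul hx (neg_ne_zero.2 Complex.I_ne_zero), Complex.log_neg_I]
    push_cast; ring
  simp only [Kc, h1, h2, Ec_even, Ic_even]
  push_cast; ring

lemma closure_bound {z : ℂ} (hz : 0 ≤ z.re) (hz0 : z ≠ 0) :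
    ‖Kc z‖ ≤ 2 * (1 + 1 / ‖z‖) * Real.exp (-z.re) := by
  have hs : z ∈ Complex.slitPlane := by
    rcases hz.lt_or_eq with h | h
    · exact Or.inl h
    · right; intro hi; exact hz0 (Complex.ext h.symm hi)
  have l0 : Tendsto (fun t : ℝ => z + t) (𝓝[>] (0:ℝ)) (𝓝 z) := by
    have : Tendsto (fun t : ℝ => z + t) (𝓝 (0:ℝ)) (𝓝 (z + (0:ℝ))) :=
      (Continuous.tendsto (by fun_prop) 0)
    rw [Complex.ofReal_zero, add_zero] at this
    exact this.mono_left nhdsWithin_le_nhds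
  have hl := ((Kc_hasDerivAt hs).continuousAt.tendsto.comp l0).norm
  have hr : ContinuousAt (fun z : ℂ => 2 * (1 + 1 / ‖z‖) * Real.exp (-z.re)) z := by
    have : ‖z‖ ≠ 0 := norm_ne_zero_iff.2 hz0
    have h2 : ContinuousAt (fun z : ℂ => 1 / ‖z‖) z :=
      continuousAt_const.div continuous_norm.continuousAt this
    have h3 : ContinuousAt (fun z : ℂ => z.re) z := Complex.continuous_re.continuousAt
    fun_prop
  have hr2 := hr.tendsto.comp l0
  refine le_of_tendsto_of_tendsto hl hr2 ?_
  filter_upwards [eventually_mem_nhdsWithin] with t ht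
  have ht' : 0 < t := ht
  have hre : 0 < (z + t).re := by simp; linarith
  simp only [Function.comp]
  rw [Kc_eq_KQ hre]
  exact KQ_bound hre

end PartA3


section PartB1
open MeasureTheory Topology

lemma rpow_norm_mul_Kc_tendsto {r : ℝ} (hr : 0 < r) :
    Tendsto (fun z : ℂ => ‖z‖ ^ r * ‖Kc z‖) (𝓝[≠] 0) (𝓝 0) := by
  have hn : Tendsto (fun z : ℂ => ‖z‖) (𝓝[≠] 0) (𝓝[>] 0) := by
    apply tendsto_nhdsWithin_of_tendsto_nhds_of_eventually_within
    · have := (continuous_norm (E := ℂ)).tendsto 0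
      rw [norm_zero] at this
      exact this.mono_left nhdsWithin_le_nhds
    · filter_upwards [eventually_mem_nhdsWithin] with z hz
      exact norm_pos_iff.2 hz
  have h1 := (tendsto_log_mul_rpow_nhdsGT_zero hr).comp hn
  have h2 : Tendsto (fun z : ℂ => ‖z‖ ^ r) (𝓝[≠] 0) (𝓝 0) := by
    have h := (Real.continuousAt_rpow_const 0 r (Or.inr hr.le)).tendsto
    rw [Real.zero_rpow hr.ne'] at h
    exact (h.mono_left nhdsWithin_le_nhds).comp hn
  have hI : Tendsto (fun z : ℂ => ‖Ic z‖) (𝓝[≠] 0) (𝓝 ‖Ic 0‖) :=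
    ((Ic_hasDerivAt 0).continuousAt.tendsto.norm).mono_left nhdsWithin_le_nhds
  have hE : Tendsto (fun z : ℂ => ‖Ec z‖) (𝓝[≠] 0) (𝓝 ‖Ec 0‖) :=
    ((Ec_hasDerivAt 0).continuousAt.tendsto.norm).mono_left nhdsWithin_le_nhds
  have hb := (hI.mul (h1.norm.add (h2.mul_const Real.pi))).add (h2.mul hE)
  simp only [norm_zero, zero_mul, add_zero, mul_zero] at hb
  refine squeeze_zero (fun z => by positivity) (fun z => ?_) hb
  have hlog : ‖Complex.log z‖ ≤ |Real.log ‖z‖| + Real.pi := by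
    refine (Complex.norm_le_abs_re_add_abs_im _).trans ?_
    rw [Complex.log_re, Complex.log_im]
    gcongr
    exact Complex.abs_arg_le_pi z
  have hK : ‖Kc z‖ ≤ ‖Ic z‖ * (|Real.log ‖z‖| + Real.pi) + ‖Ec z‖ := by
    rw [Kc]
    refine (norm_add_le _ _).trans ?_
    rw [norm_neg, norm_mul]
    gcongr
  have hp : 0 ≤ ‖z‖ ^ r := by positivity
  calc ‖z‖ ^ r * ‖Kc z‖ ≤ ‖z‖ ^ r * (‖Ic z‖ * (|Real.log ‖z‖| + Real.pi) + ‖Ec z‖) := by gcongr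
    _ = _ := by
      simp only [Function.comp, norm_mul, Real.norm_eq_abs, abs_of_nonneg hp]; ring

lemma mul_Kc_pow_tendsto (n : ℕ) : Tendsto (fun z : ℂ => z * Kc z ^ n) (𝓝[≠] 0) (𝓝 0) := by
  rcases Nat.eq_zero_or_pos n with rfl | hn
  · simp only [pow_zero, mul_one]
    exact tendsto_id.mono_left nhdsWithin_le_nhds
  · rw [tendsto_zero_iff_norm_tendsto_zero]
    have hn' : (0:ℝ) < n := by exact_mod_cast hn
    have h := (rpow_norm_mul_Kc_tendsto (r := 1 / n) (by positivity)).pow n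
    rw [zero_pow hn.ne'] at h
    refine h.congr fun z => ?_
    rw [mul_pow, ← Real.rpow_natCast, ← Real.rpow_mul (norm_nonneg _), norm_mul, norm_pow]
    congr 1
    rw [one_div, inv_mul_cancel₀ hn'.ne', Real.rpow_one]

noncomputable def Gc (N b n : ℕ) (z : ℂ) : ℂ := z ^ (2 * b + 1) * Ic z ^ (N - n) * Kc z ^ n

lemma Gc_continuousAt_zero (N b n : ℕ) : ContinuousAt (Gc N b n) 0 := by
  rw [continuousAt_iff_punctured_nhds]
  have h0 : Gc N b n 0 = 0 := by simp [Gc]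
  rw [h0]
  have h1 : Tendsto (fun z : ℂ => z ^ (2 * b) * Ic z ^ (N - n)) (𝓝[≠] 0)
      (𝓝 (0 ^ (2 * b) * Ic 0 ^ (N - n))) :=
    ((continuousAt_id.pow _).mul ((Ic_hasDerivAt 0).continuousAt.pow _)).tendsto.mono_left
      nhdsWithin_le_nhds
  have h := h1.mul (mul_Kc_pow_tendsto n)
  rw [mul_zero] at h
  refine h.congr fun z => ?_
  rw [Gc]; ring

lemma mem_slit_of_re_nonneg {z : ℂ} (hz : 0 ≤ z.re) (hz0 : z ≠ 0) : z ∈ Complex.slitPlane := by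
  rcases hz.lt_or_eq with h | h
  · exact Or.inl h
  · right; intro hi; exact hz0 (Complex.ext h.symm hi)

lemma Gc_differentiableAt (N b n : ℕ) {z : ℂ} (hz : z ∈ Complex.slitPlane) :
    DifferentiableAt ℂ (Gc N b n) z := by
  have h1 := (Ic_hasDerivAt z).differentiableAt
  have h2 := (Kc_hasDerivAt hz).differentiableAt
  unfold Gc
  fun_prop

lemma Gc_continuousAt (N b n : ℕ) {z : ℂ} (hz : 0 ≤ z.re) : ContinuousAt (Gc N b n) z := by
  by_cases h : z = 0
  · subst h; exact Gc_continuousAt_zero N b n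
  · exact (Gc_differentiableAt N b n (mem_slit_of_re_nonneg hz h)).continuousAt

lemma Gc_conj (N b n : ℕ) {z : ℂ} (hz : 0 ≤ z.re) :
    Gc N b n (starRingEnd ℂ z) = starRingEnd ℂ (Gc N b n z) := by
  by_cases h : z = 0
  · subst h; simp [Gc]
  · simp [Gc, Ic_conj, Kc_conj (mem_slit_of_re_nonneg hz h)]

noncomputable def om (s : ℝ) (z : ℂ) : ℂ :=
  Ic z * Kc (z + Complex.I * s) - Kc z * Ic (z + Complex.I * s)

noncomputable def Fc (k b c : ℕ) (s : ℝ) (z : ℂ) : ℂ :=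
  z ^ (2 * b + 1) * (z + Complex.I * s) ^ (2 * c + 1) * om s z ^ (2 * k + 1)

lemma Fc_expand (k b c : ℕ) (s : ℝ) (z : ℂ) :
    Fc k b c s z = ∑ n ∈ Finset.range (2 * k + 1 + 1), (-1) ^ n * ((2 * k + 1).choose n : ℂ) *
      (Gc (2 * k + 1) b n z * Gc (2 * k + 1) c (2 * k + 1 - n) (z + Complex.I * s)) := by
  rw [Fc, om, sub_eq_neg_add, add_pow (-(Kc z * Ic (z + Complex.I * s))), Finset.mul_sum]
  refine Finset.sum_congr rfl fun n hn => ?_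
  have hn' : n ≤ 2 * k + 1 := Nat.lt_succ_iff.1 (Finset.mem_range.1 hn)
  rw [Gc, Gc, Nat.sub_sub_self hn', neg_pow, mul_pow, mul_pow]
  ring

lemma re_add_I_mul (z : ℂ) (s : ℝ) : (z + Complex.I * s).re = z.re := by simp

lemma Fc_continuousAt (k b c : ℕ) (s : ℝ) {z : ℂ} (hz : 0 ≤ z.re) :
    ContinuousAt (Fc k b c s) z := by
  have : Fc k b c s = fun z => ∑ n ∈ Finset.range (2 * k + 1 + 1), (-1) ^ n * ((2 * k + 1).choose n : ℂ) *
      (Gc (2 * k + 1) b n z * Gc (2 * k + 1) c (2 * k + 1 - n) (z + Complex.I * s)) := by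
    ext z; exact Fc_expand k b c s z
  rw [this]
  unfold ContinuousAt
  refine tendsto_finsetSum _ fun n _ => ?_
  have h1 := Gc_continuousAt (2 * k + 1) b n hz
  have h2 : ContinuousAt (fun z : ℂ => Gc (2 * k + 1) c (2 * k + 1 - n) (z + Complex.I * s)) z :=
    ContinuousAt.comp (f := fun z : ℂ => z + Complex.I * s)
      (Gc_continuousAt (2 * k + 1) c (2 * k + 1 - n) (by rw [re_add_I_mul]; exact hz)) (by fun_prop)
  exact tendsto_const_nhds.mul (h1.mul h2)

lemma Fc_differentiableAt (k b c : ℕ) (s : ℝ) {z : ℂ} (hz : 0 < z.re) :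
    DifferentiableAt ℂ (Fc k b c s) z := by
  have h1 := (Ic_hasDerivAt z).differentiableAt
  have h2 := (Kc_hasDerivAt (rhp_slit hz)).differentiableAt
  have h3 : DifferentiableAt ℂ (fun z : ℂ => Ic (z + Complex.I * s)) z :=
    DifferentiableAt.comp (f := fun z : ℂ => z + Complex.I * s) z
      (Ic_hasDerivAt _).differentiableAt (by fun_prop)
  have h4 : DifferentiableAt ℂ (fun z : ℂ => Kc (z + Complex.I * s)) z :=
    DifferentiableAt.comp (f := fun z : ℂ => z + Complex.I * s) z
      (Kc_hasDerivAt (rhp_slit (by rw [re_add_I_mul]; exact hz))).differentiableAt (by fun_prop)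
  unfold Fc om
  fun_prop

/-- Gronwall estimate -/
lemma om_bound {s : ℝ} (hs : 0 ≤ s) {z : ℂ} (hz : 0 ≤ z.re) (hz1 : s + 1 ≤ ‖z‖) :
    ‖(z + Complex.I * s) * om s z + Complex.I * Real.sin s‖ ≤ Real.exp (2 * s) / (‖z‖ - s) := by
  set ρ := ‖z‖ - s with hρ
  have hρ1 : 1 ≤ ρ := by linarith
  have hy : ∀ σ ∈ Set.Icc 0 s, ρ ≤ ‖z + Complex.I * σ‖ := by
    intro σ hσ
    have := norm_sub_norm_le z (-(Complex.I * σ))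
    rw [norm_neg, norm_mul, Complex.norm_I, one_mul, Complex.norm_real, Real.norm_of_nonneg hσ.1,
      sub_neg_eq_add] at this
    linarith [hσ.2]
  have hyne : ∀ σ ∈ Set.Icc 0 s, z + Complex.I * σ ≠ 0 := by
    intro σ hσ h
    have := hy σ hσ
    rw [h, norm_zero] at this
    linarith
  have hslit : ∀ σ ∈ Set.Icc 0 s, z + Complex.I * σ ∈ Complex.slitPlane := fun σ hσ =>
    mem_slit_of_re_nonneg (by rw [re_add_I_mul]; exact hz) (hyne σ hσ)
  set e1 : ℝ → ℂ := fun σ => (z + Complex.I * σ) * om σ z + Complex.I * Real.sin σ with he1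
  set P : ℝ → ℂ := fun σ => Complex.I * (z + Complex.I * σ) *
    (Ic z * Kc1 (z + Complex.I * σ) - Kc z * Ic1 (z + Complex.I * σ)) with hP
  set e2 : ℝ → ℂ := fun σ => P σ + Complex.I * Real.cos σ with he2
  have hd0 : ∀ σ : ℝ, HasDerivAt (fun σ : ℝ => z + Complex.I * σ) Complex.I σ := by
    intro σ
    have := ((hasDerivAt_id σ).ofReal_comp.const_mul Complex.I).const_add z
    simpa using this
  have hcomp : ∀ {f : ℂ → ℂ} {f' : ℂ} {σ : ℝ}, HasDerivAt f f' (z + Complex.I * σ) →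
      HasDerivAt (fun σ : ℝ => f (z + Complex.I * σ)) (f' * Complex.I) σ := by
    intro f f' σ h
    exact h.comp σ (hd0 σ)
  have hd1 : ∀ σ ∈ Set.Icc 0 s, HasDerivAt e1
      (e2 σ + Complex.I / (z + Complex.I * σ) * (e1 σ - Complex.I * Real.sin σ)) σ := by
    intro σ hσ
    have hK := hcomp (Kc_hasDerivAt (hslit σ hσ))
    have hI := hcomp (Ic_hasDerivAt (z + Complex.I * σ))
    have hsn := (Real.hasDerivAt_sin σ).ofReal_comp.const_mul Complex.I
    have h := ((hd0 σ).mul ((hK.const_mul (Ic z)).sub (hI.const_mul (Kc z)))).add hsn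
    refine h.congr_deriv ?_
    have hne := hyne σ hσ
    simp only [he1, he2, hP, om, Pi.sub_apply]
    field_simp
    ring
  have hd2 : ∀ σ ∈ Set.Icc 0 s, HasDerivAt e2 (-e1 σ) σ := by
    intro σ hσ
    have hK := hcomp (Kc1_hasDerivAt (hslit σ hσ))
    have hI := hcomp (Ic1_hasDerivAt (z + Complex.I * σ))
    have hcs := (Real.hasDerivAt_cos σ).ofReal_comp.const_mul Complex.I
    have h := (((hd0 σ).const_mul Complex.I).mul ((hK.const_mul (Ic z)).sub (hI.const_mul (Kc z)))).add hcs
    refine h.congr_deriv ?_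
    have hne := hyne σ hσ
    have ho := Ic_ode (z + Complex.I * σ)
    simp only [he1, om, Pi.sub_apply]
    have hI2 : Complex.I ^ 2 = -1 := Complex.I_sq
    push_cast
    field_simp
    linear_combination (Kc z) * ho + (- Kc z * Ic1 (z + Complex.I * σ) + (z + Complex.I * σ) *
      (Ic z * Kc (z + Complex.I * σ) - Kc z * Ic2 (z + Complex.I * σ))) * hI2
  have hgr := norm_le_gronwallBound_of_norm_deriv_right_le (f := fun σ => (e1 σ, e2 σ))
    (f' := fun σ => (e2 σ + Complex.I / (z + Complex.I * σ) * (e1 σ - Complex.I * Real.sin σ), -e1 σ))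
    (δ := 0) (K := 2) (ε := 1 / ρ) (a := 0) (b := s) ?_ ?_ ?_ ?_ s ⟨hs, le_refl _⟩
  · have h1 : ‖e1 s‖ ≤ ‖(e1 s, e2 s)‖ := norm_fst_le (e1 s, e2 s)
    refine h1.trans (hgr.trans ?_)
    rw [gronwallBound_of_K_ne_0 two_ne_zero]
    simp only [zero_mul, zero_add, sub_zero]
    have hE := Real.exp_pos (2 * s)
    have : 0 < ρ := by linarith
    rw [div_div, div_mul_eq_mul_div, div_le_div_iff₀ (by positivity) this]
    nlinarith
  · intro σ hσ
    exact ((hd1 σ hσ).continuousAt.prodMk (hd2 σ hσ).continuousAt).continuousWithinAt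
  · intro σ hσ
    have hσ' : σ ∈ Set.Icc 0 s := ⟨hσ.1, hσ.2.le⟩
    exact ((hd1 σ hσ').prodMk (hd2 σ hσ')).hasDerivWithinAt
  · have hz0 : z ≠ 0 := by rintro rfl; rw [norm_zero] at hz1; linarith
    have hw := Kc_wronskian hz0
    have a1 : e1 0 = 0 := by simp [he1, om]; right; ring
    have a2 : e2 0 = 0 := by
      simp only [he2, hP, Complex.ofReal_zero, mul_zero, add_zero, Real.cos_zero, Complex.ofReal_one]
      linear_combination Complex.I * hw
    simp [a1, a2]
  · intro σ hσ
    have hσ' : σ ∈ Set.Icc 0 s := ⟨hσ.1, hσ.2.le⟩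
    have m1 : ‖e1 σ‖ ≤ ‖(e1 σ, e2 σ)‖ := norm_fst_le (e1 σ, e2 σ)
    have m2 : ‖e2 σ‖ ≤ ‖(e1 σ, e2 σ)‖ := norm_snd_le (e1 σ, e2 σ)
    have hρp : 0 < ρ := by linarith
    set M := ‖(e1 σ, e2 σ)‖
    have hM : 0 ≤ M := norm_nonneg _
    rw [Prod.norm_def, max_le_iff]
    have hinv : 0 < 1 / ρ := by positivity
    constructor
    · have q : ‖Complex.I / (z + Complex.I * σ)‖ ≤ 1 / ρ := by
        rw [norm_div, Complex.norm_I]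
        gcongr
        exact hy σ hσ'
      have q2 : ‖e1 σ - Complex.I * Real.sin σ‖ ≤ M + 1 := by
        refine (norm_sub_le _ _).trans (add_le_add m1 ?_)
        rw [norm_mul, Complex.norm_I, one_mul, Complex.norm_real]
        exact Real.abs_sin_le_one σ
      have q3 : 1 / ρ ≤ 1 := by rw [div_le_one hρp]; exact hρ1
      calc _ ≤ ‖e2 σ‖ + ‖Complex.I / (z + Complex.I * σ) * (e1 σ - Complex.I * Real.sin σ)‖ :=
            norm_add_le _ _
        _ ≤ M + (1 / ρ) * (M + 1) := by
            rw [norm_mul]; gcongr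
        _ ≤ 2 * M + 1 / ρ := by nlinarith
    · rw [norm_neg]; linarith

noncomputable def ellc (k b c : ℕ) (s : ℝ) : ℂ :=
  if b + c + 1 = k then (-(Complex.I * Real.sin s)) ^ (2 * k + 1) else 0

noncomputable def rhpInf : Filter ℂ := Bornology.cobounded ℂ ⊓ 𝓟 {z : ℂ | 0 ≤ z.re}

lemma om_tendsto {s : ℝ} (hs : 0 ≤ s) :
    Tendsto (fun z => (z + Complex.I * s) * om s z) rhpInf (𝓝 (-(Complex.I * Real.sin s))) := by
  have hn : Tendsto (fun z : ℂ => ‖z‖) rhpInf atTop :=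
    tendsto_norm_cobounded_atTop.mono_left inf_le_left
  have hre : ∀ᶠ z in rhpInf, 0 ≤ z.re := mem_inf_of_right (mem_principal_self _)
  rw [tendsto_iff_norm_sub_tendsto_zero]
  have hb : Tendsto (fun z : ℂ => Real.exp (2 * s) / (‖z‖ - s)) rhpInf (𝓝 0) :=
    Tendsto.div_atTop tendsto_const_nhds (tendsto_atTop_add_const_right _ (-s) hn)
  refine squeeze_zero' (Eventually.of_forall fun z => norm_nonneg _) ?_ hb
  filter_upwards [hre, hn.eventually_ge_atTop (s + 1)] with z h1 h2
  rw [sub_neg_eq_add]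
  exact om_bound hs h1 h2

lemma Fc_tendsto {k b c : ℕ} (hbc : b + c + 1 ≤ k) {s : ℝ} (hs : 0 ≤ s) :
    Tendsto (fun z => z * Fc k b c s z) rhpInf (𝓝 (ellc k b c s)) := by
  have hn : Tendsto (fun z : ℂ => ‖z‖) rhpInf atTop :=
    tendsto_norm_cobounded_atTop.mono_left inf_le_left
  have hcb : Tendsto (fun z : ℂ => z + Complex.I * s) rhpInf (Bornology.cobounded ℂ) := by
    rw [← tendsto_norm_atTop_iff_cobounded]
    refine tendsto_atTop_mono (fun z => ?_) (tendsto_atTop_add_const_right _ (-s) hn)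
    have := norm_sub_norm_le z (-(Complex.I * s))
    rw [norm_neg, norm_mul, Complex.norm_I, one_mul, Complex.norm_real, Real.norm_of_nonneg hs,
      sub_neg_eq_add] at this
    linarith
  have hinv : Tendsto (fun z : ℂ => (z + Complex.I * s)⁻¹) rhpInf (𝓝 0) :=
    tendsto_inv₀_cobounded.comp hcb
  have hne : ∀ᶠ z in rhpInf, z + Complex.I * s ≠ 0 :=
    hcb.eventually (Bornology.eventually_ne_cobounded 0)
  have hq : Tendsto (fun z : ℂ => z * (z + Complex.I * s)⁻¹) rhpInf (𝓝 1) := by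
    have h := (hinv.const_mul (Complex.I * s)).const_sub 1
    rw [mul_zero, sub_zero] at h
    refine h.congr' (hne.mono fun z hz => ?_)
    field_simp
    ring
  have ho := (om_tendsto hs).pow (2 * k + 1)
  have h := ((hq.pow (2 * b + 2)).mul (hinv.pow (2 * (k - 1 - b - c)))).mul ho
  have hl : (1:ℂ) ^ (2 * b + 2) * 0 ^ (2 * (k - 1 - b - c)) * (-(Complex.I * Real.sin s)) ^ (2 * k + 1)
      = ellc k b c s := by
    rw [ellc]
    split_ifs with hh
    · have : k - 1 - b - c = 0 := by omega
      simp [this]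
    · have : 2 * (k - 1 - b - c) ≠ 0 := by omega
      rw [zero_pow this]; ring
  rw [hl] at h
  refine h.congr' (hne.mono fun z hz => ?_)
  have e : 2 * k + 1 = (2 * b + 2) + (2 * (k - 1 - b - c)) + (2 * c + 1) := by omega
  simp only [Fc]
  rw [mul_pow _ (om s z)]
  generalize om s z ^ (2 * k + 1) = O
  rw [show (z + Complex.I * s) ^ (2 * k + 1) = (z + Complex.I * s) ^ (2 * b + 2) *
    (z + Complex.I * s) ^ (2 * (k - 1 - b - c)) * (z + Complex.I * s) ^ (2 * c + 1) by
      rw [← pow_add, ← pow_add, ← e]]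
  generalize z + Complex.I * s = y at *
  rw [mul_pow, inv_pow, inv_pow]
  field_simp
  ring

lemma Fc_reflect (k b c : ℕ) (s : ℝ) {τ : ℝ} (hs : 0 ≤ s) (hτ : 0 < τ) :
    Fc k b c s (-(Complex.I * (s + τ : ℝ))) = - Fc k c b s (Complex.I * τ) := by
  have e1 : -(Complex.I * (s + τ : ℝ)) + Complex.I * s = -(Complex.I * τ) := by push_cast; ring
  have e2 : Complex.I * τ + Complex.I * s = Complex.I * (s + τ : ℝ) := by push_cast; ring
  have hom : om s (-(Complex.I * (s + τ : ℝ))) = - om s (Complex.I * τ) := by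
    rw [om, om, e1, e2, Kc_jump hτ, Kc_jump (by linarith : 0 < s + τ), Ic_even, Ic_even]
    ring
  rw [Fc, Fc, hom, e1, e2, Odd.neg_pow ⟨b, rfl⟩, Odd.neg_pow ⟨c, rfl⟩, Odd.neg_pow ⟨k, rfl⟩]
  ring

end PartB1


section PartB2
open MeasureTheory Topology

lemma rhpInf_eventually {p : ℂ → Prop} (h : ∀ᶠ z in rhpInf, p z) :
    ∃ R0 : ℝ, ∀ z : ℂ, 0 ≤ z.re → R0 ≤ ‖z‖ → p z := by
  rw [rhpInf, eventually_inf_principal] at h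
  obtain ⟨R0, -, hR⟩ := (Filter.hasBasis_cobounded_norm (E := ℂ)).eventually_iff.1 h
  exact ⟨R0, fun z h1 h2 => hR h2 h1⟩

lemma contour_left_tendsto {H : ℂ → ℂ} {s : ℝ} (hs : 0 < s)
    (hc : ∀ z : ℂ, 0 ≤ z.re → ContinuousAt H z) (hd : ∀ z : ℂ, 0 < z.re → DifferentiableAt ℂ H z)
    (hl : Tendsto (fun z => z * H z) rhpInf (𝓝 0)) :
    Tendsto (fun R : ℝ => ∫ τ in (-s-R)..R, H (Complex.I * τ)) atTop (𝓝 0) := by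
  rw [Metric.tendsto_atTop]
  intro ε hε
  have hev : ∀ᶠ z in rhpInf, ‖z * H z‖ ≤ ε / 7 := by
    have := (tendsto_zero_iff_norm_tendsto_zero.1 hl).eventually (gt_mem_nhds (by positivity : 0 < ε / 7))
    exact this.mono fun z hz => hz.le
  obtain ⟨R0, hR0⟩ := rhpInf_eventually hev
  refine ⟨max (max R0 s) 1, fun R hR => ?_⟩
  have hRR0 : R0 ≤ R := (le_max_left _ _).trans ((le_max_left _ _).trans hR)
  have hRs : s ≤ R := (le_max_right _ _).trans ((le_max_left _ _).trans hR)
  have hR1 : 1 ≤ R := (le_max_right _ _).trans hR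
  have hRp : 0 < R := by linarith
  have hb : ∀ z : ℂ, 0 ≤ z.re → R ≤ ‖z‖ → ‖H z‖ ≤ ε / 7 / R := by
    intro z h1 h2
    have h3 := hR0 z h1 (hRR0.trans h2)
    rw [norm_mul] at h3
    rw [le_div_iff₀ hRp]
    nlinarith [norm_nonneg (H z)]
  have hrect := Complex.integral_boundary_rect_eq_zero_of_continuousOn_of_differentiableOn H
    ⟨0, -s-R⟩ ⟨R + s/2, R⟩ ?_ ?_
  · simp only [Complex.ofReal_zero, zero_add] at hrect
    have hleft : ∫ τ in (-s-R)..R, H (Complex.I * τ) = ∫ τ in (-s-R)..R, H (τ * Complex.I) := by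
      congr 1; ext τ; rw [mul_comm]
    rw [dist_zero_right, hleft]
    set A := ∫ x in (0:ℝ)..(R + s/2), H (x + ((-s-R : ℝ) : ℂ) * Complex.I)
    set B := ∫ x in (0:ℝ)..(R + s/2), H (x + ((R : ℝ) : ℂ) * Complex.I)
    set C := ∫ y in (-s-R)..R, H (((R + s/2 : ℝ) : ℂ) + y * Complex.I)
    set D := ∫ y in (-s-R)..R, H (y * Complex.I)
    have hA : ‖A‖ ≤ ε / 7 / R * (R + s/2) := by
      have := intervalIntegral.norm_integral_le_of_norm_le_const (a := 0) (b := R + s/2)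
        (f := fun x : ℝ => H (x + ((-s-R : ℝ) : ℂ) * Complex.I)) (C := ε / 7 / R) (by
          intro x hx
          rw [Set.uIoc_of_le (by linarith)] at hx
          apply hb
          · simp [hx.1.le]
          · refine le_trans ?_ (Complex.abs_im_le_norm _)
            simp
            rw [abs_of_nonpos (by linarith)]
            linarith)
      rwa [sub_zero, abs_of_pos (by linarith)] at this
    have hB : ‖B‖ ≤ ε / 7 / R * (R + s/2) := by
      have := intervalIntegral.norm_integral_le_of_norm_le_const (a := 0) (b := R + s/2)
        (f := fun x : ℝ => H (x + ((R : ℝ) : ℂ) * Complex.I)) (C := ε / 7 / R) (by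
          intro x hx
          rw [Set.uIoc_of_le (by linarith)] at hx
          apply hb
          · simp [hx.1.le]
          · refine le_trans ?_ (Complex.abs_im_le_norm _)
            simp
            exact le_abs_self R)
      rwa [sub_zero, abs_of_pos (by linarith)] at this
    have hC : ‖C‖ ≤ ε / 7 / R * (2 * R + s) := by
      have := intervalIntegral.norm_integral_le_of_norm_le_const (a := -s-R) (b := R)
        (f := fun y : ℝ => H (((R + s/2 : ℝ) : ℂ) + y * Complex.I)) (C := ε / 7 / R) (by
          intro x hx
          apply hb
          · simp; linarith
          · refine le_trans ?_ (Complex.abs_re_le_norm _)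
            simp
            rw [abs_of_nonneg (by linarith)]
            linarith)
      rw [abs_of_pos (by linarith)] at this
      refine this.trans (le_of_eq ?_)
      ring
    have e : D = C - Complex.I * (A - B) := by
      have h2 : Complex.I * (A - B + Complex.I * C - Complex.I * D) = 0 := by
        simp only [smul_eq_mul] at hrect
        rw [hrect, mul_zero]
      linear_combination (D - C) * Complex.I_sq + h2
    have : ‖D‖ ≤ ε / 7 / R * (4 * R + 2 * s) := by
      rw [e]
      calc _ ≤ ‖C‖ + ‖Complex.I * (A - B)‖ := norm_sub_le _ _
        _ ≤ ‖C‖ + (‖A‖ + ‖B‖) := by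
            rw [norm_mul, Complex.norm_I, one_mul]; gcongr; exact norm_sub_le _ _
        _ ≤ ε / 7 / R * (2 * R + s) + (ε / 7 / R * (R + s/2) + ε / 7 / R * (R + s/2)) := by gcongr
        _ = _ := by ring
    refine this.trans_lt ?_
    calc ε / 7 / R * (4 * R + 2 * s) ≤ ε / 7 / R * (6 * R) := by gcongr; linarith
      _ = 6 / 7 * ε := by field_simp
      _ < ε := by linarith
  · intro z hz
    rw [Complex.mem_reProdIm] at hz
    have : 0 ≤ z.re := by
      have := hz.1
      rw [Set.uIcc_of_le (by simp; linarith)] at this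
      exact this.1
    exact (hc z this).continuousWithinAt
  · intro z hz
    rw [Complex.mem_reProdIm] at hz
    have : 0 < z.re := by
      have := hz.1.1
      rw [min_eq_left (by simp; linarith)] at this
      exact this
    exact (hd z this).differentiableWithinAt

lemma ellc_symm (k b c : ℕ) (s : ℝ) : ellc k c b s = ellc k b c s := by
  simp only [ellc, add_comm]

lemma int_one_div (R : ℝ) :
    ∫ σ in (-R)..R, (1 + Complex.I * (σ:ℂ))⁻¹ = 2 * Real.arctan R := by
  have hne : ∀ σ : ℝ, (1 + Complex.I * (σ:ℂ)) ≠ 0 := by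
    intro σ h
    have := congrArg Complex.re h
    simp at this
  have hcont : Continuous (fun σ : ℝ => (1 + Complex.I * (σ:ℂ))⁻¹) :=
    Continuous.inv₀ (by fun_prop) hne
  have h1 : ∫ σ in (-R)..R, (1 + Complex.I * (σ:ℂ))⁻¹ = ∫ σ in (-R)..R, (1 - Complex.I * (σ:ℂ))⁻¹ := by
    have := intervalIntegral.integral_comp_neg (a := -R) (b := R) (fun σ : ℝ => (1 - Complex.I * (σ:ℂ))⁻¹)
    rw [neg_neg] at this
    rw [← this]
    congr 1; ext σ; push_cast; ring_nf
  have hcont2 : Continuous (fun σ : ℝ => (1 - Complex.I * (σ:ℂ))⁻¹) := by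
    have := hcont.comp continuous_neg
    refine this.congr fun σ => ?_
    simp [Function.comp, sub_eq_add_neg]
  have h2 : 2 * ∫ σ in (-R)..R, (1 + Complex.I * (σ:ℂ))⁻¹ =
      ∫ σ in (-R)..R, (((2 * (1 + σ^2)⁻¹ : ℝ)) : ℂ) := by
    rw [two_mul]
    nth_rw 2 [h1]
    rw [← intervalIntegral.integral_add (hcont.intervalIntegrable _ _) (hcont2.intervalIntegrable _ _)]
    congr 1
    ext σ
    have a := hne σ
    have b : (1 - Complex.I * (σ:ℂ)) ≠ 0 := by
      have := hne (-σ)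
      simpa [sub_eq_add_neg] using this
    have c : (1 + (σ:ℂ)^2) ≠ 0 := by
      have : (1 + σ^2 : ℝ) ≠ 0 := by positivity
      exact_mod_cast this
    push_cast
    field_simp
    linear_combination (2 * (σ:ℂ)^2) * Complex.I_sq
  rw [intervalIntegral.integral_ofReal, intervalIntegral.integral_const_mul, integral_inv_one_add_sq,
    Real.arctan_neg] at h2
  simp only [Complex.ofReal_mul, Complex.ofReal_sub, Complex.ofReal_neg, Complex.ofReal_ofNat] at h2
  linear_combination h2 / 2

lemma contour_identity {k b c : ℕ} (hbc : b + c + 1 ≤ k) {s : ℝ} (hs : 0 < s) :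
    ∫ u in (0:ℝ)..s, (Fc k b c s (-(Complex.I * u)) + Fc k c b s (-(Complex.I * u))) =
      2 * Real.pi * ellc k b c s := by
  set F : ℂ → ℂ := fun z => Fc k b c s z + Fc k c b s z with hF
  set ℓ := ellc k b c s with hℓ
  set q : ℂ → ℂ := fun z => (z + 1 + Complex.I * (s/2 : ℝ))⁻¹ with hq
  have hqne : ∀ z : ℂ, 0 ≤ z.re → z + 1 + Complex.I * (s/2 : ℝ) ≠ 0 := by
    intro z hz h
    have := congrArg Complex.re h
    simp at this
    linarith
  set H : ℂ → ℂ := fun z => F z - 2 * ℓ * q z with hH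
  have hFc : ∀ z : ℂ, 0 ≤ z.re → ContinuousAt F z := fun z hz =>
    (Fc_continuousAt k b c s hz).add (Fc_continuousAt k c b s hz)
  have hqd : ∀ z : ℂ, 0 ≤ z.re → DifferentiableAt ℂ q z := fun z hz =>
    DifferentiableAt.inv (by fun_prop) (hqne z hz)
  have hHc : ∀ z : ℂ, 0 ≤ z.re → ContinuousAt H z := fun z hz =>
    (hFc z hz).sub (continuousAt_const.mul (hqd z hz).continuousAt)
  have hHd : ∀ z : ℂ, 0 < z.re → DifferentiableAt ℂ H z := fun z hz =>
    ((Fc_differentiableAt k b c s hz).add (Fc_differentiableAt k c b s hz)).sub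
      ((hqd z hz.le).const_mul _)
  have hre : ∀ᶠ z in rhpInf, 0 ≤ z.re := mem_inf_of_right (mem_principal_self _)
  have hzq : Tendsto (fun z => z * q z) rhpInf (𝓝 1) := by
    have hcb : Tendsto (fun z : ℂ => z + 1 + Complex.I * (s/2 : ℝ)) rhpInf (Bornology.cobounded ℂ) := by
      rw [← tendsto_norm_atTop_iff_cobounded]
      have hn : Tendsto (fun z : ℂ => ‖z‖) rhpInf atTop :=
        tendsto_norm_cobounded_atTop.mono_left inf_le_left
      refine tendsto_atTop_mono (fun z => ?_)
        (tendsto_atTop_add_const_right _ (-‖1 + Complex.I * (s/2 : ℝ)‖) hn)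
      have := norm_sub_norm_le z (-(1 + Complex.I * (s/2 : ℝ)))
      rw [norm_neg, sub_neg_eq_add, ← add_assoc] at this
      exact this
    have hinv : Tendsto q rhpInf (𝓝 0) := tendsto_inv₀_cobounded.comp hcb
    have h := (hinv.const_mul (1 + Complex.I * (s/2 : ℝ))).const_sub 1
    rw [mul_zero, sub_zero] at h
    refine h.congr' (hre.mono fun z hz => ?_)
    have := hqne z hz
    simp only [hq]
    field_simp
    ring
  have hHl : Tendsto (fun z => z * H z) rhpInf (𝓝 0) := by
    have h1 := Fc_tendsto hbc hs.le
    have h2 := Fc_tendsto (k := k) (b := c) (c := b) (by omega) hs.le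
    rw [ellc_symm] at h2
    have h := (h1.add h2).sub (hzq.const_mul (2 * ℓ))
    have e : ellc k b c s + ellc k b c s - 2 * ℓ * 1 = 0 := by rw [hℓ]; ring
    rw [e] at h
    refine h.congr fun z => ?_
    simp only [hH, hF]; ring
  have hlim := contour_left_tendsto hs hHc hHd hHl
  have hcF : Continuous (fun τ : ℝ => F (Complex.I * τ)) := by
    rw [continuous_iff_continuousAt]
    intro τ
    exact ContinuousAt.comp (f := fun τ : ℝ => Complex.I * (τ:ℂ)) (hFc _ (by simp)) (by fun_prop)
  have hcq : Continuous (fun τ : ℝ => q (Complex.I * τ)) := by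
    rw [continuous_iff_continuousAt]
    intro τ
    exact ContinuousAt.comp (f := fun τ : ℝ => Complex.I * (τ:ℂ)) (hqd _ (by simp)).continuousAt (by fun_prop)
  have hval : ∀ R : ℝ, 0 < R → ∫ τ in (-s-R)..R, H (Complex.I * τ) =
      (∫ u in (0:ℝ)..s, F (-(Complex.I * u))) - 2 * ℓ * (2 * Real.arctan (R + s/2)) := by
    intro R hR
    have i : ∀ a b : ℝ, IntervalIntegrable (fun τ : ℝ => F (Complex.I * τ)) volume a b :=
      fun a b => hcF.intervalIntegrable _ _
    simp only [hH]
    rw [intervalIntegral.integral_sub (i _ _) ((hcq.const_mul _).intervalIntegrable _ _),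
      intervalIntegral.integral_const_mul]
    congr 1
    · rw [← intervalIntegral.integral_add_adjacent_intervals (i (-s-R) (-s)) (i (-s) R),
        ← intervalIntegral.integral_add_adjacent_intervals (i (-s) 0) (i 0 R)]
      have e1 : ∫ τ in (-s-R)..(-s), F (Complex.I * τ) = - ∫ τ in (0:ℝ)..R, F (Complex.I * τ) := by
        have := intervalIntegral.integral_comp_sub_left (a := 0) (b := R)
          (fun τ : ℝ => F (Complex.I * τ)) (-s)
        rw [sub_zero] at this
        rw [← this, ← intervalIntegral.integral_neg]
        apply intervalIntegral.integral_congr_ae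
        refine Eventually.of_forall fun τ hτ => ?_
        rw [Set.uIoc_of_le hR.le] at hτ
        have e : Complex.I * ((-s - τ : ℝ) : ℂ) = -(Complex.I * (s + τ : ℝ)) := by push_cast; ring
        simp only [hF]
        rw [e, Fc_reflect k b c s hs.le hτ.1, Fc_reflect k c b s hs.le hτ.1]
        ring
      have e2 : ∫ τ in (-s)..0, F (Complex.I * τ) = ∫ u in (0:ℝ)..s, F (-(Complex.I * u)) := by
        have := intervalIntegral.integral_comp_neg (a := 0) (b := s) (fun τ : ℝ => F (Complex.I * τ))
        rw [neg_zero] at this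
        rw [← this]
        congr 1; ext u; push_cast; ring_nf
      rw [e1, e2]; ring
    · congr 1
      rw [← int_one_div]
      have := intervalIntegral.integral_comp_add_right (a := -s-R) (b := R)
          (fun σ : ℝ => (1 + Complex.I * (σ:ℂ))⁻¹) (s/2)
      rw [show -s - R + s/2 = -(R + s/2) by ring] at this
      rw [← this]
      congr 1; ext τ
      simp only [hq]
      push_cast; ring_nf
  have hat : Tendsto (fun R : ℝ => Real.arctan (R + s/2)) atTop (𝓝 (Real.pi / 2)) :=
    (Real.tendsto_arctan_atTop.mono_right nhdsWithin_le_nhds).comp (tendsto_atTop_add_const_right _ _ tendsto_id)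
  have hat2 : Tendsto (fun R : ℝ => (Real.arctan (R + s/2) : ℂ)) atTop (𝓝 ((Real.pi / 2 : ℝ) : ℂ)) :=
    (Complex.continuous_ofReal.tendsto _).comp hat
  have hlim2 : Tendsto (fun R : ℝ => ∫ τ in (-s-R)..R, H (Complex.I * τ)) atTop
      (𝓝 ((∫ u in (0:ℝ)..s, F (-(Complex.I * u))) - 2 * ℓ * (2 * ((Real.pi / 2 : ℝ) : ℂ)))) := by
    refine Tendsto.congr' ?_ (((hat2.const_mul 2).const_mul (2 * ℓ)).const_sub _)
    filter_upwards [eventually_gt_atTop 0] with R hR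
    exact (hval R hR).symm
  have := tendsto_nhds_unique hlim2 hlim
  push_cast at this
  linear_combination this

end PartB2


section PartC1
open MeasureTheory Topology

lemma Gc_bound {N b n : ℕ} (hn : n ≤ N) {z : ℂ} (hz : 0 ≤ z.re) (hz1 : 1 ≤ ‖z‖) :
    ‖Gc N b n z‖ ≤ ‖z‖ ^ (2 * b + 1) * 4 ^ n * Real.exp (((N:ℝ) - 2 * n) * z.re) := by
  have hz0 : z ≠ 0 := by rintro rfl; simp at hz1; linarith
  have h1 := Ic_norm_le z
  rw [abs_of_nonneg hz] at h1
  have h2 : ‖Kc z‖ ≤ 4 * Real.exp (-z.re) := by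
    refine (closure_bound hz hz0).trans ?_
    have : 1 / ‖z‖ ≤ 1 := by rw [div_le_one (by linarith)]; exact hz1
    gcongr
    linarith
  rw [Gc, norm_mul, norm_mul, norm_pow, norm_pow, norm_pow]
  calc _ ≤ ‖z‖ ^ (2 * b + 1) * Real.exp z.re ^ (N - n) * (4 * Real.exp (-z.re)) ^ n := by gcongr
    _ = _ := by
      rw [mul_pow, ← Real.exp_nat_mul, ← Real.exp_nat_mul, Nat.cast_sub hn]
      have : ((N:ℝ) - 2 * n) * z.re = (N - n) * z.re + n * (-z.re) := by ring
      rw [this, Real.exp_add]; ring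

lemma Gc_axis_continuous (N b n : ℕ) (c : ℂ) (hc : c.re = 0) :
    Continuous (fun u : ℝ => Gc N b n (c * u)) := by
  rw [continuous_iff_continuousAt]
  intro u
  have h1 : ContinuousAt (Gc N b n) (c * u) := Gc_continuousAt N b n (by simp [hc])
  exact ContinuousAt.comp (f := fun u : ℝ => c * u) h1 (by fun_prop)

lemma poly_exp_isBigO {ε : ℝ} (hε : 0 < ε) (m : ℕ) (C : ℝ) :
    (fun u : ℝ => Real.exp (-(ε * u)) * (u ^ m * C)) =O[atTop] fun u => Real.exp (-(ε/2) * u) := by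
  have h := (isLittleO_pow_exp_pos_mul_atTop m (half_pos hε)).isBigO
  have h2 := (h.mul (Asymptotics.isBigO_refl (fun u : ℝ => Real.exp (-(ε * u))) atTop)).const_mul_left C
  refine (h2.congr_left fun u => ?_).congr_right fun u => ?_
  · ring
  · rw [← Real.exp_add]; congr 1; ring

lemma integrable_of_isBigO_exp_negC {f : ℝ → ℂ} {a b : ℝ} (h0 : 0 < b) (h1 : ContinuousOn f (Set.Ici a))
    (h2 : f =O[atTop] fun x => Real.exp (-b * x)) : IntegrableOn f (Set.Ioi a) := by
  have h := integrable_of_isBigO_exp_neg (f := fun x => ‖f x‖) h0 h1.norm h2.norm_left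
  refine (integrable_norm_iff ?_).1 h
  exact (h1.mono Set.Ioi_subset_Ici_self).aestronglyMeasurable measurableSet_Ioi

lemma Gc_axis_integrable {N b n : ℕ} (hn : n ≤ N) {ε : ℝ} (hε : 0 < ε) (c : ℂ) (hc : c.re = 0)
    (hc1 : ‖c‖ = 1) :
    IntegrableOn (fun u : ℝ => (Real.exp (-(ε * u)) : ℂ) * Gc N b n (c * u)) (Set.Ioi 0) := by
  refine integrable_of_isBigO_exp_negC (b := ε / 2) (half_pos hε) ?_ ?_
  · have := Gc_axis_continuous N b n c hc
    fun_prop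
  · refine Asymptotics.IsBigO.trans ?_ (poly_exp_isBigO hε (2*b+1) (4^n))
    refine Asymptotics.IsBigO.of_bound 1 ?_
    filter_upwards [eventually_ge_atTop 1] with u hu
    have hnu : ‖c * (u:ℂ)‖ = u := by
      rw [norm_mul, hc1, one_mul, Complex.norm_real, Real.norm_of_nonneg (by linarith)]
    have h := Gc_bound (b := b) hn (z := c * u) (by simp [hc]) (by rw [hnu]; exact hu)
    rw [hnu] at h
    simp [hc] at h
    rw [norm_mul, Complex.norm_real, Real.norm_of_nonneg (Real.exp_pos _).le, one_mul,
      Real.norm_of_nonneg (by positivity)]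
    gcongr

lemma Gc_real {N b n : ℕ} {t : ℝ} (ht : 0 < t) :
    Gc N b n t = ((besselI0 t ^ (N - n) * besselK0 t ^ n * t ^ (2 * b + 1) : ℝ) : ℂ) := by
  rw [Gc, Ic_ofReal, Kc_ofReal ht]; push_cast; ring

lemma Gc_real_integrable {N b n : ℕ} (hn : n ≤ N) (hn2 : N < 2 * n) :
    IntegrableOn (fun t : ℝ => Gc N b n t) (Set.Ioi 0) := by
  refine integrable_of_isBigO_exp_negC (b := 1 / 2) (by norm_num) ?_ ?_
  · intro t ht
    have h1 : ContinuousAt (Gc N b n) t := Gc_continuousAt N b n (by simpa using ht)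
    exact (ContinuousAt.comp (f := fun u : ℝ => (u:ℂ)) h1 (by fun_prop)).continuousWithinAt
  · refine Asymptotics.IsBigO.trans ?_ (poly_exp_isBigO one_pos (2*b+1) (4^n))
    refine Asymptotics.IsBigO.of_bound 1 ?_
    filter_upwards [eventually_ge_atTop 1] with u hu
    have hnu : ‖(u:ℂ)‖ = u := by
      rw [Complex.norm_real, Real.norm_of_nonneg (by linarith)]
    have h := Gc_bound (b := b) hn (z := u) (by simp; linarith) (by rw [hnu]; exact hu)
    rw [hnu, Complex.ofReal_re] at h
    rw [one_mul, Real.norm_of_nonneg (by positivity), mul_comm]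
    refine h.trans ?_
    gcongr
    have : (N:ℝ) + 1 ≤ 2 * n := by exact_mod_cast hn2
    nlinarith

lemma IKM_eq {N b n : ℕ} :
    ∫ t in Set.Ioi (0:ℝ), Gc N b n t = (IKM (N - n) n (2 * b + 1) : ℂ) := by
  rw [IKM, ← integral_complex_ofReal]
  refine setIntegral_congr_fun measurableSet_Ioi fun t ht => ?_
  exact Gc_real ht

lemma rotationGc {N b n : ℕ} (hn : n ≤ N) (hn2 : N < 2 * n) {ε : ℝ} (hε : 0 < ε) :
    ∫ u in Set.Ioi (0:ℝ), (Real.exp (-(ε * u)) : ℂ) * Gc N b n (-Complex.I * u) =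
      Complex.I * ∫ t in Set.Ioi (0:ℝ), Complex.exp (-(Complex.I * ε * t)) * Gc N b n t := by
  set f : ℂ → ℂ := fun z => Complex.exp (-(Complex.I * ε * z)) * Gc N b n z with hf
  have hfd : ∀ z ∈ Complex.slitPlane, DifferentiableAt ℂ f z := by
    intro z hz
    have := Gc_differentiableAt N b n hz
    rw [hf]; fun_prop
  have hfc : ∀ z : ℂ, 0 ≤ z.re → ContinuousAt f z := by
    intro z hz
    have := Gc_continuousAt N b n hz
    rw [hf]; fun_prop
  set μ := min ε 1 with hμ
  have hμ0 : 0 < μ := lt_min hε one_pos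
  have hbd : ∀ R : ℝ, 1 ≤ R → ∀ z : ℂ, 0 ≤ z.re → z.im ≤ 0 → z.re ≤ R → -R ≤ z.im →
      (z.re = R ∨ z.im = -R) → ‖f z‖ ≤ Real.exp (-(μ * R)) * ((2 * R) ^ (2*b+1) * 4 ^ n) := by
    intro R hR z h1 h2 h3 h4 h5
    have hz1 : 1 ≤ ‖z‖ := by
      rcases h5 with h | h
      · refine le_trans ?_ (Complex.abs_re_le_norm z); rw [h, abs_of_pos (by linarith)]; exact hR
      · refine le_trans ?_ (Complex.abs_im_le_norm z); rw [h, abs_neg, abs_of_pos (by linarith)]; exact hR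
    have hz2 : ‖z‖ ≤ 2 * R := by
      refine (Complex.norm_le_abs_re_add_abs_im z).trans ?_
      rw [abs_of_nonneg h1, abs_of_nonpos h2]; linarith
    rw [hf]
    simp only
    rw [norm_mul, Complex.norm_exp]
    have hre : (-(Complex.I * ε * z)).re = ε * z.im := by simp
    rw [hre]
    have hg := Gc_bound (b := b) hn h1 hz1
    have hN : (N:ℝ) + 1 ≤ 2 * n := by exact_mod_cast hn2
    have hexp : ε * z.im + ((N:ℝ) - 2 * n) * z.re ≤ -(μ * R) := by
      have e1 : μ ≤ ε := min_le_left _ _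
      have e2 : μ ≤ 1 := min_le_right _ _
      have e3 : ((N:ℝ) - 2 * n) * z.re ≤ - (μ * z.re) := by nlinarith
      have e4 : ε * z.im ≤ μ * z.im := by nlinarith
      rcases h5 with h | h
      · rw [h] at e3 ⊢; nlinarith
      · rw [h] at e4 ⊢; nlinarith
    calc _ ≤ Real.exp (ε * z.im) * (‖z‖ ^ (2 * b + 1) * 4 ^ n * Real.exp (((N:ℝ) - 2 * n) * z.re)) := by
          gcongr
      _ = Real.exp (ε * z.im + ((N:ℝ) - 2 * n) * z.re) * (‖z‖ ^ (2 * b + 1) * 4 ^ n) := by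
          rw [Real.exp_add]; ring
      _ ≤ _ := by gcongr
  have hrect : ∀ R : ℝ, 1 ≤ R → ‖Complex.I * (∫ u in (0:ℝ)..R, f (-Complex.I * u)) + ∫ t in (0:ℝ)..R, f t‖ ≤
      2 * R * (Real.exp (-(μ * R)) * ((2 * R) ^ (2*b+1) * 4 ^ n)) := by
    intro R hR
    have h := Complex.integral_boundary_rect_eq_zero_of_continuousOn_of_differentiableOn f
      ⟨0, -R⟩ ⟨R, 0⟩ ?_ ?_
    · simp only [smul_eq_mul] at h
      have e1 : ∫ y in (-R)..0, f (((0:ℝ):ℂ) + y * Complex.I) = ∫ u in (0:ℝ)..R, f (-Complex.I * u) := by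
        have := intervalIntegral.integral_comp_neg (a := -R) (b := 0) (fun u : ℝ => f (-Complex.I * u))
        rw [neg_neg, neg_zero] at this
        rw [← this]
        congr 1; ext y; congr 1; push_cast; ring
      have e2 : ∫ x in (0:ℝ)..R, f (x + ((0:ℝ):ℂ) * Complex.I) = ∫ t in (0:ℝ)..R, f t := by
        simp
      rw [e1, e2] at h
      set A := ∫ x in (0:ℝ)..R, f (x + ((-R:ℝ):ℂ) * Complex.I)
      set B := ∫ y in (-R)..0, f ((R:ℂ) + y * Complex.I)
      have hA : ‖A‖ ≤ Real.exp (-(μ * R)) * ((2 * R) ^ (2*b+1) * 4 ^ n) * |R - 0| := by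
        refine intervalIntegral.norm_integral_le_of_norm_le_const fun x hx => ?_
        rw [Set.uIoc_of_le (by linarith)] at hx
        apply hbd R hR <;> simp [hx.1.le, hx.2] <;> linarith
      have hB : ‖B‖ ≤ Real.exp (-(μ * R)) * ((2 * R) ^ (2*b+1) * 4 ^ n) * |0 - (-R)| := by
        refine intervalIntegral.norm_integral_le_of_norm_le_const fun x hx => ?_
        rw [Set.uIoc_of_le (by linarith)] at hx
        apply hbd R hR <;> simp [hx.1.le, hx.2] <;> linarith
      rw [sub_zero, abs_of_pos (by linarith)] at hA
      rw [zero_sub, neg_neg, abs_of_pos (by linarith)] at hB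
      have e : Complex.I * (∫ u in (0:ℝ)..R, f (-Complex.I * u)) + ∫ t in (0:ℝ)..R, f t =
          A + Complex.I * B := by linear_combination -h
      rw [e]
      refine (norm_add_le _ _).trans ?_
      rw [norm_mul, Complex.norm_I, one_mul]
      linarith
    · intro z hz
      rw [Complex.mem_reProdIm] at hz
      have : 0 ≤ z.re := by
        have := hz.1
        rw [Set.uIcc_of_le (by simp; linarith)] at this
        exact this.1
      exact (hfc z this).continuousWithinAt
    · intro z hz
      rw [Complex.mem_reProdIm] at hz
      have : 0 < z.re := by
        have := hz.1.1
        rw [min_eq_left (by simp; linarith)] at this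
        exact this
      exact (hfd z (Or.inl this)).differentiableWithinAt
  have i1 : IntegrableOn (fun u : ℝ => f (-Complex.I * u)) (Set.Ioi 0) := by
    refine (Gc_axis_integrable (b := b) hn hε (-Complex.I) (by simp) (by simp)).congr_fun (fun u _ => ?_) measurableSet_Ioi
    simp only [hf]
    congr 1
    rw [Complex.ofReal_exp]; congr 1; push_cast
    linear_combination -(ε:ℂ) * u * Complex.I_sq
  have i2 : IntegrableOn (fun t : ℝ => f t) (Set.Ioi 0) := by
    have := Gc_real_integrable (b := b) hn hn2
    refine Integrable.mono this ?_ ?_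
    · refine AEStronglyMeasurable.mul (Continuous.aestronglyMeasurable (by fun_prop)) this.1
    · refine Eventually.of_forall fun t => ?_
      simp only [hf]
      rw [norm_mul, Complex.norm_exp]
      simp
  have t1 := intervalIntegral_tendsto_integral_Ioi 0 i1 tendsto_id
  have t2 := intervalIntegral_tendsto_integral_Ioi 0 i2 tendsto_id
  have t3 := ((t1.const_mul Complex.I).add t2).norm
  have t4 : Tendsto (fun R : ℝ => 2 * R * (Real.exp (-(μ * R)) * ((2 * R) ^ (2*b+1) * 4 ^ n))) atTop (𝓝 0) := by
    have := (poly_exp_isBigO hμ0 (2*b+2) (4^n * 2^(2*b+2))).trans_tendsto (g'' := fun u => Real.exp (-(μ/2) * u)) ?_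
    · refine this.congr fun R => ?_
      rw [mul_pow]; ring
    · have : Tendsto (fun u : ℝ => -(μ/2) * u) atTop atBot :=
        tendsto_id.const_mul_atTop_of_neg (by linarith)
      exact Real.tendsto_exp_atBot.comp this
  have t5 := le_of_tendsto_of_tendsto t3 t4 (by
    filter_upwards [eventually_ge_atTop 1] with R hR using hrect R hR)
  have t6 := norm_le_zero_iff.1 t5
  have i3 : ∫ u in Set.Ioi (0:ℝ), (Real.exp (-(ε * u)) : ℂ) * Gc N b n (-Complex.I * u) =
      ∫ u in Set.Ioi (0:ℝ), f (-Complex.I * u) := by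
    refine setIntegral_congr_fun measurableSet_Ioi fun u _ => ?_
    simp only [hf]
    congr 1
    rw [Complex.ofReal_exp]; congr 1; push_cast
    linear_combination -(ε:ℂ) * u * Complex.I_sq
  rw [i3]
  linear_combination -Complex.I * t6 + (∫ u in Set.Ioi (0:ℝ), f (-Complex.I * u)) * Complex.I_sq

lemma rotation_tendsto {N b n : ℕ} (hn : n ≤ N) (hn2 : N < 2 * n) :
    Tendsto (fun ε : ℝ => ∫ u in Set.Ioi (0:ℝ), (Real.exp (-(ε * u)) : ℂ) * Gc N b n (-Complex.I * u))
      (𝓝[>] 0) (𝓝 (Complex.I * (IKM (N - n) n (2 * b + 1) : ℂ))) := by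
  have h : Tendsto (fun ε : ℝ => ∫ t in Set.Ioi (0:ℝ), Complex.exp (-(Complex.I * ε * t)) * Gc N b n t)
      (𝓝[>] 0) (𝓝 (∫ t in Set.Ioi (0:ℝ), Gc N b n t)) := by
    have hi := Gc_real_integrable (b := b) hn hn2
    refine tendsto_integral_filter_of_dominated_convergence (fun t => ‖Gc N b n t‖) ?_ ?_ hi.norm ?_
    · refine Eventually.of_forall fun ε => ?_
      exact AEStronglyMeasurable.mul (Continuous.aestronglyMeasurable (by fun_prop)) hi.1
    · refine Eventually.of_forall fun ε => Eventually.of_forall fun t => ?_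
      rw [norm_mul, Complex.norm_exp]
      simp
    · refine Eventually.of_forall fun t => ?_
      have : Continuous (fun ε : ℝ => Complex.exp (-(Complex.I * ε * t)) * Gc N b n t) := by fun_prop
      have h := this.tendsto 0
      simp only [Complex.ofReal_zero, mul_zero, zero_mul, neg_zero, Complex.exp_zero, one_mul] at h
      exact h.mono_left nhdsWithin_le_nhds
  rw [IKM_eq] at h
  refine (h.const_mul Complex.I).congr' ?_
  filter_upwards [self_mem_nhdsWithin] with ε hε
  exact (rotationGc hn hn2 hε).symm

end PartC1


section PartC2
open MeasureTheory Topology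

noncomputable def Xe (N b n : ℕ) (ε : ℝ) : ℂ :=
  ∫ u in Set.Ioi (0:ℝ), (Real.exp (-(ε * u)) : ℂ) * Gc N b n (-Complex.I * u)

lemma Xe_conj (N b n : ℕ) (ε : ℝ) : starRingEnd ℂ (Xe N b n ε) =
    ∫ u in Set.Ioi (0:ℝ), (Real.exp (-(ε * u)) : ℂ) * Gc N b n (Complex.I * u) := by
  rw [Xe, ← integral_conj]
  refine setIntegral_congr_fun measurableSet_Ioi fun u _ => ?_
  rw [map_mul, Complex.conj_ofReal, ← Gc_conj _ _ _ (by simp)]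
  simp

lemma conv_piece {N b c n m : ℕ} (hn : n ≤ N) (hm : m ≤ N) {ε : ℝ} (hε : 0 < ε) :
    IntegrableOn (fun s : ℝ => (Real.exp (-(ε * s)) : ℂ) *
      ∫ u in (0:ℝ)..s, Gc N b n (-Complex.I * u) * Gc N c m (-(Complex.I * u) + Complex.I * s)) (Set.Ioi 0) ∧
    ∫ s in Set.Ioi (0:ℝ), (Real.exp (-(ε * s)) : ℂ) *
      ∫ u in (0:ℝ)..s, Gc N b n (-Complex.I * u) * Gc N c m (-(Complex.I * u) + Complex.I * s) =
    Xe N b n ε * starRingEnd ℂ (Xe N c m ε) := by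
  have hf := Gc_axis_integrable (b := b) hn hε (-Complex.I) (by simp) (by simp)
  have hg := Gc_axis_integrable (b := c) hm hε (Complex.I) (by simp) (by simp)
  have h1 := integrable_posConvolution hf hg (ContinuousLinearMap.mul ℝ ℂ)
  have h2 := integral_posConvolution hf hg (ContinuousLinearMap.mul ℝ ℂ)
  have key : ∀ s : ℝ, ∫ t in (0:ℝ)..s, (ContinuousLinearMap.mul ℝ ℂ) ((Real.exp (-(ε * t)) : ℂ) * Gc N b n (-Complex.I * t))
      ((Real.exp (-(ε * (s - t))) : ℂ) * Gc N c m (Complex.I * ((s - t : ℝ):ℂ))) =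
      (Real.exp (-(ε * s)) : ℂ) *
      ∫ u in (0:ℝ)..s, Gc N b n (-Complex.I * u) * Gc N c m (-(Complex.I * u) + Complex.I * s) := by
    intro s
    rw [← intervalIntegral.integral_const_mul]
    congr 1
    ext t
    rw [ContinuousLinearMap.mul_apply']
    have e1 : Real.exp (-(ε * s)) = Real.exp (-(ε * t)) * Real.exp (-(ε * (s-t))) := by
      rw [← Real.exp_add]; congr 1; ring
    have e2 : Complex.I * ((s - t : ℝ):ℂ) = -(Complex.I * t) + Complex.I * s := by push_cast; ring
    rw [e1, e2]; push_cast; ring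
  constructor
  · rw [posConvolution, integrable_indicator_iff measurableSet_Ioi] at h1
    refine h1.congr_fun (fun s _ => ?_) measurableSet_Ioi
    exact key s
  · rw [Xe_conj, Xe]
    rw [ContinuousLinearMap.mul_apply'] at h2
    rw [← h2]
    refine setIntegral_congr_fun measurableSet_Ioi fun s _ => ?_
    exact (key s).symm

lemma half_kernel (k b c : ℕ) {ε : ℝ} (hε : 0 < ε) :
    IntegrableOn (fun s : ℝ => (Real.exp (-(ε * s)) : ℂ) * ∫ u in (0:ℝ)..s, Fc k b c s (-(Complex.I * u))) (Set.Ioi 0) ∧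
    ∫ s in Set.Ioi (0:ℝ), (Real.exp (-(ε * s)) : ℂ) * ∫ u in (0:ℝ)..s, Fc k b c s (-(Complex.I * u)) =
    ∑ n ∈ Finset.range (2 * k + 1 + 1), (-1) ^ n * ((2 * k + 1).choose n : ℂ) *
      (Xe (2*k+1) b n ε * starRingEnd ℂ (Xe (2*k+1) c (2*k+1-n) ε)) := by
  have hp : ∀ n ∈ Finset.range (2 * k + 1 + 1), IntegrableOn (fun s : ℝ => (-1) ^ n * ((2 * k + 1).choose n : ℂ) * ((Real.exp (-(ε * s)) : ℂ) *
      ∫ u in (0:ℝ)..s, Gc (2*k+1) b n (-Complex.I * u) * Gc (2*k+1) c (2*k+1-n) (-(Complex.I * u) + Complex.I * s))) (Set.Ioi 0) := by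
    intro n hn
    exact (conv_piece (N := 2*k+1) (b := b) (c := c) (n := n) (m := 2*k+1-n)
      (Nat.lt_succ_iff.1 (Finset.mem_range.1 hn)) (Nat.sub_le _ _) hε).1.const_mul _
  have key : ∀ s : ℝ, (Real.exp (-(ε * s)) : ℂ) * ∫ u in (0:ℝ)..s, Fc k b c s (-(Complex.I * u)) =
      ∑ n ∈ Finset.range (2 * k + 1 + 1), (-1) ^ n * ((2 * k + 1).choose n : ℂ) * ((Real.exp (-(ε * s)) : ℂ) *
      ∫ u in (0:ℝ)..s, Gc (2*k+1) b n (-Complex.I * u) * Gc (2*k+1) c (2*k+1-n) (-(Complex.I * u) + Complex.I * s)) := by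
    intro s
    simp_rw [Fc_expand]
    rw [intervalIntegral.integral_finsetSum, Finset.mul_sum]
    · refine Finset.sum_congr rfl fun n _ => ?_
      rw [intervalIntegral.integral_const_mul]
      simp only [neg_mul]
      ring
    · intro n _
      apply Continuous.intervalIntegrable
      have c1 := Gc_axis_continuous (2*k+1) b n (-Complex.I) (by simp)
      have c2 := (Gc_axis_continuous (2*k+1) c (2*k+1-n) (Complex.I) (by simp)).comp
        (continuous_const.sub continuous_id : Continuous fun u : ℝ => s - u)
      have := (c1.mul c2).const_mul ((-1) ^ n * ((2 * k + 1).choose n : ℂ))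
      refine this.congr fun u => ?_
      have e1 : -Complex.I * (u:ℂ) = -(Complex.I * u) := by ring
      have e2 : Complex.I * ((s - u : ℝ) : ℂ) = -(Complex.I * u) + Complex.I * s := by push_cast; ring
      rw [← e2, ← e1]
      rfl
  constructor
  · refine IntegrableOn.congr_fun (integrable_finsetSum _ hp) (fun s _ => ?_) measurableSet_Ioi
    exact (key s).symm
  · simp_rw [key]
    rw [integral_finsetSum _ hp]
    refine Finset.sum_congr rfl fun n hn => ?_
    rw [integral_const_mul, (conv_piece (N := 2*k+1) (b := b) (c := c) (n := n) (m := 2*k+1-n)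
      (Nat.lt_succ_iff.1 (Finset.mem_range.1 hn)) (Nat.sub_le _ _) hε).2]

lemma Fc_axis_ii (k b c : ℕ) (s : ℝ) :
    IntervalIntegrable (fun u : ℝ => Fc k b c s (-(Complex.I * u))) volume 0 s := by
  apply Continuous.intervalIntegrable
  rw [continuous_iff_continuousAt]
  intro u
  have h1 : ContinuousAt (Fc k b c s) (-(Complex.I * u)) := Fc_continuousAt k b c s (by simp)
  exact ContinuousAt.comp (f := fun u : ℝ => -(Complex.I * u)) h1 (by fun_prop)

lemma laplace_kernel {k b c : ℕ} (hbc : b + c + 1 ≤ k) {ε : ℝ} (hε : 0 < ε) :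
    ∑ n ∈ Finset.range (2 * k + 1 + 1), (-1) ^ n * ((2 * k + 1).choose n : ℂ) *
      (Xe (2*k+1) b n ε * starRingEnd ℂ (Xe (2*k+1) c (2*k+1-n) ε) +
       Xe (2*k+1) c n ε * starRingEnd ℂ (Xe (2*k+1) b (2*k+1-n) ε)) =
    ∫ s in Set.Ioi (0:ℝ), (Real.exp (-(ε * s)) : ℂ) * (2 * Real.pi * ellc k b c s) := by
  simp_rw [mul_add]
  rw [Finset.sum_add_distrib, ← (half_kernel k b c hε).2, ← (half_kernel k c b hε).2,
    ← integral_add (half_kernel k b c hε).1 (half_kernel k c b hε).1]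
  refine setIntegral_congr_fun measurableSet_Ioi fun s hs => ?_
  rw [← contour_identity hbc hs, intervalIntegral.integral_add (Fc_axis_ii k b c s) (Fc_axis_ii k c b s)]
  simp only [mul_add]

lemma sin_laplace (m : ℕ) (hm : Odd m) {ε : ℝ} (hε : 0 < ε) :
    (∫ s in Set.Ioi (0:ℝ), Real.exp (-(ε * s)) * Real.sin s ^ m) * (1 + Real.exp (-(ε * Real.pi))) =
      ∫ s in (0:ℝ)..Real.pi, Real.exp (-(ε * s)) * Real.sin s ^ m := by
  have hi : IntegrableOn (fun s : ℝ => Real.exp (-(ε * s)) * Real.sin s ^ m) (Set.Ioi 0) := by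
    have h := exp_neg_integrableOn_Ioi 0 hε
    refine Integrable.mono h (Continuous.aestronglyMeasurable (by fun_prop)) ?_
    refine Eventually.of_forall fun s => ?_
    rw [norm_mul, norm_pow]
    have : ‖Real.sin s‖ ^ m ≤ 1 := pow_le_one₀ (norm_nonneg _) (Real.abs_sin_le_one s)
    calc _ ≤ ‖Real.exp (-(ε * s))‖ * 1 := by gcongr
      _ = _ := by rw [mul_one, neg_mul]
  have h1 : ∫ s in Set.Ioi (Real.pi), Real.exp (-(ε * s)) * Real.sin s ^ m =
      -(Real.exp (-(ε * Real.pi)) * ∫ s in Set.Ioi (0:ℝ), Real.exp (-(ε * s)) * Real.sin s ^ m) := by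
    have := (measurePreserving_add_right volume Real.pi).setIntegral_preimage_emb
      (measurableEmbedding_addRight Real.pi) (fun s : ℝ => Real.exp (-(ε * s)) * Real.sin s ^ m) (Set.Ioi Real.pi)
    rw [Set.preimage_add_const_Ioi, sub_self] at this
    rw [← this, ← integral_const_mul, ← integral_neg]
    congr 1
    ext s
    rw [Real.sin_add_pi, hm.neg_pow, mul_add, neg_add, Real.exp_add]; ring
  have h2 := intervalIntegral.integral_interval_add_Ioi (a := 0) (b := Real.pi) (f := fun s : ℝ => Real.exp (-(ε * s)) * Real.sin s ^ m) hi
    (hi.mono_set (Set.Ioi_subset_Ioi Real.pi_pos.le))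
  rw [h1] at h2
  linarith

lemma sin_laplace_tendsto (m : ℕ) (hm : Odd m) :
    Tendsto (fun ε : ℝ => ∫ s in Set.Ioi (0:ℝ), Real.exp (-(ε * s)) * Real.sin s ^ m) (𝓝[>] 0)
      (𝓝 ((∫ s in (0:ℝ)..Real.pi, Real.sin s ^ m) / 2)) := by
  have h1 : Continuous (fun ε : ℝ => ∫ s in (0:ℝ)..Real.pi, Real.exp (-(ε * s)) * Real.sin s ^ m) :=
    intervalIntegral.continuous_parametric_intervalIntegral_of_continuous' (by fun_prop) _ _
  have h2 : Continuous (fun ε : ℝ => 1 + Real.exp (-(ε * Real.pi))) := by fun_prop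
  have h3 : Continuous (fun ε : ℝ => (∫ s in (0:ℝ)..Real.pi, Real.exp (-(ε * s)) * Real.sin s ^ m) /
      (1 + Real.exp (-(ε * Real.pi)))) := h1.div h2 (fun ε => by positivity)
  have h4 := h3.tendsto 0
  simp only [zero_mul, neg_zero, Real.exp_zero, one_mul, one_add_one_eq_two] at h4
  refine (h4.mono_left nhdsWithin_le_nhds).congr' ?_
  filter_upwards [self_mem_nhdsWithin] with ε hε
  rw [← sin_laplace m hm hε, mul_div_cancel_right₀ _ (by positivity)]

noncomputable def kerRHS (k b c : ℕ) : ℂ :=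
  if b + c + 1 = k then 2 * Real.pi * (-1)^k * (-Complex.I) * (∏ i ∈ Finset.range k, ((2 * i + 2 : ℝ) / (2 * i + 3)) : ℝ) else 0

lemma kernel_limit (k b c : ℕ) :
    Tendsto (fun ε : ℝ => ∫ s in Set.Ioi (0:ℝ), (Real.exp (-(ε * s)) : ℂ) * (2 * Real.pi * ellc k b c s)) (𝓝[>] 0)
      (𝓝 (kerRHS k b c)) := by
  unfold ellc kerRHS
  split_ifs with h
  · have h1 := sin_laplace_tendsto (2*k+1) ⟨k, rfl⟩
    rw [integral_sin_pow_odd, mul_div_cancel_left₀ _ (by norm_num)] at h1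
    have h2 := ((Complex.continuous_ofReal.tendsto _).comp h1).const_mul (2 * Real.pi * (-1)^k * (-Complex.I))
    refine h2.congr fun ε => ?_
    simp only [Function.comp]
    rw [← integral_complex_ofReal, ← integral_const_mul]
    congr 1
    ext s
    have : (-(Complex.I * (Real.sin s : ℂ))) ^ (2*k+1) = (-1)^k * (-Complex.I) * (Real.sin s : ℂ)^(2*k+1) := by
      rw [neg_mul_eq_neg_mul, mul_pow, pow_succ (-Complex.I), pow_mul, neg_sq, Complex.I_sq]
    rw [this]
    push_cast
    ring
  · simp

end PartC2


section PartC3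
open MeasureTheory Topology

noncomputable def jh (u : ℝ) : ℝ := Real.pi / 2 * (Ic (Complex.I * u)).re
noncomputable def al (u : ℝ) : ℝ := (Kc (-(Complex.I * u))).re
noncomputable def kp (u : ℝ) : ℂ := al u + Complex.I * jh u

lemma Ic_axis (u : ℝ) : Ic (-Complex.I * u) = ((2 / Real.pi * jh u : ℝ) : ℂ) := by
  have h1 : Ic (-Complex.I * u) = Ic (Complex.I * u) := by
    rw [neg_mul, Ic_even]
  have h2 : starRingEnd ℂ (Ic (Complex.I * u)) = Ic (Complex.I * u) := by
    rw [← Ic_conj, ← h1]; congr 1; simp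
  rw [h1, jh]
  have : (2 / Real.pi * (Real.pi / 2 * (Ic (Complex.I * u)).re) : ℝ) = (Ic (Complex.I * u)).re := by
    field_simp
  rw [this]
  exact (Complex.conj_eq_iff_re.1 h2).symm

lemma Kc_axis {u : ℝ} (hu : 0 < u) : Kc (-Complex.I * u) = kp u := by
  have hj := Kc_jump hu
  have hI : Ic (Complex.I * u) = ((2 / Real.pi * jh u : ℝ) : ℂ) := by
    rw [← Ic_axis, neg_mul, Ic_even]
  have hc : Kc (Complex.I * u) = starRingEnd ℂ (Kc (-(Complex.I * u))) := by
    rw [← Kc_conj (mem_slit_of_re_nonneg (by simp) (by simpa using hu.ne'))]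
    congr 1; simp
  rw [neg_mul, kp, al]
  rw [hI, hc] at hj
  have him := congrArg Complex.im hj
  have e : Complex.I * (Real.pi:ℂ) * ((2 / Real.pi * jh u : ℝ) : ℂ) = Complex.I * ((2 * jh u : ℝ):ℂ) := by
    have : (Real.pi:ℂ) ≠ 0 := by exact_mod_cast Real.pi_ne_zero
    push_cast; field_simp
  rw [e] at him
  simp at him
  apply Complex.ext
  · simp
  · simp; linarith

lemma Gc_axis {N b n : ℕ} {u : ℝ} (hu : 0 < u) :
    Gc N b n (-Complex.I * u) = (-1)^b * (-Complex.I) * (2 / Real.pi) ^ (N - n) *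
      ((u:ℂ)^(2*b+1) * ((jh u : ℂ) ^ (N - n) * kp u ^ n)) := by
  rw [Gc, Ic_axis, Kc_axis hu, mul_pow, pow_succ (-Complex.I), pow_mul, neg_sq, Complex.I_sq]
  push_cast
  rw [mul_pow]; ring

def Cv (b : ℕ) (f : ℝ → ℂ) (L : ℂ) : Prop :=
  (∀ ε : ℝ, 0 < ε → IntegrableOn (fun u : ℝ => (Real.exp (-(ε * u)) : ℂ) * ((u:ℂ)^(2*b+1) * f u)) (Set.Ioi 0)) ∧
  Tendsto (fun ε : ℝ => ∫ u in Set.Ioi (0:ℝ), (Real.exp (-(ε * u)) : ℂ) * ((u:ℂ)^(2*b+1) * f u)) (𝓝[>] 0) (𝓝 L)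

lemma Cv.lin {b : ℕ} {f g : ℝ → ℂ} {L M : ℂ} (hf : Cv b f L) (hg : Cv b g M) (x y : ℂ) :
    Cv b (fun u => x * f u + y * g u) (x * L + y * M) := by
  have e : ∀ ε u : ℝ, (Real.exp (-(ε * u)) : ℂ) * ((u:ℂ)^(2*b+1) * (x * f u + y * g u)) =
      x * ((Real.exp (-(ε * u)) : ℂ) * ((u:ℂ)^(2*b+1) * f u)) + y * ((Real.exp (-(ε * u)) : ℂ) * ((u:ℂ)^(2*b+1) * g u)) := by
    intro ε u; ring
  refine ⟨fun ε hε => ?_, ?_⟩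
  · simp_rw [e]
    exact ((hf.1 ε hε).const_mul x).add ((hg.1 ε hε).const_mul y)
  · refine ((hf.2.const_mul x).add (hg.2.const_mul y)).congr' ?_
    filter_upwards [self_mem_nhdsWithin] with ε hε
    simp_rw [e]
    rw [integral_add ((hf.1 ε hε).const_mul x) ((hg.1 ε hε).const_mul y), integral_const_mul, integral_const_mul]

lemma Cv.congr {b : ℕ} {f g : ℝ → ℂ} {L : ℂ} (hf : Cv b f L) (h : ∀ u : ℝ, 0 < u → f u = g u) : Cv b g L := by
  refine ⟨fun ε hε => (hf.1 ε hε).congr_fun (fun u hu => by beta_reduce; rw [h u hu]) measurableSet_Ioi, ?_⟩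
  refine hf.2.congr fun ε => setIntegral_congr_fun measurableSet_Ioi fun u hu => by rw [h u hu]

lemma Cv.conj {b : ℕ} {f : ℝ → ℂ} {L : ℂ} (hf : Cv b f L) : Cv b (fun u => starRingEnd ℂ (f u)) (starRingEnd ℂ L) := by
  have e : ∀ ε u : ℝ, (Real.exp (-(ε * u)) : ℂ) * ((u:ℂ)^(2*b+1) * starRingEnd ℂ (f u)) =
      starRingEnd ℂ ((Real.exp (-(ε * u)) : ℂ) * ((u:ℂ)^(2*b+1) * f u)) := by
    intro ε u
    rw [map_mul, map_mul, map_pow, Complex.conj_ofReal, Complex.conj_ofReal]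
  refine ⟨fun ε hε => ?_, ?_⟩
  · simp_rw [e]
    have h := hf.1 ε hε
    exact (Complex.conjLIE.toContinuousLinearEquiv.toContinuousLinearMap.integrable_comp h)
  · have := (Complex.continuous_conj.tendsto L).comp hf.2
    refine this.congr fun ε => ?_
    simp_rw [e]
    rw [integral_conj]; rfl

lemma Cv.unique {b : ℕ} {f : ℝ → ℂ} {L M : ℂ} (hf : Cv b f L) (hg : Cv b f M) : L = M :=
  tendsto_nhds_unique hf.2 hg.2

lemma Cv.zero (b : ℕ) : Cv b (fun _ => 0) 0 := by
  refine ⟨fun ε _ => by simp, by simp⟩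

lemma Cv.sum {b : ℕ} {ι : Type*} (s : Finset ι) {f : ι → ℝ → ℂ} {L : ι → ℂ} (c : ι → ℂ)
    (h : ∀ i ∈ s, Cv b (f i) (L i)) : Cv b (fun u => ∑ i ∈ s, c i * f i u) (∑ i ∈ s, c i * L i) := by
  classical
  induction s using Finset.induction_on with
  | empty => simpa using Cv.zero b
  | insert a s ha ih =>
    have h1 := (h a (Finset.mem_insert_self a s)).lin (ih fun i hi => h i (Finset.mem_insert_of_mem hi)) (c a) 1
    simp only [one_mul] at h1
    rw [Finset.sum_insert ha]
    refine h1.congr fun u _ => ?_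
    rw [Finset.sum_insert ha]

lemma Cv_base {k b n : ℕ} (hn : n ≤ 2*k+1) (hn2 : k + 1 ≤ n) :
    ∃ L, Cv b (fun u => (jh u : ℂ) ^ (2*k+1-n) * kp u ^ n) L ∧
      (-1)^b * (-Complex.I) * (2 / Real.pi) ^ (2*k+1 - n) * L = Complex.I * (IKM (2*k+1-n) n (2*b+1) : ℂ) := by
  have hpi : (Real.pi:ℂ) ≠ 0 := by exact_mod_cast Real.pi_ne_zero
  set w : ℂ := (-1)^b * (-Complex.I) * (2 / Real.pi) ^ (2*k+1 - n) with hw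
  have hw0 : w ≠ 0 := by
    rw [hw]
    have : (2 / (Real.pi:ℂ)) ≠ 0 := div_ne_zero two_ne_zero hpi
    simp [this]
  refine ⟨w⁻¹ * (Complex.I * (IKM (2*k+1-n) n (2*b+1) : ℂ)), ⟨fun ε hε => ?_, ?_⟩, by field_simp⟩
  · have h := (Gc_axis_integrable (b := b) hn hε (-Complex.I) (by simp) (by simp)).const_mul w⁻¹
    refine IntegrableOn.congr_fun h (fun u hu => ?_) measurableSet_Ioi
    beta_reduce
    rw [Gc_axis hu, ← hw]; field_simp
  · refine ((rotation_tendsto (b := b) hn (by omega)).const_mul w⁻¹).congr fun ε => ?_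
    rw [← integral_const_mul]
    refine setIntegral_congr_fun measurableSet_Ioi fun u hu => ?_
    beta_reduce
    rw [Gc_axis hu, ← hw]; field_simp

lemma kp_conj (u : ℝ) : starRingEnd ℂ (kp u) = kp u - 2 * Complex.I * jh u := by
  simp [kp]; ring

lemma Cv_step1 (k b : ℕ) : ∀ j i l : ℕ, i + j + l = 2*k+1 → k + 1 ≤ i →
    ∃ L, Cv b (fun u => (jh u : ℂ) ^ l * kp u ^ i * starRingEnd ℂ (kp u) ^ j) L := by
  intro j
  induction j with
  | zero =>
    intro i l h hi
    obtain ⟨L, hL, -⟩ := Cv_base (k := k) (b := b) (n := i) (by omega) hi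
    refine ⟨L, hL.congr fun u _ => ?_⟩
    rw [show 2*k+1-i = l by omega]; ring
  | succ j ih =>
    intro i l h hi
    obtain ⟨L, hL⟩ := ih (i+1) l (by omega) (by omega)
    obtain ⟨M, hM⟩ := ih i (l+1) (by omega) hi
    refine ⟨_, (hL.lin hM 1 (-2 * Complex.I)).congr fun u _ => ?_⟩
    rw [pow_succ (starRingEnd ℂ (kp u)) j]
    nth_rw 4 [kp_conj]
    ring

lemma Cv_step2 (k b : ℕ) (j i l : ℕ) (h : i + j + l = 2*k+1) (hj : k + 1 ≤ j) :
    ∃ L, Cv b (fun u => (jh u : ℂ) ^ l * kp u ^ i * starRingEnd ℂ (kp u) ^ j) L := by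
  obtain ⟨L, hL⟩ := Cv_step1 k b i j l (by omega) hj
  refine ⟨_, hL.conj.congr fun u _ => ?_⟩
  simp only [map_mul, map_pow, Complex.conj_ofReal, Complex.conj_conj]
  ring

lemma Cv_step3 (k b : ℕ) : ∀ l i j : ℕ, i + j + l = 2*k+1 →
    ∃ L, Cv b (fun u => (jh u : ℂ) ^ l * kp u ^ i * starRingEnd ℂ (kp u) ^ j) L := by
  intro l
  induction l with
  | zero =>
    intro i j h
    by_cases hi : k + 1 ≤ i
    · exact Cv_step1 k b j i 0 h hi
    · exact Cv_step2 k b j i 0 h (by omega)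
  | succ l ih =>
    intro i j h
    obtain ⟨L, hL⟩ := ih (i+1) j (by omega)
    obtain ⟨M, hM⟩ := ih i (j+1) (by omega)
    refine ⟨_, (hL.lin hM (1/(2*Complex.I)) (-(1/(2 * Complex.I)))).congr fun u _ => ?_⟩
    have : (jh u : ℂ) = (kp u - starRingEnd ℂ (kp u)) / (2 * Complex.I) := by
      rw [kp_conj]; field_simp; ring
    rw [pow_succ (jh u : ℂ) l]
    nth_rw 4 [this]
    ring

lemma Cv_step4 (k b : ℕ) : ∀ d l i : ℕ, d + i + l = 2*k+1 →
    ∃ L, Cv b (fun u => (jh u : ℂ) ^ l * kp u ^ i * (al u : ℂ) ^ d) L := by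
  intro d
  induction d with
  | zero =>
    intro l i h
    obtain ⟨L, hL⟩ := Cv_step3 k b l i 0 (by omega)
    exact ⟨L, hL.congr fun u _ => by simp⟩
  | succ d ih =>
    intro l i h
    obtain ⟨L, hL⟩ := ih l (i+1) (by omega)
    obtain ⟨M, hM⟩ := ih (l+1) i (by omega)
    refine ⟨_, (hL.lin hM 1 (-Complex.I)).congr fun u _ => ?_⟩
    rw [pow_succ (al u : ℂ) d]
    have : (al u : ℂ) = kp u - Complex.I * jh u := by rw [kp]; ring
    nth_rw 4 [this]
    ring

lemma exists_moments (k : ℕ) : ∃ e : ℕ → ℕ → ℝ, ∀ b d, d ≤ 2*k+1 →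
    Cv b (fun u => (jh u : ℂ) ^ (2*k+1-d) * (al u : ℂ) ^ d) (e b d : ℂ) := by
  have h : ∀ b d, ∃ x : ℝ, d ≤ 2*k+1 → Cv b (fun u => (jh u : ℂ) ^ (2*k+1-d) * (al u : ℂ) ^ d) (x : ℂ) := by
    intro b d
    by_cases hd : d ≤ 2*k+1
    · obtain ⟨L, hL⟩ := Cv_step4 k b d (2*k+1-d) 0 (by omega)
      have h1 : Cv b (fun u => (jh u : ℂ) ^ (2*k+1-d) * (al u : ℂ) ^ d) L := hL.congr fun u _ => by ring
      have h2 : Cv b (fun u => (jh u : ℂ) ^ (2*k+1-d) * (al u : ℂ) ^ d) (starRingEnd ℂ L) :=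
        h1.conj.congr fun u _ => by simp
      have h3 := h1.unique h2
      refine ⟨L.re, fun _ => ?_⟩
      rw [Complex.conj_eq_iff_re.1 h3.symm]
      exact h1
    · exact ⟨0, fun h => absurd h hd⟩
  choose e he using h
  exact ⟨e, he⟩

noncomputable def Yl (e : ℕ → ℝ) (n : ℕ) : ℂ :=
  ∑ m ∈ Finset.range (n+1), (n.choose m : ℂ) * Complex.I ^ (n - m) * e m

lemma Cv_Yl {k b : ℕ} {e : ℕ → ℝ} (he : ∀ d ≤ 2*k+1,
    Cv b (fun u => (jh u : ℂ) ^ (2*k+1-d) * (al u : ℂ) ^ d) (e d : ℂ)) {n : ℕ} (hn : n ≤ 2*k+1) :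
    Cv b (fun u => (jh u : ℂ) ^ (2*k+1-n) * kp u ^ n) (Yl e n) := by
  refine (Cv.sum (Finset.range (n+1)) (fun m => (n.choose m : ℂ) * Complex.I ^ (n - m)) (fun m hm => he m
    (by have := Finset.mem_range.1 hm; omega))).congr fun u _ => ?_
  rw [kp, add_pow, Finset.mul_sum]
  refine Finset.sum_congr rfl fun m hm => ?_
  have : m ≤ n := Nat.lt_succ_iff.1 (Finset.mem_range.1 hm)
  rw [show 2*k+1-m = (2*k+1-n) + (n-m) by omega, pow_add, mul_pow]
  ring

lemma Xe_tendsto {k b : ℕ} {e : ℕ → ℝ} (he : ∀ d ≤ 2*k+1,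
    Cv b (fun u => (jh u : ℂ) ^ (2*k+1-d) * (al u : ℂ) ^ d) (e d : ℂ)) {n : ℕ} (hn : n ≤ 2*k+1) :
    Tendsto (Xe (2*k+1) b n) (𝓝[>] 0) (𝓝 ((-1)^b * (-Complex.I) * (2 / Real.pi) ^ (2*k+1 - n) * Yl e n)) := by
  refine ((Cv_Yl he hn).2.const_mul _).congr fun ε => ?_
  rw [Xe, ← integral_const_mul]
  refine setIntegral_congr_fun measurableSet_Ioi fun u hu => ?_
  beta_reduce
  rw [Gc_axis hu]; ring

theorem partC (k : ℕ) : ∃ e : ℕ → ℕ → ℝ,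
    (∀ b n, k + 1 ≤ n → n ≤ 2*k+1 →
      (-1)^b * (-Complex.I) * (2 / Real.pi) ^ (2*k+1 - n) * Yl (e b) n = Complex.I * (IKM (2*k+1-n) n (2*b+1) : ℂ)) ∧
    (∀ b c, b + c + 1 ≤ k →
      ∑ n ∈ Finset.range (2 * k + 1 + 1), (-1) ^ n * ((2 * k + 1).choose n : ℂ) *
      (((-1)^b * (-Complex.I) * (2 / Real.pi) ^ (2*k+1 - n) * Yl (e b) n) *
        starRingEnd ℂ ((-1)^c * (-Complex.I) * (2 / Real.pi) ^ (2*k+1 - (2*k+1-n)) * Yl (e c) (2*k+1-n)) +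
       ((-1)^c * (-Complex.I) * (2 / Real.pi) ^ (2*k+1 - n) * Yl (e c) n) *
        starRingEnd ℂ ((-1)^b * (-Complex.I) * (2 / Real.pi) ^ (2*k+1 - (2*k+1-n)) * Yl (e b) (2*k+1-n))) = kerRHS k b c) := by
  obtain ⟨e, he⟩ := exists_moments k
  refine ⟨e, fun b n h1 h2 => ?_, fun b c hbc => ?_⟩
  · obtain ⟨L, hL, h⟩ := Cv_base (b := b) h2 h1
    rw [← hL.unique (Cv_Yl (he b) h2)]; exact h
  · refine tendsto_nhds_unique ?_ (kernel_limit k b c)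
    have : Tendsto (fun ε => ∑ n ∈ Finset.range (2 * k + 1 + 1), (-1) ^ n * ((2 * k + 1).choose n : ℂ) *
      (Xe (2*k+1) b n ε * starRingEnd ℂ (Xe (2*k+1) c (2*k+1-n) ε) +
       Xe (2*k+1) c n ε * starRingEnd ℂ (Xe (2*k+1) b (2*k+1-n) ε))) (𝓝[>] 0) (𝓝 (∑ n ∈ Finset.range (2 * k + 1 + 1), (-1) ^ n * ((2 * k + 1).choose n : ℂ) *
      (((-1)^b * (-Complex.I) * (2 / Real.pi) ^ (2*k+1 - n) * Yl (e b) n) *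
        starRingEnd ℂ ((-1)^c * (-Complex.I) * (2 / Real.pi) ^ (2*k+1 - (2*k+1-n)) * Yl (e c) (2*k+1-n)) +
       ((-1)^c * (-Complex.I) * (2 / Real.pi) ^ (2*k+1 - n) * Yl (e c) n) *
        starRingEnd ℂ ((-1)^b * (-Complex.I) * (2 / Real.pi) ^ (2*k+1 - (2*k+1-n)) * Yl (e b) (2*k+1-n))))) := by
      refine tendsto_finsetSum _ fun n hn => ?_
      have hn' : n ≤ 2*k+1 := Nat.lt_succ_iff.1 (Finset.mem_range.1 hn)
      have hm : 2*k+1-n ≤ 2*k+1 := Nat.sub_le _ _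
      have cj : ∀ (b' : ℕ), Tendsto (fun ε => starRingEnd ℂ (Xe (2*k+1) b' (2*k+1-n) ε)) (𝓝[>] 0) (𝓝 (starRingEnd ℂ _)) :=
        fun b' => (Complex.continuous_conj.tendsto _).comp (Xe_tendsto (he b') hm)
      exact (((Xe_tendsto (he b) hn').mul (cj c)).add ((Xe_tendsto (he c) hn').mul (cj b))).const_mul _
    refine this.congr' ?_
    filter_upwards [self_mem_nhdsWithin] with ε hε
    exact laplace_kernel hbc hε

end PartC3


section PartD1

noncomputable def gam (q r : ℕ) : ℝ :=
  (-1) ^ r / ((2 * r).doubleFactorial * (2 * q + 2 * r - 1).doubleFactorial : ℝ)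

noncomputable def Hs (q : ℕ) : PowerSeries ℝ :=
  PowerSeries.mk fun d => if Even d then gam q (d / 2) else 0

noncomputable def Es (e : ℕ → ℝ) : PowerSeries ℝ := PowerSeries.mk fun d => e d / d.factorial

/-- `tt e q n`, the coefficients of the Bessel-type transforms of the moment sequence. -/
noncomputable def tt (e : ℕ → ℝ) (q n : ℕ) : ℝ := PowerSeries.coeff n (PowerSeries.X ^ q * (Hs q * Es e))

lemma gam_zero (q : ℕ) : (2 * q + 1 : ℝ) * gam (q + 1) 0 = gam q 0 := by
  unfold gam
  rcases q with _ | q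
  · simp
  · have h : 2 * (q + 1 + 1) + 2 * 0 - 1 = (2 * (q + 1) + 2 * 0 - 1) + 2 := by omega
    rw [h, Nat.doubleFactorial_add_two]
    have : ((2 * (q + 1) + 2 * 0 - 1).doubleFactorial : ℝ) ≠ 0 := by
      exact_mod_cast (Nat.doubleFactorial_pos _).ne'
    have h2 : ((2 * (q + 1) + 2 * 0 - 1 + 2 : ℕ) : ℝ) = 2 * (q+1) + 1 := by
      rw [show 2 * (q + 1) + 2 * 0 - 1 + 2 = 2 * (q+1) + 1 by omega]; push_cast; ring
    push_cast [h2]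
    field_simp

lemma gam_succ (q r : ℕ) : gam (q + 2) r = (2 * q + 1) * gam (q + 1) (r + 1) - gam q (r + 1) := by
  unfold gam
  have h1 : 2 * (q + 2) + 2 * r - 1 = (2 * q + 2 * (r + 1) - 1) + 2 := by omega
  have h2 : 2 * (q + 1) + 2 * (r + 1) - 1 = (2 * q + 2 * (r + 1) - 1) + 2 := by omega
  rw [h1, h2, show 2 * (r+1) = 2 * r + 2 by ring, Nat.doubleFactorial_add_two, Nat.doubleFactorial_add_two]
  set A := (2 * q + (2 * r + 2) - 1).doubleFactorial with hA
  have hA0 : (A : ℝ) ≠ 0 := by exact_mod_cast (Nat.doubleFactorial_pos _).ne'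
  have hB0 : ((2 * r).doubleFactorial : ℝ) ≠ 0 := by exact_mod_cast (Nat.doubleFactorial_pos _).ne'
  have h3 : ((2 * q + (2 * r + 2) - 1 + 2 : ℕ) : ℝ) = 2 * q + 2 * r + 3 := by
    rw [show 2 * q + (2 * r + 2) - 1 + 2 = 2 * q + 2 * r + 3 by omega]; push_cast; ring
  have h4 : (2 * q + 2 * r + 3 : ℝ) ≠ 0 := by positivity
  have h5 : (2 * r + 2 : ℝ) ≠ 0 := by positivity
  rw [Nat.cast_mul, Nat.cast_mul, h3]
  push_cast
  field_simp
  ring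

lemma Hs_rec (q : ℕ) : PowerSeries.X ^ 2 * Hs (q + 2) = (PowerSeries.C (2 * q + 1 : ℝ)) * Hs (q + 1) - Hs q := by
  ext n
  rw [map_sub, PowerSeries.coeff_C_mul]
  rcases n with _ | _ | n
  · rw [PowerSeries.coeff_X_pow_mul']
    simp [Hs, gam_zero]
  · rw [PowerSeries.coeff_X_pow_mul']
    simp [Hs]
  · rw [show n + 1 + 1 = n + 2 from rfl, PowerSeries.coeff_X_pow_mul]
    simp only [Hs, PowerSeries.coeff_mk]
    by_cases h : Even n
    · obtain ⟨r, rfl⟩ := h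
      have e1 : Even (r + r) := ⟨r, rfl⟩
      have e2 : Even (r + r + 2) := ⟨r + 1, by ring⟩
      rw [if_pos e1, if_pos e2, if_pos e2, show (r + r) / 2 = r by omega, show (r + r + 2) / 2 = r + 1 by omega]
      exact gam_succ q r
    · have e2 : ¬ Even (n + 2) := by
        intro h'; apply h; rw [Nat.even_add] at h'; exact h'.2 even_two
      rw [if_neg h, if_neg e2, if_neg e2]; simp

lemma tt_rec (e : ℕ → ℝ) (q n : ℕ) : tt e (q + 2) n = (2 * q + 1) * tt e (q + 1) (n + 1) - tt e q n := by
  have h : PowerSeries.X * (PowerSeries.X ^ (q+2) * (Hs (q+2) * Es e)) =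
      PowerSeries.C (2 * q + 1 : ℝ) * (PowerSeries.X ^ (q+1) * (Hs (q+1) * Es e)) -
      PowerSeries.X * (PowerSeries.X ^ q * (Hs q * Es e)) := by
    linear_combination (PowerSeries.X ^ (q+1) * Es e) * Hs_rec q
  have := congrArg (PowerSeries.coeff (n+1)) h
  rw [map_sub, PowerSeries.coeff_C_mul, PowerSeries.coeff_succ_X_mul, PowerSeries.coeff_succ_X_mul] at this
  exact this

lemma tt_zero {e : ℕ → ℝ} {q n : ℕ} (h : n < q) : tt e q n = 0 := by
  rw [tt, PowerSeries.coeff_X_pow_mul', if_neg (by omega)]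

lemma gam0 (r : ℕ) : gam 0 r = (-1)^r / (2*r).factorial := by
  unfold gam
  rcases r with _ | r
  · simp
  · rw [show 2 * 0 + 2 * (r+1) - 1 = 2 * r + 1 by omega, show 2 * (r+1) = 2 * r + 1 + 1 by ring,
      Nat.factorial_eq_mul_doubleFactorial]
    push_cast; ring

lemma gam1 (r : ℕ) : gam 1 r = (-1)^r / (2*r+1).factorial := by
  unfold gam
  rw [show 2 * 1 + 2 * r - 1 = 2 * r + 1 by omega, Nat.factorial_eq_mul_doubleFactorial]
  push_cast; ring

lemma I_pow_split (d : ℕ) : Complex.I ^ d / (d.factorial : ℂ) =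
    ((PowerSeries.coeff d (Hs 0) : ℝ) : ℂ) + Complex.I * ((PowerSeries.coeff d (PowerSeries.X * Hs 1) : ℝ) : ℂ) := by
  rcases Nat.even_or_odd' d with ⟨r, rfl | rfl⟩
  · have h1 : PowerSeries.coeff (2*r) (PowerSeries.X * Hs 1) = 0 := by
      rcases r with _ | r
      · simp
      · rw [show 2 * (r+1) = 2*r+1+1 by ring, PowerSeries.coeff_succ_X_mul]
        simp [Hs]
    rw [h1]
    simp only [Hs, PowerSeries.coeff_mk, even_two_mul, if_true]
    rw [show 2 * r / 2 = r by omega, gam0, pow_mul, Complex.I_sq]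
    push_cast; ring
  · rw [PowerSeries.coeff_succ_X_mul]
    simp only [Hs, PowerSeries.coeff_mk, even_two_mul, if_true]
    have : ¬ Even (2 * r + 1) := by simp
    rw [if_neg this, show 2 * r / 2 = r by omega, gam1, pow_succ, pow_mul, Complex.I_sq]
    push_cast; ring

lemma Yl_eq (e : ℕ → ℝ) (n : ℕ) : Yl e n = n.factorial * ((tt e 0 n : ℂ) + Complex.I * (tt e 1 n : ℂ)) := by
  have h0 : tt e 0 n = ∑ m ∈ Finset.range (n+1), PowerSeries.coeff (n-m) (Hs 0) * (e m / m.factorial) := by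
    rw [tt, pow_zero, one_mul, mul_comm, PowerSeries.coeff_mul, Finset.Nat.sum_antidiagonal_eq_sum_range_succ_mk]
    refine Finset.sum_congr rfl fun m _ => ?_
    simp [Es, mul_comm]
  have h1 : tt e 1 n = ∑ m ∈ Finset.range (n+1), PowerSeries.coeff (n-m) (PowerSeries.X * Hs 1) * (e m / m.factorial) := by
    rw [tt, pow_one, ← mul_assoc, mul_comm, PowerSeries.coeff_mul, Finset.Nat.sum_antidiagonal_eq_sum_range_succ_mk]
    refine Finset.sum_congr rfl fun m _ => ?_
    simp [Es, mul_comm]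
  rw [h0, h1, Yl]
  push_cast
  rw [Finset.mul_sum, ← Finset.sum_add_distrib, Finset.mul_sum]
  refine Finset.sum_congr rfl fun m hm => ?_
  have hm' : m ≤ n := Nat.lt_succ_iff.1 (Finset.mem_range.1 hm)
  have h := I_pow_split (n - m)
  rw [Nat.cast_choose ℂ hm']
  have f1 : (m.factorial : ℂ) ≠ 0 := by exact_mod_cast m.factorial_ne_zero
  have f2 : ((n-m).factorial : ℂ) ≠ 0 := by exact_mod_cast (n-m).factorial_ne_zero
  calc _ = n.factorial * (Complex.I ^ (n-m) / ((n-m).factorial : ℂ)) * (e m / m.factorial) := by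
        field_simp
    _ = _ := by rw [h]; ring

/-- the bilinear pairing -/
noncomputable def VV (k : ℕ) (e e' : ℕ → ℝ) (q : ℕ) : ℝ :=
  ∑ i ∈ Finset.range k, (-1)^i * (tt e (q+1) (i+1) * tt e' q (2*k-i) + tt e q (i+1) * tt e' (q+1) (2*k-i))

lemma alt_telescope (a : ℕ → ℝ) (k : ℕ) :
    ∑ i ∈ Finset.range k, (-1)^i * (a (i+1) + a i) = a 0 - (-1)^k * a k := by
  induction k with
  | zero => simp
  | succ k ih => rw [Finset.sum_range_succ, ih, pow_succ]; ring

lemma VV_succ {k : ℕ} {e e' : ℕ → ℝ} (h' : tt e' 1 (2*k+1) = 0) (q : ℕ) :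
    VV k e e' (q+1) = - VV k e e' q - (2*q+1) * (-1)^k * (tt e (q+1) (k+1) * tt e' (q+1) (k+1)) := by
  have h := alt_telescope (fun i => tt e (q+1) (i+1) * tt e' (q+1) (2*k+1-i)) k
  have h0 : tt e (q+1) 1 * tt e' (q+1) (2*k+1) = 0 := by
    rcases q with _ | q
    · rw [h', mul_zero]
    · rw [tt_zero (by omega : 1 < q+1+1), zero_mul]
  simp only [zero_add, Nat.sub_zero] at h
  rw [h0, show 2*k+1-k = k+1 by omega] at h
  have : VV k e e' (q+1) + VV k e e' q = (2*q+1) * ∑ i ∈ Finset.range k, (-1)^i * (tt e (q+1) (i+1+1) * tt e' (q+1) (2*k+1-(i+1)) + tt e (q+1) (i+1) * tt e' (q+1) (2*k+1-i)) := by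
    rw [VV, VV, ← Finset.sum_add_distrib, Finset.mul_sum]
    refine Finset.sum_congr rfl fun i hi => ?_
    have hi' := Finset.mem_range.1 hi
    rw [show 2*k+1-(i+1) = 2*k-i by omega, show 2*k+1-i = 2*k-i+1 by omega, tt_rec, tt_rec]
    ring
  rw [h] at this
  linarith

lemma VV_last (k : ℕ) (e e' : ℕ → ℝ) : VV k e e' (k+1) = 0 := by
  rw [VV]
  refine Finset.sum_eq_zero fun i hi => ?_
  have hi' := Finset.mem_range.1 hi
  rw [tt_zero (by omega : i+1 < k+1+1), tt_zero (by omega : i+1 < k+1)]; ring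

lemma VV_zero {k : ℕ} {e e' : ℕ → ℝ} (h' : tt e' 1 (2*k+1) = 0) (hk : tt e 1 (k+1) = 0) :
    (-1)^k * VV k e e' 0 = - ∑ l ∈ Finset.range k, (-1)^(l+1) * (2*(l+1:ℝ)+1) * (tt e (l+2) (k+1) * tt e' (l+2) (k+1)) := by
  have h : ∀ Q, (-1)^k * ((-1)^Q * VV k e e' Q) = (-1)^k * VV k e e' 0 + ∑ q ∈ Finset.range Q, (-1)^q * (2*q+1) * (tt e (q+1) (k+1) * tt e' (q+1) (k+1)) := by
    intro Q
    have s : ((-1:ℝ)^k)*(-1)^k = 1 := by rw [← mul_pow]; norm_num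
    induction Q with
    | zero => simp
    | succ Q ih =>
      rw [Finset.sum_range_succ, ← add_assoc, ← ih, VV_succ h', pow_succ]
      linear_combination ((-1)^Q * (2*Q+1) * (tt e (Q+1) (k+1) * tt e' (Q+1) (k+1))) * s
  have h1 := h (k+1)
  rw [VV_last, Finset.sum_range_succ', hk] at h1
  push_cast at h1
  simp only [mul_zero, zero_mul, add_zero] at h1
  have e1 : ∀ l : ℕ, l + 1 + 1 = l + 2 := fun l => rfl
  simp only [e1] at h1
  linarith

end PartD1


section PartD2

lemma ssum {k : ℕ} {e e' : ℕ → ℝ} (h : ∀ n, k + 1 ≤ n → n ≤ 2*k+1 → tt e 1 n = 0)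
    (h' : ∀ n, k + 1 ≤ n → n ≤ 2*k+1 → tt e' 1 n = 0) :
    ∑ n ∈ Finset.range (2*k+1+1), (-1)^n * (tt e 1 n * tt e' 0 (2*k+1-n)) = - VV k e e' 0 := by
  rw [Finset.sum_range_succ', tt_zero (by omega : 0 < 1), zero_mul, mul_zero, add_zero, VV, ← Finset.sum_neg_distrib]
  symm
  rw [← Finset.sum_subset (Finset.range_mono (by omega : k ≤ 2*k+1))]
  · refine Finset.sum_congr rfl fun i hi => ?_
    have hi' := Finset.mem_range.1 hi
    rw [zero_add, h' (2*k-i) (by omega) (by omega), show 2*k+1-(i+1) = 2*k-i by omega, pow_succ]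
    ring
  · intro i hi hi2
    have a := Finset.mem_range.1 hi
    have b : ¬ i < k := fun h => hi2 (Finset.mem_range.2 h)
    rw [h (i+1) (by omega) (by omega)]; ring

lemma reflect_sum (N : ℕ) (f : ℕ → ℂ) :
    ∑ n ∈ Finset.range (N+1), f n = ∑ n ∈ Finset.range (N+1), f (N - n) := by
  rw [← Finset.sum_range_reflect]
  refine Finset.sum_congr rfl fun n hn => ?_
  rw [show N + 1 - 1 - n = N - n by omega]

lemma neg_one_pow_reflect {k n : ℕ} (hn : n ≤ 2*k+1) : (-1:ℂ)^(2*k+1-n) = - (-1)^n := by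
  have : (-1:ℂ)^(2*k+1-n) * (-1)^n = -1 := by
    rw [← pow_add, Nat.sub_add_cancel hn, pow_succ, pow_mul]; norm_num
  have s : ((-1:ℂ)^n)*(-1)^n = 1 := by rw [← mul_pow]; norm_num
  linear_combination (-1)^n * this - (-1:ℂ)^(2*k+1-n) * s

lemma kernel_alg {k : ℕ} {e e' : ℕ → ℝ} (h : ∀ n, k + 1 ≤ n → n ≤ 2*k+1 → tt e 1 n = 0)
    (h' : ∀ n, k + 1 ≤ n → n ≤ 2*k+1 → tt e' 1 n = 0) :
    ∑ n ∈ Finset.range (2*k+1+1), (-1:ℂ)^n * (((tt e 0 n : ℂ) + Complex.I * tt e 1 n) *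
        ((tt e' 0 (2*k+1-n) : ℂ) - Complex.I * tt e' 1 (2*k+1-n)) +
      ((tt e' 0 n : ℂ) + Complex.I * tt e' 1 n) *
        ((tt e 0 (2*k+1-n) : ℂ) - Complex.I * tt e 1 (2*k+1-n))) =
    -2 * Complex.I * ((VV k e e' 0 : ℝ) + (VV k e' e 0 : ℝ) : ℂ) := by
  have s1 := congrArg (fun x : ℝ => (x : ℂ)) (ssum h h')
  have s2 := congrArg (fun x : ℝ => (x : ℂ)) (ssum h' h)
  push_cast at s1 s2
  have s3 := s2
  rw [reflect_sum] at s3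
  simp only [mul_add, Finset.sum_add_distrib]
  rw [reflect_sum _ (fun n => (-1:ℂ)^n * (((tt e' 0 n : ℂ) + Complex.I * tt e' 1 n) *
        ((tt e 0 (2*k+1-n) : ℂ) - Complex.I * tt e 1 (2*k+1-n))))]
  rw [← Finset.sum_add_distrib]
  have : -2 * Complex.I * ((VV k e e' 0 : ℝ) + (VV k e' e 0 : ℝ) : ℂ) = 2 * Complex.I *
     (∑ n ∈ Finset.range (2*k+1+1), (-1:ℂ)^n * ((tt e 1 n : ℂ) * tt e' 0 (2*k+1-n))) + 2 * Complex.I *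
     (∑ n ∈ Finset.range (2*k+1+1), (-1:ℂ)^(2*k+1-n) * ((tt e' 1 (2*k+1-n) : ℂ) * tt e 0 (2*k+1-(2*k+1-n)))) := by
    rw [s1, s3]; ring
  rw [← mul_add, this, Finset.mul_sum, Finset.mul_sum, ← Finset.sum_add_distrib]
  refine Finset.sum_congr rfl fun n hn => ?_
  have hn' : n ≤ 2*k+1 := Nat.lt_succ_iff.1 (Finset.mem_range.1 hn)
  rw [neg_one_pow_reflect hn', Nat.sub_sub_self hn']
  ring

lemma prod_df (k : ℕ) : ∏ i ∈ Finset.range k, ((2 * i + 2 : ℝ) / (2 * i + 3)) =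
    (2*k).doubleFactorial / (2*k+1).doubleFactorial := by
  induction k with
  | zero => simp
  | succ k ih =>
    rw [Finset.prod_range_succ, ih, show 2*(k+1) = 2*k+2 by ring, show 2*k+2+1 = 2*k+1+2 by ring,
      Nat.doubleFactorial_add_two, Nat.doubleFactorial_add_two]
    push_cast
    rw [div_mul_div_comm]
    congr 1 <;> ring

theorem partD (k : ℕ) : ∃ e : ℕ → ℕ → ℝ,
    (∀ b n, k + 1 ≤ n → n ≤ 2*k+1 → tt (e b) 1 n = 0 ∧
      tt (e b) 0 n = - ((-1)^b * ((Real.pi/2)^(2*k+1-n) / n.factorial) * IKM (2*k+1-n) n (2*b+1))) ∧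
    (∀ b c, b + c + 1 ≤ k →
      (-1)^(b+c) * ∑ l ∈ Finset.range k, (-1)^(l+1) * (2*(l+1:ℝ)+1) * (tt (e b) (l+2) (k+1) * tt (e c) (l+2) (k+1)) =
      if b + c + 1 = k then - ((Real.pi/2)^(2*k+2) / ((2*k+1).doubleFactorial : ℝ)^2) else 0) := by
  obtain ⟨e, hA, hB⟩ := partC k
  have hpi : (Real.pi:ℂ) ≠ 0 := by exact_mod_cast Real.pi_ne_zero
  have A : ∀ b n, k + 1 ≤ n → n ≤ 2*k+1 → tt (e b) 1 n = 0 ∧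
      tt (e b) 0 n = - ((-1)^b * ((Real.pi/2)^(2*k+1-n) / n.factorial) * IKM (2*k+1-n) n (2*b+1)) := by
    intro b n h1 h2
    have h := hA b n h1 h2
    rw [Yl_eq] at h
    have f1 : (n.factorial : ℂ) ≠ 0 := by exact_mod_cast n.factorial_ne_zero
    have sq : ((-1:ℂ)^b)*(-1)^b = 1 := by rw [← mul_pow]; norm_num
    have pq : (2 / (Real.pi:ℂ)) ^ (2*k+1-n) * ((Real.pi:ℂ)/2) ^ (2*k+1-n) = 1 := by
      rw [← mul_pow, div_mul_div_comm, mul_comm, div_self (mul_ne_zero hpi two_ne_zero), one_pow]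
    have h3 : (tt (e b) 0 n : ℂ) + Complex.I * (tt (e b) 1 n : ℂ) =
        ((- ((-1)^b * ((Real.pi/2)^(2*k+1-n) / n.factorial) * IKM (2*k+1-n) n (2*b+1)) : ℝ) : ℂ) := by
      push_cast
      set P := (2 / (Real.pi:ℂ)) ^ (2*k+1-n)
      set Q := ((Real.pi:ℂ)/2) ^ (2*k+1-n)
      set S := (-1:ℂ)^b
      set x := (tt (e b) 0 n : ℂ) + Complex.I * (tt (e b) 1 n : ℂ)
      set Z := (IKM (2*k+1-n) n (2*b+1) : ℂ)
      have h4 : S * P * n.factorial * x = - Z := by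
        have : Complex.I * (S * P * n.factorial * x + Z) = 0 := by linear_combination -h
        rcases mul_eq_zero.1 this with h | h
        · exact absurd h Complex.I_ne_zero
        · linear_combination h
      field_simp
      linear_combination S * Q * h4 - (n.factorial * x * P * Q) * sq - n.factorial * x * pq
    have r := congrArg Complex.re h3
    have i := congrArg Complex.im h3
    rw [Complex.ofReal_re] at r
    rw [Complex.ofReal_im] at i
    simp at r i
    refine ⟨i, ?_⟩
    rw [r]
  refine ⟨e, A, fun b c hbc => ?_⟩
  have h1 : ∀ b n, k + 1 ≤ n → n ≤ 2*k+1 → tt (e b) 1 n = 0 := fun b n a1 a2 => (A b n a1 a2).1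
  have h := hB b c hbc
  have key : ∑ n ∈ Finset.range (2 * k + 1 + 1), (-1) ^ n * ((2 * k + 1).choose n : ℂ) *
      (((-1)^b * (-Complex.I) * (2 / Real.pi) ^ (2*k+1 - n) * Yl (e b) n) *
        starRingEnd ℂ ((-1)^c * (-Complex.I) * (2 / Real.pi) ^ (2*k+1 - (2*k+1-n)) * Yl (e c) (2*k+1-n)) +
       ((-1)^c * (-Complex.I) * (2 / Real.pi) ^ (2*k+1 - n) * Yl (e c) n) *
        starRingEnd ℂ ((-1)^b * (-Complex.I) * (2 / Real.pi) ^ (2*k+1 - (2*k+1-n)) * Yl (e b) (2*k+1-n))) =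
      ((-1)^(b+c) * (2 / Real.pi)^(2*k+1) * (2*k+1).factorial) * (-2 * Complex.I * ((VV k (e b) (e c) 0 : ℝ) + (VV k (e c) (e b) 0 : ℝ) : ℂ)) := by
    rw [← kernel_alg (h1 b) (h1 c), Finset.mul_sum]
    refine Finset.sum_congr rfl fun n hn => ?_
    have hn' : n ≤ 2*k+1 := Nat.lt_succ_iff.1 (Finset.mem_range.1 hn)
    rw [Yl_eq, Yl_eq, Yl_eq, Yl_eq, Nat.sub_sub_self hn']
    have hc : (((2*k+1).choose n : ℂ)) * n.factorial * (2*k+1-n).factorial = (2*k+1).factorial := by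
      exact_mod_cast Nat.choose_mul_factorial_mul_factorial hn'
    have hp : (2 / (Real.pi:ℂ)) ^ (2*k+1-n) * (2 / (Real.pi:ℂ)) ^ n = (2 / (Real.pi:ℂ))^(2*k+1) := by
      rw [← pow_add, Nat.sub_add_cancel hn']
    simp only [map_mul, map_pow, map_neg, map_one, map_add, map_div₀, Complex.conj_I, Complex.conj_ofReal, Complex.conj_natCast, map_ofNat]
    rw [← hc, ← hp, pow_add]
    linear_combination (-(-1)^n * (-1)^b * (-1)^c * ((2*k+1).choose n : ℂ) * n.factorial * (2*k+1-n).factorial * (2 / (Real.pi:ℂ)) ^ (2*k+1-n) * (2 / (Real.pi:ℂ)) ^ n * (((tt (e b) 0 n : ℂ) + Complex.I * tt (e b) 1 n) *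
        ((tt (e c) 0 (2*k+1-n) : ℂ) - Complex.I * tt (e c) 1 (2*k+1-n)) +
      ((tt (e c) 0 n : ℂ) + Complex.I * tt (e c) 1 n) *
        ((tt (e b) 0 (2*k+1-n) : ℂ) - Complex.I * tt (e b) 1 (2*k+1-n)))) * Complex.I_sq
  rw [key] at h
  have v1 := VV_zero (h1 c (2*k+1) (by omega) le_rfl) (h1 b (k+1) le_rfl (by omega))
  have v2 := VV_zero (h1 b (2*k+1) (by omega) le_rfl) (h1 c (k+1) le_rfl (by omega))
  set SS := ∑ l ∈ Finset.range k, (-1)^(l+1) * (2*(l+1:ℝ)+1) * (tt (e b) (l+2) (k+1) * tt (e c) (l+2) (k+1)) with hS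
  have v3 : (-1)^k * VV k (e c) (e b) 0 = - SS := by
    rw [v2, hS]; congr 1
    refine Finset.sum_congr rfl fun l _ => by ring
  have sk : ((-1:ℝ)^k)*(-1)^k = 1 := by rw [← mul_pow]; norm_num
  have w1 : VV k (e b) (e c) 0 = - (-1)^k * SS := by linear_combination (-1)^k * v1 - VV k (e b) (e c) 0 * sk
  have w3 : VV k (e c) (e b) 0 = - (-1)^k * SS := by linear_combination (-1)^k * v3 - VV k (e c) (e b) 0 * sk
  rw [w1, w3] at h
  set D := ((2*k+1).doubleFactorial : ℝ) with hD
  set D2 := ((2*k).doubleFactorial : ℝ) with hD2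
  have hD0 : D ≠ 0 := by rw [hD]; exact_mod_cast (Nat.doubleFactorial_pos _).ne'
  have hD20 : D2 ≠ 0 := by rw [hD2]; exact_mod_cast (Nat.doubleFactorial_pos _).ne'
  have hf : ((2*k+1).factorial : ℝ) = D * D2 := by
    rw [Nat.factorial_eq_mul_doubleFactorial]; push_cast; rfl
  have hreal : (-1)^(b+c) * (2 / Real.pi)^(2*k+1) * (D * D2) * (4 * (-1)^k * SS) =
      if b + c + 1 = k then - (2 * Real.pi * (-1)^k * (D2 / D)) else 0 := by
    have : Complex.I * (((-1)^(b+c) * (2 / Real.pi)^(2*k+1) * (D * D2) * (4 * (-1)^k * SS) : ℝ) : ℂ) =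
      Complex.I * ((if b + c + 1 = k then - (2 * Real.pi * (-1)^k * (D2 / D)) else 0 : ℝ) : ℂ) := by
      rw [kerRHS, prod_df] at h
      rw [← hf]
      push_cast at h ⊢
      split_ifs at h ⊢ with hh
      · rw [hD, hD2]
        push_cast
        linear_combination h
      · push_cast
        linear_combination h
    exact_mod_cast mul_left_cancel₀ Complex.I_ne_zero this
  have pq : (2 / Real.pi) ^ (2*k+1) * (Real.pi/2) ^ (2*k+1) = 1 := by
    rw [← mul_pow, div_mul_div_comm, mul_comm, div_self (by positivity), one_pow]
  have hpr := Real.pi_pos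
  split_ifs at hreal ⊢ with hh
  · have e1 : (-1)^(b+c) * SS * (D*D2*4) = -(2 * Real.pi * (D2/D)) * (Real.pi/2)^(2*k+1) := by
      linear_combination (-1)^k * (Real.pi/2)^(2*k+1) * hreal - ((-1)^(b+c) * SS * (D*D2*4) * (-1)^k * (-1)^k) * pq - ((-1)^(b+c) * SS * (D*D2*4) + (2 * Real.pi * (D2/D)) * (Real.pi/2)^(2*k+1)) * sk
    have e2 : (-1)^(b+c) * SS = (-(2 * Real.pi * (D2/D)) * (Real.pi/2)^(2*k+1)) / (D*D2*4) := by
      rw [eq_div_iff (by positivity)]; exact e1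
    rw [e2]
    rw [show 2*k+2 = 2*k+1+1 by ring, pow_succ (Real.pi/2) (2*k+1)]
    field_simp
    ring
  · have : (-1)^(b+c) * SS * (D * D2 * 4 * (2 / Real.pi)^(2*k+1) * (-1)^k) = 0 := by linear_combination hreal
    rcases mul_eq_zero.1 this with h | h
    · exact h
    · exfalso
      revert h
      have : (2 / Real.pi)^(2*k+1) ≠ 0 := by positivity
      have : (-1:ℝ)^k ≠ 0 := by simp
      positivity

end PartD2


section PartE1

/-- Coefficients of the Lommel-type polynomials. -/
noncomputable def cU : ℕ → ℕ → ℝ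
  | 0, l => if l = 0 then 1 else 0
  | 1, _ => 0
  | (q+2), 0 => - cU q 0
  | (q+2), (l+1) => (2*q+1) * cU (q+1) l - cU q (l+1)

lemma cU_zero (q : ℕ) : ∀ l, q ≤ l + 1 → 1 ≤ l → cU q l = 0 := by
  induction q using Nat.twoStepInduction with
  | zero => intro l _ h; simp [cU]; omega
  | one => intro l _ _; simp [cU]
  | more q h1 h2 =>
    intro l h3 h4
    obtain ⟨l, rfl⟩ : ∃ m, l = m + 1 := ⟨l - 1, by omega⟩
    rw [cU, h1 (l+1) (by omega) (by omega)]
    rcases Nat.eq_zero_or_pos l with rfl | hl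
    · have : q = 0 := by omega
      subst this; simp [cU]
    · rw [h2 l (by omega) hl]; ring

lemma cU_odd (q : ℕ) : ∀ l, Odd (q + l) → cU q l = 0 := by
  induction q using Nat.twoStepInduction with
  | zero =>
    intro l h
    have : l ≠ 0 := by rintro rfl; simp at h
    simp [cU, this]
  | one => intro l _; simp [cU]
  | more q h1 h2 =>
    intro l h
    rcases l with _ | l
    · rw [cU, h1 0 (by rw [Nat.odd_iff] at h ⊢; omega)]; ring
    · rw [cU, h1 (l+1) (by rw [Nat.odd_iff] at h ⊢; omega), h2 l (by rw [Nat.odd_iff] at h ⊢; omega)]; ring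

lemma cU_lead (l : ℕ) : cU (l+2) l = - ((2*l+1).doubleFactorial : ℝ) := by
  induction l with
  | zero => simp [cU]
  | succ l ih =>
    rw [show l + 1 + 2 = (l+1) + 2 from rfl, cU, ih, cU_zero (l+1) (l+1) (by omega) (by omega),
      show 2 * (l+1) + 1 = (2*l+1) + 2 by ring, Nat.doubleFactorial_add_two]
    push_cast; ring

lemma tt_cU {k : ℕ} {e : ℕ → ℝ} (h : ∀ n, k+1 ≤ n → n ≤ 2*k+1 → tt e 1 n = 0) (q : ℕ) :
    ∀ n L, k + 1 ≤ n → n + q ≤ 2*k+2 → (q = 0 → 1 ≤ L) → q ≤ L + 1 →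
      tt e q n = ∑ l ∈ Finset.range L, cU q l * tt e 0 (n+l) := by
  induction q using Nat.twoStepInduction with
  | zero =>
    intro n L h1 h2 h3 _
    obtain ⟨L, rfl⟩ : ∃ m, L = m + 1 := ⟨L - 1, by have := h3 rfl; omega⟩
    rw [Finset.sum_range_succ']
    simp [cU]
  | one => intro n L h1 h2 _ _; rw [h n h1 (by omega)]; simp [cU]
  | more q i1 i2 =>
    intro n L h1 h2 h3 h4
    obtain ⟨L, rfl⟩ : ∃ m, L = m + 1 := ⟨L - 1, by omega⟩
    rw [tt_rec, i1 n (L+1) h1 (by omega) (by omega) (by omega), i2 (n+1) L (by omega) (by omega) (by omega) (by omega),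
      Finset.sum_range_succ', Finset.sum_range_succ', cU]
    simp only [cU]
    rw [Finset.mul_sum, ← sub_sub, ← Finset.sum_sub_distrib]
    rw [neg_mul, ← sub_eq_add_neg]
    congr 1
    refine Finset.sum_congr rfl fun l _ => ?_
    rw [show n + 1 + l = n + (l+1) by ring]; ring

lemma parity_sum (k : ℕ) : ∀ f : ℕ → ℝ, ∑ l ∈ Finset.range k, f l =
    ∑ a ∈ Finset.range ((k+1)/2), f (k-1-2*a) + ∑ a ∈ Finset.range (k/2), f (k-2-2*a) := by
  induction k using Nat.twoStepInduction with
  | zero => intro f; simp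
  | one => intro f; simp
  | more k h _ =>
    intro f
    rw [Finset.sum_range_succ, Finset.sum_range_succ, h f,
      show (k+2+1)/2 = (k+1)/2+1 by omega, show (k+2)/2 = k/2+1 by omega,
      Finset.sum_range_succ', Finset.sum_range_succ']
    have e1 : ∀ a, k + 2 - 1 - 2*(a+1) = k - 1 - 2*a := by intro a; omega
    have e2 : ∀ a, k + 2 - 2 - 2*(a+1) = k - 2 - 2*a := by intro a; omega
    simp only [e1, e2]
    simp only [mul_zero, Nat.sub_zero, show k+2-1 = k+1 by omega, show k+2-2 = k by omega]
    ring

noncomputable def MO (k : ℕ) : Matrix (Fin ((k+1)/2)) (Fin ((k+1)/2)) ℝ :=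
  Matrix.of fun a b => IKM (2*a+1) (2*k-2*a) (2*b+1)
noncomputable def ME (k : ℕ) : Matrix (Fin (k/2)) (Fin (k/2)) ℝ :=
  Matrix.of fun a b => IKM (2*a+2) (2*k-1-2*a) (2*b+1)
noncomputable def cO (k a : ℕ) : ℝ := (2*(k-1-2*a)+1).doubleFactorial * ((Real.pi/2)^(2*a+1) / (2*k-2*a).factorial)
noncomputable def cE (k a : ℕ) : ℝ := (2*(k-2-2*a)+1).doubleFactorial * ((Real.pi/2)^(2*a+2) / (2*k-1-2*a).factorial)

lemma TO_expand {k : ℕ} {e : ℕ → ℝ} {b : ℕ} (h : ∀ n, k + 1 ≤ n → n ≤ 2*k+1 → tt e 1 n = 0 ∧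
      tt e 0 n = - ((-1)^b * ((Real.pi/2)^(2*k+1-n) / n.factorial) * IKM (2*k+1-n) n (2*b+1)))
    {a : ℕ} (ha : a < (k+1)/2) :
    (-1)^b * tt e (k-2*a+1) (k+1) = ∑ a' ∈ Finset.range ((k+1)/2),
      (-cU (k-2*a+1) (k-1-2*a') * ((Real.pi/2)^(2*a'+1) / (2*k-2*a').factorial)) * IKM (2*a'+1) (2*k-2*a') (2*b+1) := by
  rw [tt_cU (fun n h1 h2 => (h n h1 h2).1) (k-2*a+1) (k+1) k le_rfl (by omega) (by omega) (by omega), parity_sum]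
  have : ∑ a' ∈ Finset.range (k/2), cU (k-2*a+1) (k-2-2*a') * tt e 0 (k+1+(k-2-2*a')) = 0 := by
    refine Finset.sum_eq_zero fun a' h' => ?_
    rw [Finset.mem_range] at h'
    rw [cU_odd _ _ (by rw [Nat.odd_iff]; omega), zero_mul]
  rw [this, add_zero, Finset.mul_sum]
  refine Finset.sum_congr rfl fun a' h' => ?_
  rw [Finset.mem_range] at h'
  rw [(h _ (by omega) (by omega)).2, show k+1+(k-1-2*a') = 2*k-2*a' by omega, show 2*k+1-(2*k-2*a') = 2*a'+1 by omega]
  have : (-1:ℝ)^b*(-1)^b = 1 := by rw [← mul_pow]; norm_num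
  linear_combination (-cU (k-2*a+1) (k-1-2*a') * ((Real.pi/2)^(2*a'+1) / (2*k-2*a').factorial)) * IKM (2*a'+1) (2*k-2*a') (2*b+1) * this

lemma TE_expand {k : ℕ} {e : ℕ → ℝ} {b : ℕ} (h : ∀ n, k + 1 ≤ n → n ≤ 2*k+1 → tt e 1 n = 0 ∧
      tt e 0 n = - ((-1)^b * ((Real.pi/2)^(2*k+1-n) / n.factorial) * IKM (2*k+1-n) n (2*b+1)))
    {a : ℕ} (ha : a < k/2) :
    (-1)^b * tt e (k-2*a) (k+1) = ∑ a' ∈ Finset.range (k/2),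
      (-cU (k-2*a) (k-2-2*a') * ((Real.pi/2)^(2*a'+2) / (2*k-1-2*a').factorial)) * IKM (2*a'+2) (2*k-1-2*a') (2*b+1) := by
  rw [tt_cU (fun n h1 h2 => (h n h1 h2).1) (k-2*a) (k+1) k le_rfl (by omega) (by omega) (by omega), parity_sum]
  have : ∑ a' ∈ Finset.range ((k+1)/2), cU (k-2*a) (k-1-2*a') * tt e 0 (k+1+(k-1-2*a')) = 0 := by
    refine Finset.sum_eq_zero fun a' h' => ?_
    rw [Finset.mem_range] at h'
    rw [cU_odd _ _ (by rw [Nat.odd_iff]; omega), zero_mul]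
  rw [this, zero_add, Finset.mul_sum]
  refine Finset.sum_congr rfl fun a' h' => ?_
  rw [Finset.mem_range] at h'
  rw [(h _ (by omega) (by omega)).2, show k+1+(k-2-2*a') = 2*k-1-2*a' by omega, show 2*k+1-(2*k-1-2*a') = 2*a'+2 by omega]
  have : (-1:ℝ)^b*(-1)^b = 1 := by rw [← mul_pow]; norm_num
  linear_combination (-cU (k-2*a) (k-2-2*a') * ((Real.pi/2)^(2*a'+2) / (2*k-1-2*a').factorial)) * IKM (2*a'+2) (2*k-1-2*a') (2*b+1) * this

lemma det_TO {k : ℕ} {e : ℕ → ℕ → ℝ} (h : ∀ b n, k + 1 ≤ n → n ≤ 2*k+1 → tt (e b) 1 n = 0 ∧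
      tt (e b) 0 n = - ((-1)^b * ((Real.pi/2)^(2*k+1-n) / n.factorial) * IKM (2*k+1-n) n (2*b+1))) :
    (Matrix.of fun a b : Fin ((k+1)/2) => (-1)^(b:ℕ) * tt (e b) (k-2*a+1) (k+1)).det =
      (∏ a ∈ Finset.range ((k+1)/2), cO k a) * (MO k).det := by
  have e1 : (Matrix.of fun a b : Fin ((k+1)/2) => (-1)^(b:ℕ) * tt (e b) (k-2*a+1) (k+1)) =
    (Matrix.of fun a a' : Fin ((k+1)/2) => (-cU (k-2*a+1) (k-1-2*a') * ((Real.pi/2)^(2*a'.1+1) / (2*k-2*a'.1).factorial))) * MO k := by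
    ext a b
    rw [Matrix.mul_apply, Matrix.of_apply, TO_expand (h b) a.2, Finset.sum_range]
    rfl
  rw [e1, Matrix.det_mul, Matrix.det_of_isUpperTriangular]
  · rw [Finset.prod_range]
    congr 1
    refine Finset.prod_congr rfl fun a _ => ?_
    have := a.2
    rw [Matrix.of_apply, show k-2*a.1+1 = (k-1-2*a)+2 by omega, cU_lead, neg_neg, cO]
  · intro a a' haa
    have h1 : a'.1 < a.1 := haa
    have := a.2
    rw [Matrix.of_apply, cU_zero _ _ (by omega) (by omega)]; simp

lemma det_TE {k : ℕ} {e : ℕ → ℕ → ℝ} (h : ∀ b n, k + 1 ≤ n → n ≤ 2*k+1 → tt (e b) 1 n = 0 ∧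
      tt (e b) 0 n = - ((-1)^b * ((Real.pi/2)^(2*k+1-n) / n.factorial) * IKM (2*k+1-n) n (2*b+1))) :
    (Matrix.of fun a b : Fin (k/2) => (-1)^(b:ℕ) * tt (e b) (k-2*a) (k+1)).det =
      (∏ a ∈ Finset.range (k/2), cE k a) * (ME k).det := by
  have e1 : (Matrix.of fun a b : Fin (k/2) => (-1)^(b:ℕ) * tt (e b) (k-2*a) (k+1)) =
    (Matrix.of fun a a' : Fin (k/2) => (-cU (k-2*a) (k-2-2*a') * ((Real.pi/2)^(2*a'.1+2) / (2*k-1-2*a'.1).factorial))) * ME k := by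
    ext a b
    rw [Matrix.mul_apply, Matrix.of_apply, TE_expand (h b) a.2, Finset.sum_range]
    rfl
  rw [e1, Matrix.det_mul, Matrix.det_of_isUpperTriangular]
  · rw [Finset.prod_range]
    congr 1
    refine Finset.prod_congr rfl fun a _ => ?_
    have := a.2
    rw [Matrix.of_apply, show k-2*a.1 = (k-2-2*a)+2 by omega, cU_lead, neg_neg, cE]
  · intro a a' haa
    have h1 : a'.1 < a.1 := haa
    have := a.2
    rw [Matrix.of_apply, cU_zero _ _ (by omega) (by omega)]; simp

lemma quad_id {k : ℕ} {e : ℕ → ℕ → ℝ} (h : ∀ b c, b + c + 1 ≤ k →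
      (-1)^(b+c) * ∑ l ∈ Finset.range k, (-1)^(l+1) * (2*(l+1:ℝ)+1) * (tt (e b) (l+2) (k+1) * tt (e c) (l+2) (k+1)) =
      if b + c + 1 = k then - ((Real.pi/2)^(2*k+2) / ((2*k+1).doubleFactorial : ℝ)^2) else 0)
    {b c : ℕ} (hbc : b + c + 1 ≤ k) :
    ∑ a ∈ Finset.range ((k+1)/2), ((2*(k-2*a)+1 : ℕ):ℝ) * (((-1)^b * tt (e b) (k-2*a+1) (k+1)) * ((-1)^c * tt (e c) (k-2*a+1) (k+1))) =
    ∑ a ∈ Finset.range (k/2), ((2*(k-1-2*a)+1 : ℕ):ℝ) * (((-1)^b * tt (e b) (k-2*a) (k+1)) * ((-1)^c * tt (e c) (k-2*a) (k+1))) +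
    (-1)^(k+1) * if b + c + 1 = k then ((Real.pi/2)^(2*k+2) / ((2*k+1).doubleFactorial : ℝ)^2) else 0 := by
  have h1 := h b c hbc
  rw [parity_sum] at h1
  have e1 : ∑ a ∈ Finset.range ((k+1)/2), ((-1:ℝ)^(k-1-2*a+1) * (2*(((k-1-2*a:ℕ):ℝ)+1)+1) * (tt (e b) (k-1-2*a+2) (k+1) * tt (e c) (k-1-2*a+2) (k+1))) =
     (-1)^(k+b+c) * ∑ a ∈ Finset.range ((k+1)/2), ((2*(k-2*a)+1 : ℕ):ℝ) * (((-1)^b * tt (e b) (k-2*a+1) (k+1)) * ((-1)^c * tt (e c) (k-2*a+1) (k+1))) := by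
    rw [Finset.mul_sum]
    refine Finset.sum_congr rfl fun a ha => ?_
    rw [Finset.mem_range] at ha
    obtain ⟨p, hp⟩ : ∃ p, k = p + 1 + 2*a := ⟨k-1-2*a, by omega⟩
    rw [show k-1-2*a = p by omega, show k - 2*a = p+1 by omega, show k + b + c = p + 1 + b + c + 2*a by omega]
    have hb : (-1:ℝ)^b*(-1)^b = 1 := by rw [← mul_pow]; norm_num
    have hc : (-1:ℝ)^c*(-1)^c = 1 := by rw [← mul_pow]; norm_num
    have ha : (-1:ℝ)^(2*a) = 1 := by rw [pow_mul]; norm_num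
    simp only [pow_add, ha]
    push_cast
    set A := tt (e b) (p+2) (k+1)
    set B := tt (e c) (p+2) (k+1)
    linear_combination (-((-1)^p*(-1)^1*(2*((p:ℝ)+1)+1)*(A*B))) * ((-1)^c*(-1)^c * hb + hc)
  have e2 : ∑ a ∈ Finset.range (k/2), ((-1:ℝ)^(k-2-2*a+1) * (2*(((k-2-2*a:ℕ):ℝ)+1)+1) * (tt (e b) (k-2-2*a+2) (k+1) * tt (e c) (k-2-2*a+2) (k+1))) =
     - (-1)^(k+b+c) * ∑ a ∈ Finset.range (k/2), ((2*(k-1-2*a)+1 : ℕ):ℝ) * (((-1)^b * tt (e b) (k-2*a) (k+1)) * ((-1)^c * tt (e c) (k-2*a) (k+1))) := by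
    rw [Finset.mul_sum]
    refine Finset.sum_congr rfl fun a ha => ?_
    rw [Finset.mem_range] at ha
    obtain ⟨p, hp⟩ : ∃ p, k = p + 2 + 2*a := ⟨k-2-2*a, by omega⟩
    rw [show k-2-2*a = p by omega, show k - 2*a = p+2 by omega, show k - 1 - 2*a = p+1 by omega, show k + b + c = p + 2 + b + c + 2*a by omega]
    have hb : (-1:ℝ)^b*(-1)^b = 1 := by rw [← mul_pow]; norm_num
    have hc : (-1:ℝ)^c*(-1)^c = 1 := by rw [← mul_pow]; norm_num
    have ha : (-1:ℝ)^(2*a) = 1 := by rw [pow_mul]; norm_num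
    simp only [pow_add, ha]
    push_cast
    set A := tt (e b) (p+2) (k+1)
    set B := tt (e c) (p+2) (k+1)
    linear_combination (-((-1)^p*(-1)^1*(2*((p:ℝ)+1)+1)*(A*B))) * ((-1)^c*(-1)^c * hb + hc)
  rw [e1, e2] at h1
  set S1 := ∑ a ∈ Finset.range ((k+1)/2), ((2*(k-2*a)+1 : ℕ):ℝ) * (((-1)^b * tt (e b) (k-2*a+1) (k+1)) * ((-1)^c * tt (e c) (k-2*a+1) (k+1)))
  set S2 := ∑ a ∈ Finset.range (k/2), ((2*(k-1-2*a)+1 : ℕ):ℝ) * (((-1)^b * tt (e b) (k-2*a) (k+1)) * ((-1)^c * tt (e c) (k-2*a) (k+1)))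
  have hb : (-1:ℝ)^(b+c)*(-1)^(b+c) = 1 := by rw [← mul_pow]; norm_num
  have hk : (-1:ℝ)^k*(-1)^k = 1 := by rw [← mul_pow]; norm_num
  have h2 : S1 - S2 = (-1)^k * (if b + c + 1 = k then - ((Real.pi/2)^(2*k+2) / ((2*k+1).doubleFactorial : ℝ)^2) else 0) := by
    rw [← h1, show k+b+c = k+(b+c) by ring, pow_add]
    linear_combination (-(S1-S2)*(-1)^k*(-1)^k) * hb - (S1-S2) * hk
  split_ifs at h2 ⊢
  · rw [pow_succ]; linear_combination h2
  · linear_combination h2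

end PartE1


section PartE2

noncomputable def dn (n : ℕ) (f : ℕ → ℕ → ℝ) : ℝ := (Matrix.of fun a b : Fin n => f a b).det

lemma dn_gram {n : ℕ} {f g : ℕ → ℕ → ℝ} {w v : ℕ → ℝ}
    (h : ∀ b c, b < n → c < n → ∑ a ∈ Finset.range n, w a * (f a b * f a c) =
      ∑ a ∈ Finset.range n, v a * (g a b * g a c)) :
    (∏ a ∈ Finset.range n, w a) * dn n f ^ 2 = (∏ a ∈ Finset.range n, v a) * dn n g ^ 2 := by
  have key : ∀ (f : ℕ → ℕ → ℝ) (w : ℕ → ℝ), (∏ a ∈ Finset.range n, w a) * dn n f ^ 2 =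
      (Matrix.of fun b c : Fin n => ∑ a ∈ Finset.range n, w a * (f a b * f a c)).det := by
    intro f w
    have : (Matrix.of fun b c : Fin n => ∑ a ∈ Finset.range n, w a * (f a b * f a c)) =
      (Matrix.of fun a b : Fin n => f a b)ᵀ * (Matrix.diagonal (fun a : Fin n => w a) * (Matrix.of fun a b : Fin n => f a b)) := by
      ext b c
      rw [Matrix.mul_apply, Matrix.of_apply, Finset.sum_range]
      refine Finset.sum_congr rfl fun a _ => ?_
      rw [Matrix.diagonal_mul]
      simp only [Matrix.transpose_apply, Matrix.of_apply]
      ring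
    rw [this, Matrix.det_mul, Matrix.det_mul, Matrix.det_transpose, Matrix.det_diagonal, Finset.prod_range, dn]
    ring
  rw [key, key]
  congr 1
  ext b c
  exact h b c b.2 c.2

lemma dn_gram_succ {n : ℕ} {f g : ℕ → ℕ → ℝ} {w v : ℕ → ℝ} {d : ℝ}
    (h : ∀ b c, b < n + 1 → c < n + 1 → ∑ a ∈ Finset.range (n+1), w a * (f a b * f a c) =
      ∑ a ∈ Finset.range n, v a * (g a b * g a c) + if b = n ∧ c = n then d else 0) :
    (∏ a ∈ Finset.range (n+1), w a) * dn (n+1) f ^ 2 = d * (∏ a ∈ Finset.range n, v a) * dn n g ^ 2 := by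
  set g' : ℕ → ℕ → ℝ := fun a b => if a < n then g a b else if b = n then 1 else 0 with hg
  set v' : ℕ → ℝ := fun a => if a < n then v a else d with hv
  rw [dn_gram (n := n+1) (f := f) (g := g') (w := w) (v := v')]
  · have e1 : dn (n+1) g' = dn n g := by
      rw [dn, Matrix.det_succ_row _ (Fin.last n), Finset.sum_eq_single (Fin.last n)]
      · simp only [Matrix.of_apply, hg, Fin.val_last, lt_irrefl, if_false, if_true, mul_one, dn]
        rw [← two_mul, pow_mul]
        simp only [even_two, Even.neg_pow, one_pow, one_mul]
        congr 1
        ext a b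
        simp [Matrix.submatrix_apply, Fin.succAbove_last]
      · intro b _ hb
        have : b.1 ≠ n := fun h => hb (Fin.ext h)
        simp [hg, this]
      · simp
    rw [e1, Finset.prod_range_succ]
    have e2 : ∏ a ∈ Finset.range n, v' a = ∏ a ∈ Finset.range n, v a :=
      Finset.prod_congr rfl fun a ha => by simp [hv, Finset.mem_range.1 ha]
    rw [e2]
    simp only [hv, lt_irrefl, if_false]
    ring
  · intro b c hb hc
    rw [h b c hb hc, Finset.sum_range_succ _ n]
    congr 1
    · refine Finset.sum_congr rfl fun a ha => ?_
      simp [hv, hg, Finset.mem_range.1 ha]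
    · simp only [hv, hg, lt_irrefl, if_false]
      by_cases h1 : b = n <;> by_cases h2 : c = n <;> simp [h1, h2]

theorem partE (k : ℕ) :
    (∏ a ∈ Finset.range ((k+1)/2), ((2*(k-2*a)+1 : ℕ):ℝ) * cO k a ^ 2) * (MO k).det ^ 2 =
    (if Even k then 1 else (Real.pi/2)^(2*k+2) / ((2*k+1).doubleFactorial : ℝ)^2) *
    (∏ a ∈ Finset.range (k/2), ((2*(k-1-2*a)+1 : ℕ):ℝ) * cE k a ^ 2) * (ME k).det ^ 2 := by
  obtain ⟨e, hA, hB⟩ := partD k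
  have h1 := det_TO hA
  have h2 := det_TE hA
  have h3 := fun b c => quad_id hB (b := b) (c := c)
  have h1' : dn ((k+1)/2) (fun a b => (-1)^b * tt (e b) (k-2*a+1) (k+1)) =
      (∏ a ∈ Finset.range ((k+1)/2), cO k a) * (MO k).det := h1
  have h2' : dn (k/2) (fun a b => (-1)^b * tt (e b) (k-2*a) (k+1)) =
      (∏ a ∈ Finset.range (k/2), cE k a) * (ME k).det := h2
  simp only [Finset.prod_mul_distrib, Finset.prod_pow]
  have g : (∏ a ∈ Finset.range ((k+1)/2), ((2*(k-2*a)+1 : ℕ):ℝ)) * dn ((k+1)/2) (fun a b => (-1)^b * tt (e b) (k-2*a+1) (k+1)) ^ 2 =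
      (if Even k then 1 else (Real.pi/2)^(2*k+2) / ((2*k+1).doubleFactorial : ℝ)^2) *
      (∏ a ∈ Finset.range (k/2), ((2*(k-1-2*a)+1 : ℕ):ℝ)) * dn (k/2) (fun a b => (-1)^b * tt (e b) (k-2*a) (k+1)) ^ 2 := by
    split_ifs with hk
    · rw [Nat.even_iff] at hk
      rw [show (k+1)/2 = k/2 by omega] at h3 ⊢
      rw [one_mul]
      apply dn_gram
      intro b c hb hc
      rw [h3 b c (by omega), if_neg (by omega)]
      simp
    · have hk' : Odd k := Nat.not_even_iff_odd.1 hk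
      have ho : (-1:ℝ)^(k+1) = 1 := (Odd.add_one hk').neg_one_pow
      rw [Nat.odd_iff] at hk'
      rw [show (k+1)/2 = k/2+1 by omega] at h3 ⊢
      apply dn_gram_succ
      intro b c hb hc
      rw [h3 b c (by omega), ho, one_mul]
      congr 1
      refine if_congr (by omega) rfl rfl
  rw [h1', h2'] at g
  linear_combination g

end PartE2


section PartE3
open MeasureTheory Topology

lemma andreief_nonneg {n : ℕ} {w φ ψ : ℝ → ℝ} (hw : ∀ t, 0 ≤ w t) (hw0 : ∀ t, t ≤ 0 → w t = 0)
    (hφ : ∀ s t, 0 < s → s ≤ t → φ s ≤ φ t) (hψ : ∀ s t, 0 < s → s ≤ t → ψ s ≤ ψ t)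
    (hi : ∀ a b : Fin n, Integrable (fun t => w t * (φ t ^ (a:ℕ) * ψ t ^ (b:ℕ)))) :
    0 ≤ (Matrix.of fun a b : Fin n => ∫ t, w t * (φ t ^ (a:ℕ) * ψ t ^ (b:ℕ))).det := by
  set A := (Matrix.of fun a b : Fin n => ∫ t, w t * (φ t ^ (a:ℕ) * ψ t ^ (b:ℕ))) with hA
  have h1 : ∀ t : Fin n → ℝ, (∏ i, w (t i)) * ((Matrix.vandermonde (fun i => φ (t i))).det * (Matrix.vandermonde (fun i => ψ (t i))).det) =
      ∑ σ : Equiv.Perm (Fin n), ∑ τ : Equiv.Perm (Fin n), ((Equiv.Perm.sign σ : ℤ) : ℝ) * (((Equiv.Perm.sign τ : ℤ) : ℝ) *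
        ∏ i, (w (t i) * (φ (t i) ^ ((σ i : Fin n):ℕ) * ψ (t i) ^ ((τ i : Fin n):ℕ)))) := by
    intro t
    rw [← Matrix.det_transpose, ← Matrix.det_transpose (Matrix.vandermonde (fun i => ψ (t i))), Matrix.det_apply', Matrix.det_apply',
      Finset.sum_mul_sum, Finset.mul_sum]
    refine Finset.sum_congr rfl fun σ _ => ?_
    rw [Finset.mul_sum]
    refine Finset.sum_congr rfl fun τ _ => ?_
    simp only [Matrix.transpose_apply, Matrix.vandermonde_apply, Finset.prod_mul_distrib]
    ring
  have hIntg : ∀ σ τ : Equiv.Perm (Fin n), Integrable (fun t : Fin n → ℝ => ∏ i, (w (t i) * (φ (t i) ^ ((σ i : Fin n):ℕ) * ψ (t i) ^ ((τ i : Fin n):ℕ)))) :=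
    fun σ τ => Integrable.fintype_prod (f := fun i s => w s * (φ s ^ ((σ i : Fin n):ℕ) * ψ s ^ ((τ i : Fin n):ℕ))) (fun i => hi (σ i) (τ i))
  have h2 : ∫ t : Fin n → ℝ, (∏ i, w (t i)) * ((Matrix.vandermonde (fun i => φ (t i))).det * (Matrix.vandermonde (fun i => ψ (t i))).det) =
      (n.factorial : ℝ) * A.det := by
    simp only [h1]
    rw [integral_finsetSum _ (fun σ _ => integrable_finsetSum _ fun τ _ => ((hIntg σ τ).const_mul _).const_mul _)]
    have : ∀ σ : Equiv.Perm (Fin n), ∫ t : Fin n → ℝ, ∑ τ : Equiv.Perm (Fin n), ((Equiv.Perm.sign σ : ℤ) : ℝ) * (((Equiv.Perm.sign τ : ℤ) : ℝ) *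
        ∏ i, (w (t i) * (φ (t i) ^ ((σ i : Fin n):ℕ) * ψ (t i) ^ ((τ i : Fin n):ℕ)))) = A.det := by
      intro σ
      rw [integral_finsetSum _ (fun τ _ => ((hIntg σ τ).const_mul _).const_mul _)]
      have e1 : ∀ τ : Equiv.Perm (Fin n), ∫ t : Fin n → ℝ, ((Equiv.Perm.sign σ : ℤ) : ℝ) * (((Equiv.Perm.sign τ : ℤ) : ℝ) *
        ∏ i, (w (t i) * (φ (t i) ^ ((σ i : Fin n):ℕ) * ψ (t i) ^ ((τ i : Fin n):ℕ)))) =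
          ((Equiv.Perm.sign σ : ℤ) : ℝ) * (((Equiv.Perm.sign τ : ℤ) : ℝ) * ∏ i, (A.submatrix σ id)ᵀ (τ i) i) := by
        intro τ
        rw [integral_const_mul, integral_const_mul,
          integral_fintype_prod_volume_eq_prod (fun i s => w s * (φ s ^ ((σ i : Fin n):ℕ) * ψ s ^ ((τ i : Fin n):ℕ)))]
        rfl
      simp only [e1]
      rw [← Finset.mul_sum, ← Matrix.det_apply', Matrix.det_transpose, Matrix.det_permute, ← mul_assoc]
      have : ((Equiv.Perm.sign σ : ℤ) : ℝ) * ((Equiv.Perm.sign σ : ℤ) : ℝ) = 1 := by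
        rcases Int.units_eq_one_or (Equiv.Perm.sign σ) with h | h <;> simp [h]
      rw [this, one_mul]
    simp only [this]
    simp [Fintype.card_perm]
  have h3 : 0 ≤ (n.factorial : ℝ) * A.det := by
    rw [← h2]
    refine integral_nonneg fun t => ?_
    by_cases ht : ∀ i, 0 < t i
    · refine mul_nonneg (Finset.prod_nonneg fun i _ => hw _) ?_
      rw [Matrix.det_vandermonde, Matrix.det_vandermonde, ← Finset.prod_mul_distrib]
      refine Finset.prod_nonneg fun i _ => ?_
      rw [← Finset.prod_mul_distrib]
      refine Finset.prod_nonneg fun j _ => ?_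
      rcases le_total (t i) (t j) with h | h
      · exact mul_nonneg (sub_nonneg.2 (hφ _ _ (ht i) h)) (sub_nonneg.2 (hψ _ _ (ht i) h))
      · exact mul_nonneg_of_nonpos_of_nonpos (sub_nonpos.2 (hφ _ _ (ht j) h)) (sub_nonpos.2 (hψ _ _ (ht j) h))
    · push Not at ht
      obtain ⟨i, hi⟩ := ht
      rw [Finset.prod_eq_zero (Finset.mem_univ i) (hw0 _ hi), zero_mul]
      exact le_rfl
  exact nonneg_of_mul_nonneg_right h3 (by exact_mod_cast n.factorial_pos)

lemma besselK0_int {t : ℝ} (ht : 0 < t) : IntegrableOn (fun v : ℝ => Real.exp (-(t * Real.cosh v))) (Set.Ioi 0) := by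
  have h := (KQ_integrable 0 (z := t) (by simpa using ht)).re
  refine h.congr (Eventually.of_forall fun v => ?_)
  have : (((Real.cosh v : ℝ) : ℂ) ^ 0 * Complex.exp (-((t:ℂ) * (Real.cosh v : ℂ)))) = ((Real.exp (-(t * Real.cosh v)) : ℝ) : ℂ) := by
    push_cast; ring
  simp only [this]
  exact Complex.ofReal_re _

lemma besselK0_pos {t : ℝ} (ht : 0 < t) : 0 < besselK0 t := by
  rw [besselK0, setIntegral_pos_iff_support_of_nonneg_ae _ (besselK0_int ht)]
  · have : (Function.support fun v : ℝ => Real.exp (-(t * Real.cosh v))) = Set.univ := by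
      ext v; simp [(Real.exp_pos _).ne']
    rw [this, Set.univ_inter, Real.volume_Ioi]
    exact ENNReal.zero_lt_top
  · exact Eventually.of_forall fun v => (Real.exp_pos _).le

lemma besselK0_anti {s t : ℝ} (hs : 0 < s) (h : s ≤ t) : besselK0 t ≤ besselK0 s := by
  refine setIntegral_mono (besselK0_int (hs.trans_le h)) (besselK0_int hs) fun v => ?_
  have := Real.cosh_pos v
  simp only
  gcongr

lemma besselI0_neg (t : ℝ) : besselI0 (-t) = besselI0 t := by
  have h := Ic_even t
  rw [← Complex.ofReal_neg, Ic_ofReal, Ic_ofReal] at h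
  exact_mod_cast h

lemma besselI0_cosh (t : ℝ) : besselI0 t = (1 / Real.pi) * ∫ θ in (0:ℝ)..Real.pi, Real.cosh (t * Real.cos θ) := by
  have h1 : besselI0 t = (besselI0 t + besselI0 (-t)) / 2 := by rw [besselI0_neg]; ring
  rw [h1, besselI0, besselI0, ← mul_add, ← intervalIntegral.integral_add
    (Continuous.intervalIntegrable (by fun_prop) _ _) (Continuous.intervalIntegrable (by fun_prop) _ _), mul_div_assoc,
    ← intervalIntegral.integral_div]
  congr 1
  refine intervalIntegral.integral_congr fun θ _ => ?_
  simp only [Real.cosh_eq, neg_mul]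

lemma besselI0_mono {s t : ℝ} (hs : 0 < s) (h : s ≤ t) : besselI0 s ≤ besselI0 t := by
  rw [besselI0_cosh, besselI0_cosh]
  have := Real.pi_pos
  refine mul_le_mul_of_nonneg_left ?_ (by positivity)
  refine intervalIntegral.integral_mono_on this.le (Continuous.intervalIntegrable (by fun_prop) _ _) (Continuous.intervalIntegrable (by fun_prop) _ _) fun θ _ => ?_
  rw [Real.cosh_le_cosh, abs_mul, abs_mul, abs_of_pos hs, abs_of_pos (hs.trans_le h)]
  gcongr

lemma IKM_det_nonneg {n p q : ℕ} (h : ∀ a, a < n → 2*a + p < q - 2*a) :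
    0 ≤ (Matrix.of fun a b : Fin n => IKM (2*a+p) (q-2*a) (2*b+1)).det := by
  set w : ℝ → ℝ := (Set.Ioi (0:ℝ)).indicator fun t => besselI0 t ^ p * besselK0 t ^ q * t with hw
  have key : ∀ a b : Fin n, (fun t => w t * (((besselI0 t / besselK0 t)^2) ^ (a:ℕ) * (t^2) ^ (b:ℕ))) =
     (Set.Ioi (0:ℝ)).indicator fun t => besselI0 t ^ (2*a.1+p) * besselK0 t ^ (q-2*a.1) * t ^ (2*b.1+1) := by
    intro a b
    ext t
    by_cases ht : t ∈ Set.Ioi (0:ℝ)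
    · rw [hw, Set.indicator_of_mem ht, Set.indicator_of_mem ht]
      have hk := (besselK0_pos ht).ne'
      have := h a a.2
      obtain ⟨r, hr⟩ : ∃ r, q = r + 2*a.1 := ⟨q - 2*a, by omega⟩
      rw [show q - 2*a.1 = r by omega, hr, ← pow_mul, ← pow_mul, div_pow, pow_add]
      field_simp
      ring
    · rw [hw, Set.indicator_of_notMem ht, Set.indicator_of_notMem ht, zero_mul]
  have e : (Matrix.of fun a b : Fin n => IKM (2*a+p) (q-2*a) (2*b+1)) =
      (Matrix.of fun a b : Fin n => ∫ t, w t * (((besselI0 t / besselK0 t)^2) ^ (a:ℕ) * (t^2) ^ (b:ℕ))) := by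
    ext a b
    rw [Matrix.of_apply, Matrix.of_apply, key a b, integral_indicator measurableSet_Ioi, IKM]
  rw [e]
  apply andreief_nonneg (φ := fun t => (besselI0 t / besselK0 t)^2) (ψ := fun t => t^2)
  · intro t
    refine Set.indicator_nonneg (fun t ht => ?_) t
    have := besselK0_pos ht
    have := besselI0_pos t
    have : 0 < t := ht
    positivity
  · intro t ht
    exact Set.indicator_of_notMem (by simpa using ht) _
  · intro s t hs hst
    have h1 := besselK0_pos (hs.trans_le hst)
    have h2 := besselI0_pos s
    have h3 := besselI0_mono hs hst
    have h4 := besselK0_anti hs hst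
    have h5 := besselK0_pos hs
    gcongr
    exact h2.le.trans h3
  · intro s t hs hst
    gcongr
  · intro a b
    have := h a a.2
    rw [key a b, integrable_indicator_iff measurableSet_Ioi]
    have h1 := (Gc_real_integrable (N := 2*a.1+p+(q-2*a.1)) (b := b.1) (n := q-2*a.1) (by omega) (by omega)).re
    refine (integrableOn_congr_fun (fun t ht => ?_) measurableSet_Ioi).1 h1
    rw [Gc_real ht, show 2*a.1+p+(q-2*a.1) - (q-2*a.1) = 2*a.1+p by omega]
    exact Complex.ofReal_re _

lemma MO_nonneg (k : ℕ) : 0 ≤ (MO k).det := by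
  have := IKM_det_nonneg (n := (k+1)/2) (p := 1) (q := 2*k) (by intro a ha; omega)
  exact this

lemma ME_nonneg (k : ℕ) : 0 ≤ (ME k).det := by
  have := IKM_det_nonneg (n := k/2) (p := 2) (q := 2*k-1) (by intro a ha; omega)
  exact this

end PartE3


section PartF

noncomputable def Xa (k a : ℕ) : ℝ := ((2*(k-2*a)+1 : ℕ):ℝ) * ((2*(k-1-2*a)+1 : ℕ):ℝ) / (Real.pi * ((k - a : ℕ):ℝ))^2

lemma cO_cE {k a : ℕ} (ha : a < k/2) : ((2*(k-2*a)+1 : ℕ):ℝ) * cO k a ^ 2 =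
    (((2*(k-1-2*a)+1 : ℕ):ℝ) * cE k a ^ 2) * Xa k a := by
  obtain ⟨p, hp⟩ : ∃ p, k = p + 2 + 2*a := ⟨k-2-2*a, by omega⟩
  unfold cO cE Xa
  rw [show k-1-2*a = p+1 by omega, show k-2-2*a = p by omega, show 2*k-2*a = (2*k-1-2*a)+1 by omega,
    Nat.factorial_succ, show 2*(p+1)+1 = 2*p+1+2 by ring, Nat.doubleFactorial_add_two,
    show 2*k-1-2*a+1 = 2*(k-a) by omega]
  have h1 : ((k-a:ℕ):ℝ) ≠ 0 := by
    have : k - a ≠ 0 := by omega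
    exact_mod_cast this
  have h2 : ((2*k-1-2*a).factorial : ℝ) ≠ 0 := by exact_mod_cast (Nat.factorial_pos _).ne'
  have h3 := Real.pi_ne_zero
  have h4 : ((2*p+1+2:ℕ):ℝ) ≠ 0 := by positivity
  push_cast at h4 ⊢
  rw [show 2*a+2 = (2*a+1)+1 by ring, pow_succ (Real.pi/2) (2*a+1)]
  field_simp

lemma prod_even (m : ℕ) : ∏ a ∈ Finset.range m, ((2*(2*m-2*a)+1) * (2*(2*m-1-2*a)+1)) = (4*m+1).doubleFactorial := by
  induction m with
  | zero => simp
  | succ m ih =>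
    rw [Finset.prod_range_succ']
    have : ∀ a, (2*(2*(m+1)-2*(a+1))+1) * (2*(2*(m+1)-1-2*(a+1))+1) = (2*(2*m-2*a)+1) * (2*(2*m-1-2*a)+1) := by
      intro a
      rw [show 2*(m+1)-2*(a+1) = 2*m-2*a by omega, show 2*(m+1)-1-2*(a+1) = 2*m-1-2*a by omega]
    simp only [this]
    rw [ih, show 4*(m+1)+1 = (4*m+1+2)+2 by ring, Nat.doubleFactorial_add_two, Nat.doubleFactorial_add_two,
      show 2*(m+1) - 2*0 = 2*m+2 by omega, show 2*(m+1)-1-2*0 = 2*m+1 by omega]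
    ring

lemma prod_odd (m : ℕ) : (∏ a ∈ Finset.range m, ((2*(2*m+1-2*a)+1) * (2*(2*m+1-1-2*a)+1))) * 3 = (4*m+3).doubleFactorial := by
  induction m with
  | zero => simp [Nat.doubleFactorial]
  | succ m ih =>
    rw [Finset.prod_range_succ']
    have : ∀ a, (2*(2*(m+1)+1-2*(a+1))+1) * (2*(2*(m+1)+1-1-2*(a+1))+1) = (2*(2*m+1-2*a)+1) * (2*(2*m+1-1-2*a)+1) := by
      intro a
      rw [show 2*(m+1)+1-2*(a+1) = 2*m+1-2*a by omega, show 2*(m+1)+1-1-2*(a+1) = 2*m+1-1-2*a by omega]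
    simp only [this]
    rw [show 4*(m+1)+3 = (4*m+3+2)+2 by ring, Nat.doubleFactorial_add_two, Nat.doubleFactorial_add_two, ← ih,
      show 2*(m+1)+1 - 2*0 = 2*m+3 by omega, show 2*(m+1)+1-1-2*0 = 2*m+2 by omega]
    ring

lemma prod_sub_even (m : ℕ) : ∏ a ∈ Finset.range m, (2*m - a) = 2^m * (2*m-1).doubleFactorial := by
  rw [← Nat.descFactorial_eq_prod_range]
  have h := Nat.factorial_mul_descFactorial (show m ≤ 2*m by omega)
  rw [show 2*m-m = m by omega] at h
  have h2 : (2*m).factorial = 2^m * m.factorial * (2*m-1).doubleFactorial := by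
    rcases m with _ | m
    · simp
    · rw [show 2*(m+1) = (2*m+1)+1 by ring, Nat.factorial_eq_mul_doubleFactorial, show 2*m+1+1 = 2*(m+1) by ring,
        Nat.doubleFactorial_two_mul]
      rfl
  have h3 := m.factorial_pos
  apply Nat.eq_of_mul_eq_mul_left h3
  rw [h, h2]; ring

lemma prod_sub_odd (m : ℕ) : (∏ a ∈ Finset.range m, (2*m+1 - a)) * (2*m+2).factorial =
    2 * (2^m * (2*m).doubleFactorial * (2*m+1).doubleFactorial^2) := by
  rw [← Nat.descFactorial_eq_prod_range]
  have h := Nat.factorial_mul_descFactorial (show m ≤ 2*m+1 by omega)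
  rw [show 2*m+1-m = m+1 by omega] at h
  have h1 : (2*m+1).factorial = (2*m+1).doubleFactorial * (2*m).doubleFactorial := Nat.factorial_eq_mul_doubleFactorial _
  have h2 : (2*m+2).factorial = 2^(m+1) * (m+1).factorial * (2*m+1).doubleFactorial := by
    rw [show 2*m+2 = (2*m+1)+1 by ring, Nat.factorial_eq_mul_doubleFactorial, show 2*m+1+1 = 2*(m+1) by ring,
        Nat.doubleFactorial_two_mul]
  rw [h2]
  rw [h1] at h
  calc _ = 2^(m+1) * (2*m+1).doubleFactorial * ((m+1).factorial * (2*m+1).descFactorial m) := by ring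
    _ = _ := by rw [h]; ring

noncomputable def refC (k : ℕ) : ℝ := Real.pi ^ (-(((k + 1) / 2 : ℕ) : ℤ)) *
      ((Nat.doubleFactorial (2 * k + 1) : ℝ) ^ (((2 : ℝ) - (-1 : ℝ) ^ k) / 2) /
        (2 ^ (k / 2) * (Nat.doubleFactorial (k - 1) : ℝ) *
          (Nat.doubleFactorial k : ℝ) ^ ((1 : ℝ) - (-1 : ℝ) ^ k)))

lemma refC_nonneg (k : ℕ) : 0 ≤ refC k := by
  have := Real.pi_pos
  unfold refC
  positivity

lemma refC_even (m : ℕ) : refC (2*m) ^ 2 = (4*m+1).doubleFactorial / (Real.pi^m * (2^m * (2*m-1).doubleFactorial))^2 := by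
  have h1 : (-1:ℝ)^(2*m) = 1 := by rw [pow_mul]; norm_num
  have h2 := Real.pi_ne_zero
  rw [refC, h1, show (2*m+1)/2 = m by omega, show 2*m/2 = m by omega, show 2*(2*m)+1 = 4*m+1 by ring, sub_self, Real.rpow_zero,
    mul_one, show ((2:ℝ)-1)/2 = 1/2 by norm_num, ← Real.sqrt_eq_rpow, mul_pow, div_pow, Real.sq_sqrt (by positivity),
    _root_.zpow_neg, zpow_natCast]
  field_simp

lemma refC_odd (m : ℕ) : refC (2*m+1) ^ 2 = ((4*m+3).doubleFactorial:ℝ)^3 / (Real.pi^(m+1) * (2^m * (2*m).doubleFactorial * ((2*m+1).doubleFactorial:ℝ)^2))^2 := by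
  have h1 : (-1:ℝ)^(2*m+1) = -1 := by rw [pow_succ, pow_mul]; norm_num
  have h2 := Real.pi_ne_zero
  have h3 : ((4*m+3).doubleFactorial : ℝ) ^ (((2:ℝ)- -1)/2) = √((4*m+3).doubleFactorial : ℝ) ^ 3 := by
    rw [Real.sqrt_eq_rpow, ← Real.rpow_natCast, ← Real.rpow_mul (by positivity)]
    norm_num
  have h4 : ((2*m+1).doubleFactorial : ℝ) ^ ((1:ℝ) - -1) = ((2*m+1).doubleFactorial : ℝ)^2 := by
    rw [← Real.rpow_natCast]; norm_num
  rw [refC, h1, show (2*m+1+1)/2 = m+1 by omega, show (2*m+1)/2 = m by omega, show 2*(2*m+1)+1 = 4*m+3 by ring, h3, h4,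
    mul_pow, div_pow, ← pow_mul, mul_comm 3 2, pow_mul, Real.sq_sqrt (by positivity),
    _root_.zpow_neg, zpow_natCast, show 2*m+1-1 = 2*m by omega]
  field_simp

lemma Xa_prod (k : ℕ) : ∏ a ∈ Finset.range (k/2), Xa k a =
    ((∏ a ∈ Finset.range (k/2), ((2*(k-2*a)+1) * (2*(k-1-2*a)+1)) : ℕ) : ℝ) / (Real.pi^(k/2) * ((∏ a ∈ Finset.range (k/2), (k-a) : ℕ) : ℝ))^2 := by
  unfold Xa
  rw [Finset.prod_div_distrib, Finset.prod_pow, Finset.prod_mul_distrib (f := fun _ => Real.pi)]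
  simp

theorem const_id (k : ℕ) : (∏ a ∈ Finset.range ((k+1)/2), ((2*(k-2*a)+1 : ℕ):ℝ) * cO k a ^ 2) =
    (if Even k then 1 else (Real.pi/2)^(2*k+2) / ((2*k+1).doubleFactorial : ℝ)^2) *
    (∏ a ∈ Finset.range (k/2), ((2*(k-1-2*a)+1 : ℕ):ℝ) * cE k a ^ 2) * refC k ^ 2 := by
  have h1 : (∏ a ∈ Finset.range (k/2), ((2*(k-2*a)+1 : ℕ):ℝ) * cO k a ^ 2) = (∏ a ∈ Finset.range (k/2), ((2*(k-1-2*a)+1 : ℕ):ℝ) * cE k a ^ 2) * ∏ a ∈ Finset.range (k/2), Xa k a := by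
    rw [← Finset.prod_mul_distrib]
    exact Finset.prod_congr rfl fun a ha => cO_cE (Finset.mem_range.1 ha)
  have hpi := Real.pi_ne_zero
  rcases Nat.even_or_odd' k with ⟨m, rfl | rfl⟩
  · rw [if_pos (by simp), one_mul, show (2*m+1)/2 = 2*m/2 by omega, h1, refC_even, Xa_prod]
    congr 1
    rw [show 2*m/2 = m by omega, prod_even, prod_sub_even]
    push_cast; rfl
  · rw [if_neg (by simp), show (2*m+1+1)/2 = (2*m+1)/2+1 by omega, Finset.prod_range_succ, h1, refC_odd, Xa_prod]
    set PE := ∏ a ∈ Finset.range ((2*m+1)/2), ((2*(2*m+1-1-2*a)+1 : ℕ):ℝ) * cE (2*m+1) a ^ 2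
    rw [show (2*m+1)/2 = m by omega]
    have e1 : (((∏ a ∈ Finset.range m, ((2*(2*m+1-2*a)+1) * (2*(2*m+1-1-2*a)+1)) : ℕ) : ℝ)) = ((4*m+3).doubleFactorial : ℝ) / 3 := by
      rw [← prod_odd]; push_cast; ring
    have hf : ((2*m+2).factorial : ℝ) ≠ 0 := by exact_mod_cast (Nat.factorial_pos _).ne'
    have e2 : ((∏ a ∈ Finset.range m, (2*m+1 - a) : ℕ) : ℝ) =
       2 * (2^m * (2*m).doubleFactorial * ((2*m+1).doubleFactorial:ℝ)^2) / (2*m+2).factorial := by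
      rw [eq_div_iff hf]; exact_mod_cast prod_sub_odd m
    rw [e1, e2, cO, show 2*m+1-1-2*m = 0 by omega, show 2*m+1-2*m = 1 by omega, show 2*(2*m+1)-2*m = 2*m+2 by omega,
      show 2*(2*m+1)+1 = 4*m+3 by ring]
    have hd1 : ((4*m+3).doubleFactorial : ℝ) ≠ 0 := by exact_mod_cast (Nat.doubleFactorial_pos _).ne'
    have hd2 : ((2*m).doubleFactorial : ℝ) ≠ 0 := by exact_mod_cast (Nat.doubleFactorial_pos _).ne'
    have hd3 : ((2*m+1).doubleFactorial : ℝ) ≠ 0 := by exact_mod_cast (Nat.doubleFactorial_pos _).ne'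
    have e3 : (Real.pi/2)^(2*(2*m+1)+2) = ((Real.pi/2)^(2*m+1))^2 * (Real.pi/2)^2 := by ring
    rw [e3]
    have e4 : ((2*0+1).doubleFactorial : ℝ) = 1 := by simp
    rw [e4]
    clear e1 e2 e3 e4 h1
    generalize ((4*m+3).doubleFactorial : ℝ) = D at *
    generalize ((2*m).doubleFactorial : ℝ) = D2 at *
    generalize ((2*m+1).doubleFactorial : ℝ) = D3 at *
    push_cast
    rw [pow_succ Real.pi m]
    field_simp

theorem ME_eq (k : ℕ) : (ME k).det = refC k * (MO k).det := by
  have h := partE k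
  rw [const_id] at h
  have hpi := Real.pi_pos
  have h1 : 0 < (if Even k then 1 else (Real.pi/2)^(2*k+2) / ((2*k+1).doubleFactorial : ℝ)^2) := by
    have : (0:ℝ) < ((2*k+1).doubleFactorial : ℝ) := by exact_mod_cast Nat.doubleFactorial_pos _
    split_ifs <;> positivity
  have h2 : 0 < ∏ a ∈ Finset.range (k/2), ((2*(k-1-2*a)+1 : ℕ):ℝ) * cE k a ^ 2 := by
    refine Finset.prod_pos fun a _ => ?_
    have : (0:ℝ) < ((2*(k-2-2*a)+1).doubleFactorial : ℝ) := by exact_mod_cast Nat.doubleFactorial_pos _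
    have : (0:ℝ) < ((2*k-1-2*a).factorial : ℝ) := by exact_mod_cast Nat.factorial_pos _
    unfold cE
    positivity
  have h3 : (ME k).det ^ 2 = (refC k * (MO k).det) ^ 2 := by
    apply mul_left_cancel₀ (mul_pos h1 h2).ne'
    rw [← h]; ring
  exact (sq_eq_sq₀ (ME_nonneg k) (mul_nonneg (refC_nonneg k) (MO_nonneg k))).1 h3

end PartF


/-- reflection formula for minor determinants of the on-shell Bessel
moment matrix `M_k`. -/
theorem reflection_minor_determinants (k : ℕ) (hk : 2 ≤ k) :
    Matrix.det
      (Matrix.of fun a b : Fin (k / 2) =>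
        IKM (2 * ((a : ℕ) + 1)) (2 * (k - ((a : ℕ) + 1)) + 1) (2 * ((b : ℕ) + 1) - 1)) =
    Real.pi ^ (-(((k + 1) / 2 : ℕ) : ℤ)) *
      ((Nat.doubleFactorial (2 * k + 1) : ℝ) ^ (((2 : ℝ) - (-1 : ℝ) ^ k) / 2) /
        (2 ^ (k / 2) * (Nat.doubleFactorial (k - 1) : ℝ) *
          (Nat.doubleFactorial k : ℝ) ^ ((1 : ℝ) - (-1 : ℝ) ^ k))) *
      Matrix.det
        (Matrix.of fun a b : Fin ((k + 1) / 2) =>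
          IKM (2 * ((a : ℕ) + 1) - 1) (2 * (k - ((a : ℕ) + 1) + 1)) (2 * ((b : ℕ) + 1) - 1)) := by
  have h := ME_eq k
  have e1 : (Matrix.of fun a b : Fin (k / 2) =>
        IKM (2 * ((a : ℕ) + 1)) (2 * (k - ((a : ℕ) + 1)) + 1) (2 * ((b : ℕ) + 1) - 1)) = ME k := by
    ext a b
    have := a.2
    rw [ME, Matrix.of_apply, Matrix.of_apply, show 2 * (a.1 + 1) = 2 * a.1 + 2 by ring,
      show 2 * (k - (a.1 + 1)) + 1 = 2 * k - 1 - 2 * a.1 by omega,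
      show 2 * (b.1 + 1) - 1 = 2 * b.1 + 1 by omega]
  have e2 : (Matrix.of fun a b : Fin ((k + 1) / 2) =>
          IKM (2 * ((a : ℕ) + 1) - 1) (2 * (k - ((a : ℕ) + 1) + 1)) (2 * ((b : ℕ) + 1) - 1)) = MO k := by
    ext a b
    have := a.2
    rw [MO, Matrix.of_apply, Matrix.of_apply, show 2 * (a.1 + 1) - 1 = 2 * a.1 + 1 by omega,
      show 2 * (k - (a.1 + 1) + 1) = 2 * k - 2 * a.1 by omega,
      show 2 * (b.1 + 1) - 1 = 2 * b.1 + 1 by omega]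
  rw [e1, e2, h, refC]
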